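/- Let d ≥ 4, (2d−2)/(d−3) < q < ∞ and α = d(1/2 − 1/q) − 1/2. Let η∘ be a radial Schwartz function whose Fourier transform is supported in {1/2 < |ξ| < 2} and satisfies ∑_{s∈ℤ} [η̂∘(2^{−s}ξ)]² = 1 for all ξ ≠ 0; define P_k for integers k > 0 by (P_k f)^(ξ) = [η̂∘(2^{−k}ξ)]² f̂(ξ) and P_0 = I − ∑_{k≥1} P_k. Then there is a constant C such that for every Schwartz function f, (∫_1^2 ‖ ∑_{k≥0} |P_k e^{it√(−Δ)} f| ‖_{L^q(ℝ^d)}^q dt)^{1/q} ≤ C (∑_{k≥0} 2^{kαq} ‖P_k f‖_{L^q(ℝ^d)}^q)^{1/q}. -/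

import Mathlib

open MeasureTheory Metric Set
open scoped FourierTransform ENNReal NNReal

noncomputable section

abbrev Ed (d : ℕ) := EuclideanSpace ℝ (Fin d)

/-- The wave propagator `e^{it√(-Δ)}`. -/
def waveOp (d : ℕ) (t : ℝ) (f : Ed d → ℂ) : Ed d → ℂ :=
  𝓕⁻ (fun ξ => Complex.exp (Complex.I * (t : ℂ) * (‖ξ‖ : ℂ)) * 𝓕 f ξ)

/-- The multiplier of the Littlewood–Paley piece `P_k` built from `η∘`:
`m_k(ξ) = (η̂∘(2^{-k}ξ))²` for `k ≥ 1`, and `m₀ = 1 - ∑_{k≥1} m_k`. -/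
def lpMult (d : ℕ) (η₀ : SchwartzMap (Ed d) ℂ) (k : ℕ) : Ed d → ℂ :=
  if k = 0 then
    fun ξ => 1 - ∑' j : ℕ, (𝓕 (⇑η₀) ((2 : ℝ) ^ (-((j : ℤ) + 1)) • ξ)) ^ 2
  else fun ξ => (𝓕 (⇑η₀) ((2 : ℝ) ^ (-(k : ℤ)) • ξ)) ^ 2

/-- The Littlewood–Paley projection `P_k`. -/
def Pk (d : ℕ) (η₀ : SchwartzMap (Ed d) ℂ) (k : ℕ) (f : Ed d → ℂ) : Ed d → ℂ :=
  𝓕⁻ (fun ξ => lpMult d η₀ k ξ * 𝓕 f ξ)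

lemma exp_abs_integrable : Integrable (fun x : ℝ => (Real.exp (-|x|) : ℂ)) := by
  have h : Integrable (fun x : ℝ => Real.exp (-|x|)) := by
    apply Integrable.of_integral_ne_zero
    rw [integral_comp_abs (f := fun x => Real.exp (-x)), integral_exp_neg_Ioi]
    simp
  exact h.ofReal

lemma fourier_exp_abs (w : ℝ) : 𝓕 (fun x : ℝ => (Real.exp (-|x|) : ℂ)) w =
    ((2 / (1 + 4 * Real.pi ^ 2 * w ^ 2) : ℝ) : ℂ) := by
  rw [Real.fourier_real_eq_integral_exp_smul]
  have hint : Integrable (fun v : ℝ => Complex.exp (↑(-2 * Real.pi * v * w) * Complex.I) • (Real.exp (-|v|) : ℂ)) := by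
    refine exp_abs_integrable.bdd_mul (c := 1) (by fun_prop) ?_
    filter_upwards with v
    rw [Complex.norm_exp_ofReal_mul_I]
  rw [← intervalIntegral.integral_Iic_add_Ioi (b := 0) hint.integrableOn hint.integrableOn]
  have h1 : ∫ v in Iic (0:ℝ), Complex.exp (↑(-2 * Real.pi * v * w) * Complex.I) • (Real.exp (-|v|) : ℂ)
      = ∫ v in Iic (0:ℝ), Complex.exp ((1 - 2 * Real.pi * w * Complex.I) * v) := by
    refine setIntegral_congr_fun measurableSet_Iic ?_
    intro v hv
    simp only [mem_Iic] at hv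
    simp only [smul_eq_mul, abs_of_nonpos hv, Complex.ofReal_exp, ← Complex.exp_add]
    congr 1; push_cast; ring
  have h2 : ∫ v in Ioi (0:ℝ), Complex.exp (↑(-2 * Real.pi * v * w) * Complex.I) • (Real.exp (-|v|) : ℂ)
      = ∫ v in Ioi (0:ℝ), Complex.exp ((-1 - 2 * Real.pi * w * Complex.I) * v) := by
    refine setIntegral_congr_fun measurableSet_Ioi ?_
    intro v hv
    simp only [mem_Ioi] at hv
    simp only [smul_eq_mul, abs_of_pos hv, Complex.ofReal_exp, ← Complex.exp_add]
    congr 1; push_cast; ring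
  rw [h1, h2, integral_exp_mul_complex_Iic (by simp), integral_exp_mul_complex_Ioi (by simp)]
  have e1 : (1 - 2 * Real.pi * w * Complex.I : ℂ) ≠ 0 := by
    intro h; have := congrArg Complex.re h; simp at this
  have e2 : (-1 - 2 * Real.pi * w * Complex.I : ℂ) ≠ 0 := by
    intro h; have := congrArg Complex.re h; simp at this
  have e3 : (1 + 4 * Real.pi ^ 2 * w ^ 2 : ℂ) ≠ 0 := by
    have : (1 + 4 * Real.pi ^ 2 * w ^ 2 : ℝ) ≠ 0 := by positivity
    exact_mod_cast this
  simp only [Complex.ofReal_zero, mul_zero, Complex.exp_zero]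
  push_cast
  have e4 : (1 + 4 * Real.pi ^ 2 * w ^ 2 : ℂ) = -((1 - 2 * Real.pi * w * Complex.I) * (-1 - 2 * Real.pi * w * Complex.I)) := by
    ring_nf
    simp only [Complex.I_sq]
    ring
  rw [e4]
  field_simp
  ring

lemma integrable_cauchy : Integrable (fun w : ℝ => ((2 / (1 + 4 * Real.pi ^ 2 * w ^ 2) : ℝ) : ℂ)) := by
  have h := (integrable_inv_one_add_sq.comp_mul_left' (R := 2 * Real.pi) (by positivity)).const_mul 2
  refine Integrable.ofReal (h.congr ?_)
  filter_upwards with w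
  show 2 * (1 + (2 * Real.pi * w) ^ 2)⁻¹ = 2 / (1 + 4 * Real.pi ^ 2 * w ^ 2)
  rw [div_eq_mul_inv]; congr 2; ring

/-- subordination -/
lemma subord (a : ℝ) (ha : 0 ≤ a) :
    Real.exp (-a) = ∫ s in Ioi (0:ℝ), (Real.pi * s) ^ (-(1/2) : ℝ) * Real.exp (-s) * Real.exp (-a ^ 2 / (4 * s)) := by
  have hinv := Continuous.fourierInv_fourier_eq (f := fun x : ℝ => (Real.exp (-|x|) : ℂ)) (by fun_prop)
    exp_abs_integrable (by
      refine integrable_cauchy.congr ?_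
      filter_upwards with w
      rw [fourier_exp_abs])
  have h1 := congrFun hinv a
  rw [show 𝓕 (fun x : ℝ => (Real.exp (-|x|) : ℂ)) = fun w => ((2 / (1 + 4 * Real.pi ^ 2 * w ^ 2) : ℝ) : ℂ) from
    funext fourier_exp_abs, Real.fourierInv_eq'] at h1
  simp only [abs_of_nonneg ha] at h1
  -- double integral
  let F : ℝ → ℝ → ℂ := fun w s => Complex.exp (↑(2 * Real.pi * inner ℝ w a) * Complex.I) •
    ((2 * Real.exp (-(1 + 4 * Real.pi ^ 2 * w ^ 2) * s) : ℝ) : ℂ)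
  have hG : ∀ w : ℝ, ∫ s in Ioi (0:ℝ), 2 * Real.exp (-(1 + 4 * Real.pi ^ 2 * w ^ 2) * s) = 2 / (1 + 4 * Real.pi ^ 2 * w ^ 2) := by
    intro w
    have hc : 0 < 1 + 4 * Real.pi ^ 2 * w ^ 2 := by positivity
    rw [integral_const_mul, integral_exp_mul_Ioi (by linarith)]
    simp only [mul_zero, Real.exp_zero]
    rw [neg_div_neg_eq]; ring
  have hF1 : ∀ w, ∫ s in Ioi (0:ℝ), F w s = Complex.exp (↑(2 * Real.pi * inner ℝ w a) * Complex.I) •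
      ((2 / (1 + 4 * Real.pi ^ 2 * w ^ 2) : ℝ) : ℂ) := by
    intro w
    simp only [F, smul_eq_mul]
    rw [integral_const_mul, integral_complex_ofReal]
    congr 2
    exact hG w
  have hFm : Integrable (Function.uncurry F) (volume.prod (volume.restrict (Ioi 0))) := by
    have hn : ∀ w s, ‖F w s‖ = 2 * Real.exp (-(1 + 4 * Real.pi ^ 2 * w ^ 2) * s) := by
      intro w s
      simp only [F, smul_eq_mul, norm_mul, Complex.norm_exp_ofReal_mul_I, one_mul, Complex.norm_real]
      rw [Real.norm_of_nonneg (by positivity), Real.norm_of_nonneg (by positivity)]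
    have hcont : Continuous (Function.uncurry F) := by
      simp only [F, Function.uncurry_def]
      fun_prop
    rw [integrable_prod_iff hcont.aestronglyMeasurable]
    constructor
    · filter_upwards with w
      have hc : 0 < 1 + 4 * Real.pi ^ 2 * w ^ 2 := by positivity
      have := (integrableOn_exp_mul_Ioi (a := -(1 + 4 * Real.pi ^ 2 * w ^ 2)) (by linarith) 0).const_mul 2
      refine Integrable.mono' this (by
        apply Continuous.aestronglyMeasurable
        exact hcont.comp (by fun_prop)) ?_
      filter_upwards with s
      exact (hn w s).le
    · have : (fun w => ∫ s in Ioi (0:ℝ), ‖Function.uncurry F (w, s)‖) = fun w => (2 / (1 + 4 * Real.pi ^ 2 * w ^ 2)) := by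
        ext w
        simp only [Function.uncurry_apply_pair, hn]
        exact hG w
      rw [this]
      have := integrable_cauchy.re
      refine this.congr ?_
      filter_upwards with w
      exact Complex.ofReal_re _
  rw [← Complex.ofReal_inj, ← h1, ← integral_complex_ofReal]
  simp_rw [← hF1]
  rw [integral_integral_swap hFm]
  refine setIntegral_congr_fun measurableSet_Ioi ?_
  intro s hs
  simp only [mem_Ioi] at hs
  have hg := fourier_gaussian_innerProductSpace (V := ℝ) (b := (4 * Real.pi ^ 2 * s : ℝ)) (by rw [Complex.ofReal_re]; positivity) (-a)
  rw [← Real.fourierInv_eq_fourier_neg, Real.fourierInv_eq'] at hg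
  have hF2 : ∀ w, F w s = (2 * Real.exp (-s) : ℝ) * (Complex.exp (↑(2 * Real.pi * inner ℝ w a) * Complex.I) • Complex.exp (-((4 * Real.pi ^ 2 * s : ℝ) : ℂ) * (‖w‖ : ℂ) ^ 2)) := by
    intro w
    simp only [F, smul_eq_mul]
    rw [show -(1 + 4 * Real.pi ^ 2 * w ^ 2) * s = -s + -(4 * Real.pi ^ 2 * s) * ‖w‖ ^ 2 by
      rw [Real.norm_eq_abs, sq_abs]; ring, Real.exp_add]
    push_cast
    ring
  simp_rw [hF2]
  rw [integral_const_mul, hg]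
  have e1 : ((Real.pi : ℂ) / ((4 * Real.pi ^ 2 * s : ℝ) : ℂ)) ^ ((Module.finrank ℝ ℝ : ℂ) / 2) = (((Real.pi * s) ^ (-(1/2) : ℝ) / 2 : ℝ) : ℂ) := by
    rw [← Complex.ofReal_div, Module.finrank_self]
    have : ((1 : ℕ) : ℂ) / 2 = ((1/2 : ℝ) : ℂ) := by push_cast; ring
    rw [this, ← Complex.ofReal_cpow (by positivity)]
    congr 1
    have hp := Real.pi_pos
    rw [show Real.pi / (4 * Real.pi ^ 2 * s) = (1/2)^2 * (Real.pi * s)⁻¹ by field_simp; norm_num,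
      Real.mul_rpow (by positivity) (by positivity), Real.inv_rpow (by positivity), Real.rpow_neg (by positivity),
      ← Real.sqrt_eq_rpow, Real.sqrt_sq (by positivity)]
    ring
  rw [e1]
  have e2 : Complex.exp (-(Real.pi : ℂ) ^ 2 * (‖-a‖ : ℂ) ^ 2 / ((4 * Real.pi ^ 2 * s : ℝ) : ℂ)) = ((Real.exp (-a ^ 2 / (4 * s)) : ℝ) : ℂ) := by
    rw [Complex.ofReal_exp]
    congr 1
    rw [norm_neg, Real.norm_of_nonneg ha]
    push_cast
    have hp : (Real.pi : ℂ) ≠ 0 := by exact_mod_cast Real.pi_ne_zero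
    have hs' : (s : ℂ) ≠ 0 := by exact_mod_cast hs.ne'
    field_simp
  rw [e2]
  push_cast
  ring

lemma integrable_pow_exp (d m : ℕ) {a : ℝ} (ha : 0 < a) :
    Integrable (fun ξ : Ed d => ‖ξ‖ ^ m * Real.exp (-a * ‖ξ‖)) := by
  have h1 := (integrable_one_add_norm (E := Ed d) (μ := volume) (r := (d + 1 : ℕ)) (by simp)).const_mul
    (((m + d + 1).factorial : ℝ) / a ^ (m + d + 1) * Real.exp a)
  refine h1.mono' (by apply Continuous.aestronglyMeasurable; fun_prop) ?_
  filter_upwards with ξ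
  rw [Real.norm_of_nonneg (by positivity)]
  set r := ‖ξ‖ with hr
  have hr0 : 0 ≤ r := norm_nonneg _
  have h2 := Real.pow_div_factorial_le_exp (a * (1 + r)) (by positivity) (m + d + 1)
  rw [Real.rpow_neg (by positivity), Real.rpow_natCast]
  have h3 : Real.exp (-a * r) = Real.exp a / Real.exp (a * (1 + r)) := by
    rw [← Real.exp_sub]; congr 1; ring
  rw [h3]
  have h4 : r ^ m ≤ (1 + r) ^ m := pow_le_pow_left₀ hr0 (by linarith) _
  have h5 : (1 + r) ^ m / Real.exp (a * (1 + r)) ≤ ((m + d + 1).factorial : ℝ) / a ^ (m + d + 1) * ((1 + r) ^ (d + 1))⁻¹ := by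
    rw [div_le_iff₀ (Real.exp_pos _)]
    rw [div_le_iff₀ (by positivity), mul_pow] at h2
    calc (1 + r) ^ m = (a ^ (m + d + 1) * (1 + r) ^ (m + d + 1)) / a ^ (m + d + 1) * ((1 + r) ^ (d + 1))⁻¹ := by
          rw [add_assoc, pow_add (1 + r)]; field_simp
      _ ≤ (Real.exp (a * (1 + r)) * (m + d + 1).factorial) / a ^ (m + d + 1) * ((1 + r) ^ (d + 1))⁻¹ := by gcongr
      _ = _ := by ring
  calc r ^ m * (Real.exp a / Real.exp (a * (1 + r))) ≤ (1 + r) ^ m * (Real.exp a / Real.exp (a * (1 + r))) := by gcongr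
    _ = Real.exp a * ((1 + r) ^ m / Real.exp (a * (1 + r))) := by ring
    _ ≤ Real.exp a * (((m + d + 1).factorial : ℝ) / a ^ (m + d + 1) * ((1 + r) ^ (d + 1))⁻¹) := by gcongr
    _ = _ := by ring

/-- the multiplier `‖ξ‖^m e^{-z‖ξ‖}`. -/
def Mz (d m : ℕ) (z : ℂ) : Ed d → ℂ := fun ξ => (‖ξ‖ : ℂ) ^ m * Complex.exp (-z * ‖ξ‖)

lemma norm_Mz (d m : ℕ) (z : ℂ) (ξ : Ed d) : ‖Mz d m z ξ‖ = ‖ξ‖ ^ m * Real.exp (-z.re * ‖ξ‖) := by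
  simp only [Mz, norm_mul, norm_pow, Complex.norm_real, norm_norm, Complex.norm_exp]
  congr 2
  simp

lemma continuous_Mz (d m : ℕ) (z : ℂ) : Continuous (Mz d m z) := by
  unfold Mz; fun_prop

lemma integrable_Mz (d m : ℕ) {z : ℂ} (hz : 0 < z.re) : Integrable (Mz d m z) := by
  rw [← integrable_norm_iff (continuous_Mz d m z).aestronglyMeasurable]
  simp_rw [norm_Mz]
  exact integrable_pow_exp d m hz

/-- its inverse Fourier transform. -/
def Kz (d m : ℕ) (z : ℂ) : Ed d → ℂ := 𝓕⁻ (Mz d m z)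

lemma Kz_eq (d m : ℕ) (z : ℂ) (x : Ed d) : Kz d m z x =
    ∫ v, Complex.exp (↑(2 * Real.pi * inner ℝ v x) * Complex.I) * Mz d m z v := by
  rw [Kz, Real.fourierInv_eq']; rfl

lemma hasDerivAt_Kz (d m : ℕ) {z : ℂ} (hz : 0 < z.re) (x : Ed d) :
    HasDerivAt (fun z => Kz d m z x) (-Kz d (m + 1) z x) z := by
  simp_rw [Kz_eq]
  rw [← integral_neg]
  have key := hasDerivAt_integral_of_dominated_loc_of_deriv_le (𝕜 := ℂ) (μ := (volume : Measure (Ed d)))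
    (F := fun z v => Complex.exp (↑(2 * Real.pi * inner ℝ v x) * Complex.I) * Mz d m z v)
    (F' := fun z v => -(Complex.exp (↑(2 * Real.pi * inner ℝ v x) * Complex.I) * Mz d (m + 1) z v))
    (x₀ := z) (s := {w | z.re / 2 < w.re}) (bound := fun v => ‖v‖ ^ (m + 1) * Real.exp (-(z.re / 2) * ‖v‖))
    ?_ ?_ ?_ ?_ ?_ ?_ ?_
  · exact key.2
  · exact (isOpen_lt continuous_const Complex.continuous_re).mem_nhds (show z.re / 2 < z.re by linarith)
  · filter_upwards with w
    apply Continuous.aestronglyMeasurable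
    have := continuous_Mz d m w
    fun_prop
  · refine (integrable_Mz d m hz).bdd_mul (c := 1) (by apply Continuous.aestronglyMeasurable; fun_prop) ?_
    filter_upwards with v
    rw [Complex.norm_exp_ofReal_mul_I]
  · apply Continuous.aestronglyMeasurable
    have := continuous_Mz d (m + 1) z
    fun_prop
  · filter_upwards with v w hw
    rw [norm_neg, norm_mul, Complex.norm_exp_ofReal_mul_I, one_mul, norm_Mz]
    have hw' : z.re / 2 < w.re := hw
    gcongr
  · exact integrable_pow_exp d (m + 1) (by linarith)
  · filter_upwards with v w hw
    have h1 : HasDerivAt (fun z => Mz d m z v) (-Mz d (m + 1) w v) w := by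
      unfold Mz
      have : HasDerivAt (fun z : ℂ => -z * (‖v‖ : ℂ)) (-1 * (‖v‖ : ℂ)) w := ((hasDerivAt_id w).neg).mul_const _
      have := (this.cexp).const_mul ((‖v‖ : ℂ) ^ m)
      refine this.congr_deriv ?_
      ring
    have := h1.const_mul (Complex.exp (↑(2 * Real.pi * inner ℝ v x) * Complex.I))
    refine this.congr_deriv ?_
    ring

lemma iteratedDeriv_Kz (d m : ℕ) {z : ℂ} (hz : 0 < z.re) (x : Ed d) :
    iteratedDeriv m (fun z => Kz d 0 z x) z = (-1) ^ m * Kz d m z x := by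
  induction m generalizing z with
  | zero => simp
  | succ m ih =>
    rw [iteratedDeriv_succ]
    have : iteratedDeriv m (fun z => Kz d 0 z x) =ᶠ[nhds z] fun z => (-1) ^ m * Kz d m z x := by
      filter_upwards [(isOpen_lt continuous_const Complex.continuous_re).mem_nhds hz] with w hw
      exact ih hw
    rw [this.deriv_eq, ((hasDerivAt_Kz d m hz x).const_mul _).deriv]
    ring

/-- the closed formula on the positive real axis -/
lemma Kz_real (d : ℕ) : ∃ c : ℝ, ∀ (z : ℝ), 0 < z → ∀ x : Ed d,
    Kz d 0 z x = ((c * z * (z ^ 2 + (2 * Real.pi * ‖x‖) ^ 2) ^ (-((d + 1 : ℝ) / 2)) : ℝ) : ℂ) := by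
  refine ⟨Real.pi ^ (-(1/2) : ℝ) * (4 * Real.pi) ^ ((d:ℝ)/2) * Real.Gamma ((d + 1 : ℝ) / 2), ?_⟩
  intro z hz x
  have hp := Real.pi_pos
  rw [Kz_eq]
  let F : Ed d → ℝ → ℂ := fun v s => Complex.exp (↑(2 * Real.pi * inner ℝ v x) * Complex.I) *
    (((Real.pi * s) ^ (-(1/2) : ℝ) * Real.exp (-s) * Real.exp (-(z * ‖v‖) ^ 2 / (4 * s)) : ℝ) : ℂ)
  have hF1 : ∀ v, ∫ s in Ioi (0:ℝ), F v s =
      Complex.exp (↑(2 * Real.pi * inner ℝ v x) * Complex.I) * Mz d 0 z v := by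
    intro v
    simp only [F]
    rw [integral_const_mul, integral_complex_ofReal, ← subord (z * ‖v‖) (by positivity)]
    simp [Mz]
  have hmeas : AEStronglyMeasurable (Function.uncurry F) (volume.prod (volume.restrict (Ioi 0))) := by
    apply Measurable.aestronglyMeasurable
    simp only [F, Function.uncurry_def]
    fun_prop
  have hn : ∀ v, ∀ s ∈ Ioi (0:ℝ), ‖F v s‖ = (Real.pi * s) ^ (-(1/2) : ℝ) * Real.exp (-s) * Real.exp (-(z * ‖v‖) ^ 2 / (4 * s)) := by
    intro v s hs
    simp only [mem_Ioi] at hs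
    simp only [F, norm_mul, Complex.norm_exp_ofReal_mul_I, one_mul, Complex.norm_real]
    rw [Real.norm_of_nonneg (by positivity), Real.norm_of_nonneg (by positivity), Real.norm_of_nonneg (by positivity)]
  have hFm : Integrable (Function.uncurry F) (volume.prod (volume.restrict (Ioi 0))) := by
    rw [integrable_prod_iff hmeas]
    constructor
    · filter_upwards with v
      have : IntegrableOn (fun s => (Real.pi * s) ^ (-(1/2) : ℝ) * Real.exp (-s) * Real.exp (-(z * ‖v‖) ^ 2 / (4 * s))) (Ioi 0) := by
        apply Integrable.of_integral_ne_zero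
        rw [← subord (z * ‖v‖) (by positivity)]
        exact (Real.exp_pos _).ne'
      refine Integrable.mono' this (by
        apply Measurable.aestronglyMeasurable
        simp only [F, Function.uncurry_def]
        fun_prop) ?_
      filter_upwards [ae_restrict_mem measurableSet_Ioi] with s hs
      exact (hn v s hs).le
    · have : (fun v => ∫ s in Ioi (0:ℝ), ‖Function.uncurry F (v, s)‖) = fun v => ‖v‖ ^ 0 * Real.exp (-z * ‖v‖) := by
        ext v
        simp only [Function.uncurry_apply_pair]
        rw [setIntegral_congr_fun measurableSet_Ioi (hn v), ← subord (z * ‖v‖) (by positivity)]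
        simp
      rw [this]
      exact integrable_pow_exp d 0 hz
  simp_rw [← hF1]
  rw [integral_integral_swap hFm]
  have hs1 : ∀ s ∈ Ioi (0:ℝ), ∫ v, F v s = ((Real.pi ^ (-(1/2) : ℝ) * (4 * Real.pi / z ^ 2) ^ ((d:ℝ)/2) *
      (s ^ ((d + 1 : ℝ) / 2 - 1) * Real.exp (-((1 + (2 * Real.pi * ‖x‖ / z) ^ 2) * s))) : ℝ) : ℂ) := by
    intro s hs
    simp only [mem_Ioi] at hs
    have hg := fourier_gaussian_innerProductSpace (V := Ed d) (b := (z ^ 2 / (4 * s) : ℝ)) (by rw [Complex.ofReal_re]; positivity) (-x)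
    rw [← Real.fourierInv_eq_fourier_neg, Real.fourierInv_eq'] at hg
    have hF2 : ∀ v, F v s = ((Real.pi * s) ^ (-(1/2) : ℝ) * Real.exp (-s) : ℝ) * (Complex.exp (↑(2 * Real.pi * inner ℝ v x) * Complex.I) • Complex.exp (-((z ^ 2 / (4 * s) : ℝ) : ℂ) * (‖v‖ : ℂ) ^ 2)) := by
      intro v
      simp only [F, smul_eq_mul]
      rw [show -(z * ‖v‖) ^ 2 / (4 * s) = -(z ^ 2 / (4 * s)) * ‖v‖ ^ 2 by ring]
      push_cast
      ring
    simp_rw [hF2]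
    rw [integral_const_mul, hg]
    have e1 : ((Real.pi : ℂ) / ((z ^ 2 / (4 * s) : ℝ) : ℂ)) ^ ((Module.finrank ℝ (Ed d) : ℂ) / 2) =
        (((4 * Real.pi / z ^ 2) ^ ((d:ℝ)/2) * s ^ ((d:ℝ)/2) : ℝ) : ℂ) := by
      rw [← Complex.ofReal_div, finrank_euclideanSpace_fin]
      have : (d : ℂ) / 2 = (((d:ℝ)/2 : ℝ) : ℂ) := by push_cast; ring
      rw [this, ← Complex.ofReal_cpow (by positivity), ← Real.mul_rpow (by positivity) (by positivity)]
      congr 2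
      field_simp
    have e2 : Complex.exp (-(Real.pi : ℂ) ^ 2 * (‖-x‖ : ℂ) ^ 2 / ((z ^ 2 / (4 * s) : ℝ) : ℂ)) = ((Real.exp (-(2 * Real.pi * ‖x‖ / z) ^ 2 * s) : ℝ) : ℂ) := by
      rw [Complex.ofReal_exp]
      congr 1
      rw [norm_neg]
      push_cast
      have hs' : (s : ℂ) ≠ 0 := by exact_mod_cast hs.ne'
      have hz' : (z : ℂ) ≠ 0 := by exact_mod_cast hz.ne'
      field_simp
      ring
    rw [e1, e2, ← Complex.ofReal_mul, ← Complex.ofReal_mul]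
    congr 1
    rw [Real.mul_rpow hp.le hs.le, show (d + 1 : ℝ) / 2 - 1 = -(1/2) + (d:ℝ)/2 by ring, Real.rpow_add hs,
      show -((1 + (2 * Real.pi * ‖x‖ / z) ^ 2) * s) = -s + -(2 * Real.pi * ‖x‖ / z) ^ 2 * s by ring, Real.exp_add]
    ring
  rw [setIntegral_congr_fun measurableSet_Ioi hs1, integral_complex_ofReal]
  congr 1
  rw [integral_const_mul, Real.integral_rpow_mul_exp_neg_mul_Ioi (by positivity) (by positivity)]
  have e3 : (1 / (1 + (2 * Real.pi * ‖x‖ / z) ^ 2)) = z ^ 2 * (z ^ 2 + (2 * Real.pi * ‖x‖) ^ 2)⁻¹ := by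
    field_simp
  rw [e3, Real.mul_rpow (by positivity) (by positivity), Real.inv_rpow (by positivity), ← Real.rpow_neg (by positivity),
    Real.div_rpow (by positivity) (by positivity)]
  have e4 : (z ^ 2) ^ ((d + 1 : ℝ) / 2) = z * (z ^ 2) ^ ((d : ℝ) / 2) := by
    rw [show (d + 1 : ℝ) / 2 = 1/2 + (d:ℝ)/2 by ring, Real.rpow_add (by positivity), ← Real.sqrt_eq_rpow, Real.sqrt_sq hz.le]
  rw [e4]
  have : (z ^ 2) ^ ((d : ℝ) / 2) ≠ 0 := by positivity
  field_simp

/-- closed form for the Poisson kernel -/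
def Gz (d : ℕ) (c : ℝ) (r : ℝ) (z : ℂ) : ℂ :=
  c * z * ((z + r * Complex.I) ^ ((-((d + 1 : ℝ) / 2) : ℝ) : ℂ) * (z - r * Complex.I) ^ ((-((d + 1 : ℝ) / 2) : ℝ) : ℂ))

lemma Gz_diff (d : ℕ) (c r : ℝ) (z : ℂ) (h1 : z + r * Complex.I ∈ Complex.slitPlane)
    (h2 : z - r * Complex.I ∈ Complex.slitPlane) : DifferentiableAt ℂ (Gz d c r) z := by
  unfold Gz
  refine DifferentiableAt.mul (by fun_prop) (DifferentiableAt.mul ?_ ?_)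
  · exact DifferentiableAt.cpow_const (by fun_prop) h1
  · exact DifferentiableAt.cpow_const (by fun_prop) h2

lemma isOpen_re_pos : IsOpen {z : ℂ | 0 < z.re} := isOpen_lt continuous_const Complex.continuous_re

lemma slit_of_re {z : ℂ} (hz : 0 < z.re) (r : ℝ) : z + r * Complex.I ∈ Complex.slitPlane ∧
    z - r * Complex.I ∈ Complex.slitPlane := by
  constructor <;> (left; simpa using hz)

lemma Kz_formula (d : ℕ) : ∃ c : ℝ, ∀ (z : ℂ), 0 < z.re → ∀ x : Ed d,
    Kz d 0 z x = Gz d c (2 * Real.pi * ‖x‖) z := by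
  obtain ⟨c, hc⟩ := Kz_real d
  refine ⟨c, ?_⟩
  intro z hz x
  set r := 2 * Real.pi * ‖x‖ with hr
  have hU : IsPreconnected {z : ℂ | 0 < z.re} := (convex_halfSpace_re_gt 0).isPreconnected
  have hA : AnalyticOnNhd ℂ (fun z => Kz d 0 z x) {z : ℂ | 0 < z.re} := by
    apply DifferentiableOn.analyticOnNhd _ isOpen_re_pos
    intro w hw
    exact (hasDerivAt_Kz d 0 hw x).differentiableAt.differentiableWithinAt
  have hB : AnalyticOnNhd ℂ (Gz d c r) {z : ℂ | 0 < z.re} := by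
    apply DifferentiableOn.analyticOnNhd _ isOpen_re_pos
    intro w hw
    exact (Gz_diff d c r w (slit_of_re hw r).1 (slit_of_re hw r).2).differentiableWithinAt
  have hreal : ∀ s : ℝ, 0 < s → Kz d 0 s x = Gz d c r s := by
    intro s hs
    rw [hc s hs x, Gz]
    have hre : 0 < (s + r * Complex.I : ℂ).re := by simpa using hs
    have h1 : (s - r * Complex.I : ℂ) = starRingEnd ℂ (s + r * Complex.I) := by
      simp [sub_eq_add_neg]
    have h2 : (s + r * Complex.I : ℂ).arg ≠ Real.pi := by
      intro h
      rw [Complex.arg_eq_pi_iff] at h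
      linarith [h.1]
    rw [h1, Complex.conj_cpow _ _ h2, Complex.conj_ofReal, Complex.mul_conj', Complex.norm_cpow_real]
    have h3 : ‖(s + r * Complex.I : ℂ)‖ = Real.sqrt (s ^ 2 + r ^ 2) := Complex.norm_add_mul_I s r
    rw [h3]
    push_cast
    congr 1
    rw [← Complex.ofReal_pow]
    congr 1
    rw [sq (Real.sqrt _ ^ _), ← Real.mul_rpow (Real.sqrt_nonneg _) (Real.sqrt_nonneg _), Real.mul_self_sqrt (by positivity)]
  refine hA.eqOn_of_preconnected_of_frequently_eq hB hU (z₀ := 1) (by simp) ?_ hz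
  have ht : Filter.Tendsto (fun n : ℕ => ((1 + 1 / ((n : ℝ) + 1) : ℝ) : ℂ)) Filter.atTop (nhdsWithin 1 {1}ᶜ) := by
    rw [tendsto_nhdsWithin_iff]
    constructor
    · have := (tendsto_one_div_add_atTop_nhds_zero_nat (𝕜 := ℝ)).const_add 1
      have h := (Complex.continuous_ofReal.tendsto (1 + 0)).comp this
      rw [add_zero, Complex.ofReal_one] at h
      exact h
    · filter_upwards with n
      simp only [mem_compl_iff, mem_singleton_iff]
      intro h
      have h' : (1 + 1 / ((n : ℝ) + 1) : ℝ) = 1 := by exact_mod_cast h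
      have : (0:ℝ) < 1 / ((n : ℝ) + 1) := by positivity
      linarith
  refine ht.frequently (Filter.Eventually.frequently ?_)
  filter_upwards with n
  exact hreal _ (by positivity)

lemma slit_near {a b : ℂ} (ha : 0 < a.re) (h : ‖b - a‖ ≤ ‖a‖ / 2) : b ∈ Complex.slitPlane := by
  rw [Complex.mem_slitPlane_iff_not_le_zero]
  intro hb
  obtain ⟨h1, h2⟩ := Complex.le_def.1 hb
  simp at h1 h2
  have e1 := Complex.sq_norm (b - a)
  have e2 := Complex.sq_norm a
  rw [Complex.normSq_apply] at e1 e2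
  simp only [Complex.sub_re, Complex.sub_im, h2] at e1
  have : ‖b - a‖ ^ 2 ≤ (‖a‖ / 2) ^ 2 := pow_le_pow_left₀ (norm_nonneg _) h 2
  nlinarith [norm_nonneg a]

lemma rpow_neg_half {a b β : ℝ} (ha : 0 < a) (hb : a / 2 ≤ b) (hβ : 0 ≤ β) : b ^ (-β) ≤ 2 ^ β * a ^ (-β) := by
  calc b ^ (-β) ≤ (a / 2) ^ (-β) := Real.rpow_le_rpow_of_nonpos (by positivity) hb (by linarith)
    _ = 2 ^ β * a ^ (-β) := by
      rw [Real.div_rpow ha.le (by norm_num), Real.rpow_neg (by norm_num : (0:ℝ) ≤ 2)]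
      field_simp

lemma Kz_bound1 (d m : ℕ) : ∃ C : ℝ, 0 ≤ C ∧ ∀ (z : ℂ), 0 < z.re → ∀ (x : Ed d) (δ : ℝ), 0 < δ →
    δ ≤ ‖z + (2 * Real.pi * ‖x‖ : ℝ) * Complex.I‖ → δ ≤ ‖z - (2 * Real.pi * ‖x‖ : ℝ) * Complex.I‖ →
    ‖Kz d m z x‖ ≤ C * δ ^ (-(m:ℝ)) * ((‖z + (2 * Real.pi * ‖x‖ : ℝ) * Complex.I‖ + ‖z - (2 * Real.pi * ‖x‖ : ℝ) * Complex.I‖)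
      * (‖z + (2 * Real.pi * ‖x‖ : ℝ) * Complex.I‖ ^ (-((d + 1 : ℝ) / 2)) * ‖z - (2 * Real.pi * ‖x‖ : ℝ) * Complex.I‖ ^ (-((d + 1 : ℝ) / 2)))) := by
  obtain ⟨c, hc⟩ := Kz_formula d
  set β : ℝ := (d + 1 : ℝ) / 2 with hβ
  have hβ0 : 0 ≤ β := by positivity
  refine ⟨m.factorial * (|c| * (2 ^ β * 2 ^ β)) * 2 ^ m, by positivity, ?_⟩
  intro z hz x δ hδ h1 h2
  set r := 2 * Real.pi * ‖x‖ with hr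
  set A := ‖z + (r : ℝ) * Complex.I‖ with hA
  set B := ‖z - (r : ℝ) * Complex.I‖ with hB
  have hre1 : 0 < (z + (r : ℝ) * Complex.I).re := by simpa using hz
  have hre2 : 0 < (z - (r : ℝ) * Complex.I).re := by simpa using hz
  have near1 : ∀ w, ‖w - z‖ ≤ δ / 2 → ‖(w + r * Complex.I) - (z + r * Complex.I)‖ ≤ A / 2 := by
    intro w hw
    rw [show (w + r * Complex.I) - (z + r * Complex.I) = w - z by ring]; linarith
  have near2 : ∀ w, ‖w - z‖ ≤ δ / 2 → ‖(w - r * Complex.I) - (z - r * Complex.I)‖ ≤ B / 2 := by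
    intro w hw
    rw [show (w - r * Complex.I) - (z - r * Complex.I) = w - z by ring]; linarith
  have hev : (fun z => Kz d 0 z x) =ᶠ[nhds z] Gz d c r := by
    filter_upwards [isOpen_re_pos.mem_nhds hz] with w hw
    exact hc w hw x
  have h3 := iteratedDeriv_Kz d m hz x
  rw [hev.iteratedDeriv_eq m] at h3
  have h4 : ‖Kz d m z x‖ = ‖iteratedDeriv m (Gz d c r) z‖ := by
    rw [h3, norm_mul, norm_pow, norm_neg, norm_one, one_pow, one_mul]
  rw [h4]
  have hd : DiffContOnCl ℂ (Gz d c r) (ball z (δ / 2)) := by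
    apply DifferentiableOn.diffContOnCl
    rw [closure_ball z (by positivity)]
    intro w hw
    rw [mem_closedBall, dist_eq_norm] at hw
    exact (Gz_diff d c r w (slit_near hre1 (near1 w hw)) (slit_near hre2 (near2 w hw))).differentiableWithinAt
  have hA0 : 0 < A := by linarith
  have hB0 : 0 < B := by linarith
  have hb : ∀ w ∈ sphere z (δ / 2), ‖Gz d c r w‖ ≤ |c| * (2 ^ β * 2 ^ β) * ((A + B) * (A ^ (-β) * B ^ (-β))) := by
    intro w hw
    rw [mem_sphere, dist_eq_norm] at hw
    have n1 := near1 w hw.le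
    have n2 := near2 w hw.le
    have k1 : A / 2 ≤ ‖w + r * Complex.I‖ := by
      have := norm_sub_norm_le (z + r * Complex.I) (w + r * Complex.I)
      rw [norm_sub_rev] at this
      linarith
    have k2 : B / 2 ≤ ‖w - r * Complex.I‖ := by
      have := norm_sub_norm_le (z - r * Complex.I) (w - r * Complex.I)
      rw [norm_sub_rev (z - r * Complex.I)] at this
      linarith
    have k3 : ‖w‖ ≤ A + B := by
      have e1 : ‖w‖ ≤ ‖w - z‖ + ‖z‖ := by
        have := norm_add_le (w - z) z
        rwa [sub_add_cancel] at this
      have e2 : 2 * ‖z‖ ≤ A + B := by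
        have := norm_add_le (z + r * Complex.I) (z - r * Complex.I)
        rw [show (z + r * Complex.I) + (z - r * Complex.I) = 2 * z by ring, norm_mul] at this
        simpa using this
      linarith
    unfold Gz
    rw [norm_mul, norm_mul, norm_mul, Complex.norm_cpow_real, Complex.norm_cpow_real, Complex.norm_real, Real.norm_eq_abs]
    have l1 := rpow_neg_half hA0 k1 hβ0
    have l2 := rpow_neg_half hB0 k2 hβ0
    calc |c| * ‖w‖ * (‖w + r * Complex.I‖ ^ (-β) * ‖w - r * Complex.I‖ ^ (-β))
        ≤ |c| * (A + B) * ((2 ^ β * A ^ (-β)) * (2 ^ β * B ^ (-β))) := by gcongr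
      _ = _ := by ring
  have := Complex.norm_iteratedDeriv_le_of_forall_mem_sphere_norm_le m (by positivity) hd hb
  refine this.trans (le_of_eq ?_)
  rw [Real.rpow_neg hδ.le, Real.rpow_natCast, div_pow]
  field_simp

/-- the rescaled kernel -/
def Kk (d m : ℕ) (ε t : ℝ) : Ed d → ℂ := fun x => (ε : ℂ) ^ m * Kz d m (ε - t * Complex.I) x

lemma Kk_bound (d m : ℕ) (hd : 1 ≤ d) : ∃ C : ℝ, 0 < C ∧ ∀ (ε t : ℝ), 0 < ε → ∀ (x : Ed d),
    ‖Kk d m ε t x‖ ≤ C * ε ^ m * (ε + abs (2 * Real.pi * ‖x‖ - |t|)) ^ (-(m + (d + 1 : ℝ) / 2)) *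
      (ε + 2 * Real.pi * ‖x‖ + |t|) ^ (1 - (d + 1 : ℝ) / 2) := by
  obtain ⟨C, hC, H⟩ := Kz_bound1 d m
  set β : ℝ := (d + 1 : ℝ) / 2 with hβ
  have hβ0 : 0 ≤ β := by positivity
  have hβ1 : 0 ≤ β - 1 := by
    have : (1:ℝ) ≤ d := by exact_mod_cast hd
    rw [hβ]; linarith
  refine ⟨C * 2 ^ (m : ℝ) * 2 * (2 ^ β * 2 ^ β) + 1, by positivity, ?_⟩
  intro ε t hε x
  set r := 2 * Real.pi * ‖x‖ with hr
  have hr0 : 0 ≤ r := by positivity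
  set X := ε + abs (r - |t|) with hX
  set Y := ε + r + |t| with hY
  have hX0 : 0 < X := by positivity
  have hY0 : 0 < Y := by positivity
  have hXY : X ≤ Y := by
    have : abs (r - |t|) ≤ r + |t| := by
      rw [abs_le]; constructor <;> linarith [abs_nonneg t]
    linarith
  have key : ∀ N1 N2 : ℝ, X / 2 ≤ N1 → Y / 2 ≤ N2 → N1 ≤ Y → N2 ≤ Y →
      C * (X / 2) ^ (-(m:ℝ)) * ((N1 + N2) * (N1 ^ (-β) * N2 ^ (-β))) ≤
      C * 2 ^ (m : ℝ) * 2 * (2 ^ β * 2 ^ β) * (X ^ (-(m + β)) * Y ^ (1 - β)) := by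
    intro N1 N2 a1 a2 a3 a4
    have l1 := rpow_neg_half hX0 a1 hβ0
    have l2 := rpow_neg_half hY0 a2 hβ0
    have l3 := rpow_neg_half (β := m) hX0 le_rfl (by positivity)
    have hN1 : 0 < N1 := by linarith
    have hN2 : 0 < N2 := by linarith
    calc C * (X / 2) ^ (-(m:ℝ)) * ((N1 + N2) * (N1 ^ (-β) * N2 ^ (-β)))
        ≤ C * (2 ^ (m:ℝ) * X ^ (-(m:ℝ))) * ((Y + Y) * ((2 ^ β * X ^ (-β)) * (2 ^ β * Y ^ (-β)))) := by gcongr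
      _ = _ := by
        rw [show 1 - β = 1 + -β by ring, show -((m:ℝ) + β) = -(m:ℝ) + -β by ring, Real.rpow_add hX0, Real.rpow_add hY0, Real.rpow_one]
        ring
  have nrm : ∀ b : ℝ, (ε + |b|) / 2 ≤ ‖(ε + b * Complex.I : ℂ)‖ ∧ ‖(ε + b * Complex.I : ℂ)‖ ≤ ε + |b| := by
    intro b
    rw [Complex.norm_add_mul_I]
    constructor
    · apply Real.le_sqrt_of_sq_le
      nlinarith [sq_nonneg (ε - |b|), sq_abs b, abs_nonneg b]
    · apply Real.sqrt_le_iff.2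
      constructor
      · positivity
      · nlinarith [sq_abs b, abs_nonneg b]
  have e1 : (ε - t * Complex.I + (r : ℝ) * Complex.I : ℂ) = ε + ((r - t : ℝ) : ℂ) * Complex.I := by push_cast; ring
  have e2 : (ε - t * Complex.I - (r : ℝ) * Complex.I : ℂ) = ε + ((-(r + t) : ℝ) : ℂ) * Complex.I := by push_cast; ring
  have hmain : ‖Kz d m (ε - t * Complex.I) x‖ ≤ C * 2 ^ (m : ℝ) * 2 * (2 ^ β * 2 ^ β) * (X ^ (-(m + β)) * Y ^ (1 - β)) := by
    have H' := H (ε - t * Complex.I) (by simpa using hε) x (X / 2) (by positivity)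
    rw [e1, e2] at H'
    have n1 := nrm (r - t)
    have n2 := nrm (-(r + t))
    rcases le_total 0 t with ht | ht
    · rw [abs_of_nonneg ht] at hX hY
      rw [← hX] at n1
      rw [abs_neg, abs_of_nonneg (by linarith : 0 ≤ r + t), ← add_assoc, ← hY] at n2
      exact (H' n1.1 (by linarith)).trans (key _ _ n1.1 n2.1 (by linarith) n2.2)
    · rw [abs_of_nonpos ht] at hX hY
      rw [abs_of_nonneg (by linarith : 0 ≤ r - t), show ε + (r - t) = ε + r + -t by ring, ← hY] at n1
      rw [abs_neg, show r + t = r - -t by ring, ← hX] at n2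
      rw [show r + t = r - -t by ring] at H'
      refine (H' (by linarith) n2.1).trans ?_
      rw [add_comm ‖_‖, mul_comm (‖_‖ ^ (-β))]
      exact (key _ _ n2.1 n1.1 (by linarith) n1.2)
  unfold Kk
  rw [norm_mul, norm_pow, Complex.norm_real, Real.norm_of_nonneg hε.le]
  have hpos : 0 ≤ ε ^ m * (X ^ (-(m + β)) * Y ^ (1 - β)) := by positivity
  calc ε ^ m * ‖Kz d m (ε - t * Complex.I) x‖ ≤ ε ^ m * (C * 2 ^ (m : ℝ) * 2 * (2 ^ β * 2 ^ β) * (X ^ (-(m + β)) * Y ^ (1 - β))) := by gcongr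
    _ = C * 2 ^ (m : ℝ) * 2 * (2 ^ β * 2 ^ β) * (ε ^ m * (X ^ (-(m + β)) * Y ^ (1 - β))) := by ring
    _ ≤ (C * 2 ^ (m : ℝ) * 2 * (2 ^ β * 2 ^ β) + 1) * (ε ^ m * (X ^ (-(m + β)) * Y ^ (1 - β))) := by gcongr; linarith
    _ = _ := by ring

lemma int_abs_rpow {a ε : ℝ} (ha : 1 < a) (hε : 0 < ε) :
    Integrable (fun u : ℝ => (ε + |u|) ^ (-a)) ∧ ∫ u : ℝ, (ε + |u|) ^ (-a) = 2 / (a - 1) * ε ^ (1 - a) := by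
  have h : ∫ u : ℝ, (ε + |u|) ^ (-a) = 2 / (a - 1) * ε ^ (1 - a) := by
    rw [integral_comp_abs (f := fun u => (ε + u) ^ (-a))]
    have h1 : ∫ u in Ioi (0:ℝ), (ε + u) ^ (-a) = ∫ u in Ioi ε, u ^ (-a) := by
      have := (measurePreserving_add_left volume ε).setIntegral_preimage_emb
        (measurableEmbedding_addLeft ε) (fun u : ℝ => u ^ (-a)) (Ioi ε)
      rw [← this]
      simp
    rw [h1, integral_Ioi_rpow_of_lt (by linarith) hε]
    have : a - 1 ≠ 0 := by linarith
    have h2 : -a + 1 ≠ 0 := by intro h; apply this; linarith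
    rw [show 1 - a = -a + 1 by ring]
    field_simp
    ring
  refine ⟨?_, h⟩
  apply Integrable.of_integral_ne_zero
  rw [h]
  have : 0 < a - 1 := by linarith
  positivity

lemma int_abs_rpow' {a ε t : ℝ} (ha : 1 < a) (hε : 0 < ε) :
    Integrable (fun u : ℝ => (ε + |2 * Real.pi * u - t|) ^ (-a)) ∧
    ∫ u : ℝ, (ε + |2 * Real.pi * u - t|) ^ (-a) ≤ 2 / (a - 1) * ε ^ (1 - a) := by
  obtain ⟨h1, h2⟩ := int_abs_rpow ha hε
  have hp := Real.pi_pos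
  constructor
  · exact (h1.comp_sub_right t).comp_mul_left' (R := 2 * Real.pi) (by positivity)
  · have := Measure.integral_comp_mul_left (fun u : ℝ => (ε + |u - t|) ^ (-a)) (2 * Real.pi)
    rw [this, integral_sub_right_eq_self (fun u : ℝ => (ε + |u|) ^ (-a)), h2, smul_eq_mul]
    have h3 : |(2 * Real.pi)⁻¹| ≤ 1 := by
      rw [abs_of_pos (by positivity)]
      apply inv_le_one_of_one_le₀
      linarith [Real.pi_gt_three]
    have : 0 < a - 1 := by linarith
    have h4 : 0 ≤ 2 / (a - 1) * ε ^ (1 - a) := by positivity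
    nlinarith

lemma radial_bound (d : ℕ) (hd : 2 ≤ d) : ∃ C : ℝ, 0 < C ∧ ∀ ε t : ℝ, 0 < ε → ε ≤ 1 → 1 ≤ t → t ≤ 2 →
    Integrable (fun x : Ed d => (ε + |2 * Real.pi * ‖x‖ - t|) ^ (-(1 + (d + 1 : ℝ) / 2)) *
      (ε + 2 * Real.pi * ‖x‖ + t) ^ (1 - (d + 1 : ℝ) / 2)) ∧
    ∫ x : Ed d, (ε + |2 * Real.pi * ‖x‖ - t|) ^ (-(1 + (d + 1 : ℝ) / 2)) *
      (ε + 2 * Real.pi * ‖x‖ + t) ^ (1 - (d + 1 : ℝ) / 2) ≤ C * ε ^ (-((d + 1 : ℝ) / 2)) := by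
  set β : ℝ := (d + 1 : ℝ) / 2 with hβ
  have hd' : (2:ℝ) ≤ d := by exact_mod_cast hd
  have hβ1 : 1 < β := by rw [hβ]; linarith
  have hp := Real.pi_gt_three
  have : Nontrivial (Ed d) := by
    apply Module.nontrivial_of_finrank_pos (R := ℝ)
    rw [finrank_euclideanSpace_fin]; omega
  set c0 : ℝ := 2 ^ (β - 1) * 2 ^ (β - 1) with hc0
  have hb0 : 0 < 1 + β - 1 := by linarith
  refine ⟨d * (volume.real (ball (0 : Ed d) 1) * (c0 * (2 / (1 + β - 1) + 2))) + 1, by positivity, ?_⟩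
  intro ε t hε hε1 ht1 ht2
  set f : ℝ → ℝ := fun ρ => (ε + |2 * Real.pi * ρ - t|) ^ (-(1 + β)) * (ε + 2 * Real.pi * ρ + t) ^ (1 - β) with hf
  set g : ℝ → ℝ := fun ρ => c0 * ((ε + |2 * Real.pi * ρ - t|) ^ (-(1 + β)) + (ε + |2 * Real.pi * ρ - t|) ^ (-2:ℝ)) with hg
  obtain ⟨i1, j1⟩ := int_abs_rpow' (a := 1 + β) (ε := ε) (t := t) (by linarith) hε
  obtain ⟨i2, j2⟩ := int_abs_rpow' (a := 2) (ε := ε) (t := t) (by linarith) hε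
  have gi : Integrable g := (i1.add i2).const_mul c0
  have fg : ∀ ρ ∈ Ioi (0:ℝ), ρ ^ (d - 1) * f ρ ≤ g ρ := by
    intro ρ hρ
    simp only [mem_Ioi] at hρ
    simp only [hf, hg]
    set X := ε + |2 * Real.pi * ρ - t| with hX
    have hX0 : 0 < X := by positivity
    have hY : ρ ≤ ε + 2 * Real.pi * ρ + t := by nlinarith
    have h1 : (ε + 2 * Real.pi * ρ + t) ^ (1 - β) ≤ ρ ^ (1 - β) :=
      Real.rpow_le_rpow_of_nonpos hρ hY (by linarith)
    have h2 : ρ ^ (d - 1) * ρ ^ (1 - β) = ρ ^ (β - 1) := by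
      rw [← Real.rpow_natCast, ← Real.rpow_add hρ]
      congr 1
      rw [Nat.cast_sub (by omega), hβ]
      push_cast; ring
    have h3 : ρ ≤ 2 + X := by
      have := le_abs_self (2 * Real.pi * ρ - t)
      nlinarith
    have h4 : ρ ^ (β - 1) ≤ c0 * (1 + X ^ (β - 1)) := by
      have h5 : 2 + X ≤ 2 * 2 * max 1 X := by
        have := le_max_left 1 X
        have := le_max_right 1 X
        linarith
      have h6 : (max 1 X) ^ (β - 1) ≤ 1 + X ^ (β - 1) := by
        rcases le_total 1 X with h | h
        · rw [max_eq_right h]; linarith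
        · rw [max_eq_left h, Real.one_rpow]
          have : 0 ≤ X ^ (β - 1) := by positivity
          linarith
      calc ρ ^ (β - 1) ≤ (2 * 2 * max 1 X) ^ (β - 1) := Real.rpow_le_rpow hρ.le (h3.trans h5) (by linarith)
        _ = c0 * (max 1 X) ^ (β - 1) := by
          rw [Real.mul_rpow (by norm_num) (by positivity), Real.mul_rpow (by norm_num) (by norm_num)]
        _ ≤ _ := by gcongr
    calc ρ ^ (d - 1) * (X ^ (-(1 + β)) * (ε + 2 * Real.pi * ρ + t) ^ (1 - β))
        ≤ ρ ^ (d - 1) * (X ^ (-(1 + β)) * ρ ^ (1 - β)) := by gcongr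
      _ = X ^ (-(1 + β)) * ρ ^ (β - 1) := by rw [← h2]; ring
      _ ≤ X ^ (-(1 + β)) * (c0 * (1 + X ^ (β - 1))) := by gcongr
      _ = c0 * (X ^ (-(1 + β)) + X ^ (-2:ℝ)) := by
        rw [show (-2:ℝ) = -(1 + β) + (β - 1) by ring, Real.rpow_add hX0]; ring
  have fnn : ∀ ρ ∈ Ioi (0:ℝ), 0 ≤ ρ ^ (d - 1) * f ρ := by
    intro ρ hρ
    simp only [mem_Ioi] at hρ
    simp only [hf]
    positivity
  have fi : IntegrableOn (fun ρ : ℝ => ρ ^ (d - 1) * f ρ) (Ioi 0) := by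
    refine Integrable.mono' gi.integrableOn ?_ ?_
    · apply Measurable.aestronglyMeasurable
      simp only [hf]; fun_prop
    · filter_upwards [ae_restrict_mem measurableSet_Ioi] with ρ hρ
      rw [Real.norm_of_nonneg (fnn ρ hρ)]
      exact fg ρ hρ
  constructor
  · have := (integrable_fun_norm_addHaar (volume : Measure (Ed d)) (f := f)).2 (by
      rw [finrank_euclideanSpace_fin]
      exact fi)
    exact this
  · have := integral_fun_norm_addHaar (volume : Measure (Ed d)) f
    rw [finrank_euclideanSpace_fin] at this
    have e : ∫ x : Ed d, f ‖x‖ = ∫ x : Ed d, (ε + |2 * Real.pi * ‖x‖ - t|) ^ (-(1 + β)) *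
      (ε + 2 * Real.pi * ‖x‖ + t) ^ (1 - β) := rfl
    rw [← e, this]
    simp only [nsmul_eq_mul, smul_eq_mul]
    have b1 : ∫ y in Ioi (0:ℝ), y ^ (d - 1) * f y ≤ ∫ y in Ioi (0:ℝ), g y :=
      setIntegral_mono_on fi gi.integrableOn measurableSet_Ioi fg
    have b2 : ∫ y in Ioi (0:ℝ), g y ≤ ∫ y, g y := by
      apply setIntegral_le_integral gi
      filter_upwards with y
      simp only [hg]; positivity
    have b3 : ∫ y, g y ≤ c0 * (2 / (1 + β - 1) + 2) * ε ^ (-β) := by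
      simp only [hg]
      rw [integral_const_mul, integral_add i1 i2]
      have : ε ^ (1 - 2 : ℝ) ≤ ε ^ (-β) := Real.rpow_le_rpow_of_exponent_ge hε hε1 (by linarith)
      rw [show 1 - (1 + β) = -β by ring] at j1
      rw [mul_assoc c0]
      refine mul_le_mul_of_nonneg_left ?_ (show (0:ℝ) ≤ c0 by positivity)
      calc _ ≤ 2 / (1 + β - 1) * ε ^ (-β) + 2 / (2 - 1) * ε ^ (1 - 2 : ℝ) := add_le_add j1 j2
        _ ≤ 2 / (1 + β - 1) * ε ^ (-β) + 2 * ε ^ (-β) := by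
          gcongr; norm_num
        _ = _ := by ring
    have b4 := b1.trans (b2.trans b3)
    calc (d:ℝ) * (volume.real (ball (0 : Ed d) 1) * ∫ y in Ioi (0:ℝ), y ^ (d - 1) * f y)
        ≤ d * (volume.real (ball (0 : Ed d) 1) * (c0 * (2 / (1 + β - 1) + 2) * ε ^ (-β))) := by gcongr
      _ = (d * (volume.real (ball (0 : Ed d) 1) * (c0 * (2 / (1 + β - 1) + 2)))) * ε ^ (-β) := by ring
      _ ≤ _ := by gcongr; linarith

lemma continuous_fourier_of_integrable {d : ℕ} {f : Ed d → ℂ} (hf : Integrable f) : Continuous (𝓕 f) :=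
  VectorFourier.fourierIntegral_continuous Real.continuous_fourierChar (L := innerₗ (Ed d)) (by exact continuous_inner) hf

lemma continuous_fourierInv_of_integrable {d : ℕ} {f : Ed d → ℂ} (hf : Integrable f) : Continuous (𝓕⁻ f) := by
  have : 𝓕⁻ f = fun x => 𝓕 f (-x) := by
    ext x; rw [Real.fourierInv_eq_fourier_neg]
  rw [this]
  exact (continuous_fourier_of_integrable hf).comp continuous_neg

lemma continuous_Kk (d m : ℕ) {ε : ℝ} (hε : 0 < ε) (t : ℝ) : Continuous (Kk d m ε t) := by
  unfold Kk
  refine continuous_const.mul ?_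
  unfold Kz
  have := (integrable_Mz d m (z := ε - t * Complex.I) (by simpa using hε))
  exact continuous_fourierInv_of_integrable this

/-- L¹ tail bound -/
lemma Kk_tail (d m : ℕ) (hd : 2 ≤ d) (hm : 1 ≤ m) : ∃ C : ℝ, 0 < C ∧ ∀ ε t s : ℝ, 0 < ε → ε ≤ 1 → 1 ≤ t → t ≤ 2 → 0 ≤ s →
    ∫⁻ x in {x : Ed d | s ≤ |2 * Real.pi * ‖x‖ - t|}, ‖Kk d m ε t x‖ₑ ≤
      ENNReal.ofReal (C * ε ^ (1 - (d + 1 : ℝ) / 2) * (1 + s / ε) ^ (-(m - 1 : ℝ))) := by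
  obtain ⟨C1, hC1, H1⟩ := Kk_bound d m (by omega)
  obtain ⟨C2, hC2, H2⟩ := radial_bound d hd
  set β : ℝ := (d + 1 : ℝ) / 2 with hβ
  refine ⟨C1 * C2, by positivity, ?_⟩
  intro ε t s hε hε1 ht1 ht2 hs
  obtain ⟨i1, j1⟩ := H2 ε t hε hε1 ht1 ht2
  have hm' : (1:ℝ) ≤ m := by exact_mod_cast hm
  set Φ : Ed d → ℝ := fun x => (ε + |2 * Real.pi * ‖x‖ - t|) ^ (-(1 + β)) * (ε + 2 * Real.pi * ‖x‖ + t) ^ (1 - β) with hΦ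
  have hpt : ∀ x ∈ {x : Ed d | s ≤ |2 * Real.pi * ‖x‖ - t|}, ‖Kk d m ε t x‖ₑ ≤
      ENNReal.ofReal (C1 * ε ^ m * (ε + s) ^ (-(m - 1 : ℝ)) * Φ x) := by
    intro x hx
    have hx' : s ≤ |2 * Real.pi * ‖x‖ - t| := hx
    rw [← ofReal_norm]
    apply ENNReal.ofReal_le_ofReal
    have := H1 ε t hε x
    rw [abs_of_nonneg (by linarith : 0 ≤ t)] at this
    refine this.trans ?_
    simp only [hΦ]
    set X := ε + |2 * Real.pi * ‖x‖ - t| with hX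
    have hX0 : 0 < X := by positivity
    have hp := Real.pi_pos
    have hY0 : 0 < ε + 2 * Real.pi * ‖x‖ + t := by positivity
    have h1 : X ^ (-(m + β)) = X ^ (-(m - 1 : ℝ)) * X ^ (-(1 + β)) := by
      rw [← Real.rpow_add hX0]; congr 1; ring
    have h2 : X ^ (-(m - 1 : ℝ)) ≤ (ε + s) ^ (-(m - 1 : ℝ)) :=
      Real.rpow_le_rpow_of_nonpos (by positivity) (by linarith) (by linarith)
    rw [h1]
    calc C1 * ε ^ m * (X ^ (-(m - 1 : ℝ)) * X ^ (-(1 + β))) * (ε + 2 * Real.pi * ‖x‖ + t) ^ (1 - β)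
        ≤ C1 * ε ^ m * ((ε + s) ^ (-(m - 1 : ℝ)) * X ^ (-(1 + β))) * (ε + 2 * Real.pi * ‖x‖ + t) ^ (1 - β) := by gcongr
      _ = _ := by ring
  have hmS : MeasurableSet {x : Ed d | s ≤ |2 * Real.pi * ‖x‖ - t|} := by
    apply measurableSet_le <;> fun_prop
  have hΦ0 : ∀ x, 0 ≤ Φ x := fun x => by
    simp only [hΦ]
    have hp := Real.pi_pos
    positivity
  calc ∫⁻ x in {x : Ed d | s ≤ |2 * Real.pi * ‖x‖ - t|}, ‖Kk d m ε t x‖ₑ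
      ≤ ∫⁻ x in {x : Ed d | s ≤ |2 * Real.pi * ‖x‖ - t|}, ENNReal.ofReal (C1 * ε ^ m * (ε + s) ^ (-(m - 1 : ℝ)) * Φ x) :=
        setLIntegral_mono' hmS hpt
    _ ≤ ∫⁻ x, ENNReal.ofReal (C1 * ε ^ m * (ε + s) ^ (-(m - 1 : ℝ)) * Φ x) := setLIntegral_le_lintegral _ _
    _ = ENNReal.ofReal (∫ x, C1 * ε ^ m * (ε + s) ^ (-(m - 1 : ℝ)) * Φ x) := by
      rw [ofReal_integral_eq_lintegral_ofReal (i1.const_mul _)]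
      filter_upwards with x
      have := hΦ0 x
      positivity
    _ ≤ _ := by
      apply ENNReal.ofReal_le_ofReal
      rw [integral_const_mul]
      calc C1 * ε ^ m * (ε + s) ^ (-(m - 1 : ℝ)) * ∫ x, Φ x
          ≤ C1 * ε ^ m * (ε + s) ^ (-(m - 1 : ℝ)) * (C2 * ε ^ (-β)) := by gcongr
        _ = _ := by
          rw [show 1 + s / ε = (ε + s) / ε by field_simp, Real.div_rpow (by positivity) hε.le,
            show 1 - β = 1 + -β by ring, Real.rpow_add hε, Real.rpow_one, Real.rpow_neg hε.le (m - 1 : ℝ),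
            ← Real.rpow_natCast ε m, show (m : ℝ) = (m - 1 : ℝ) + 1 by ring, Real.rpow_add hε, Real.rpow_one]
          field_simp
          ring_nf

lemma continuous_Kk_joint (d m : ℕ) {ε : ℝ} (hε : 0 < ε) :
    Continuous (fun p : ℝ × Ed d => Kk d m ε p.1 p.2) := by
  unfold Kk
  refine continuous_const.mul ?_
  simp_rw [Kz_eq]
  refine continuous_of_dominated (bound := fun v => ‖v‖ ^ m * Real.exp (-ε * ‖v‖)) ?_ ?_ ?_ ?_
  · intro p
    apply Continuous.aestronglyMeasurable
    have := continuous_Mz d m (ε - p.1 * Complex.I)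
    fun_prop
  · intro p
    filter_upwards with v
    rw [norm_mul, Complex.norm_exp_ofReal_mul_I, one_mul, norm_Mz]
    simp
  · exact integrable_pow_exp d m hε
  · filter_upwards with v
    unfold Mz
    fun_prop

/-- the multiplier -/
def Mk (d m : ℕ) (ε t : ℝ) : Ed d → ℂ := fun ξ => (ε : ℂ) ^ m * Mz d m (ε - t * Complex.I) ξ

lemma integrable_Mk (d m : ℕ) {ε : ℝ} (hε : 0 < ε) (t : ℝ) : Integrable (Mk d m ε t) :=
  (integrable_Mz d m (by simpa using hε)).const_mul _

lemma continuous_Mk (d m : ℕ) (ε t : ℝ) : Continuous (Mk d m ε t) :=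
  continuous_const.mul (continuous_Mz _ _ _)

lemma Kk_eq_fourierInv (d m : ℕ) (ε t : ℝ) : Kk d m ε t = 𝓕⁻ (Mk d m ε t) := by
  ext x
  rw [Kk, Kz_eq, Real.fourierInv_eq', ← integral_const_mul]
  congr 1
  ext v
  simp only [Mk, smul_eq_mul]; ring

lemma Kk_sup (d m : ℕ) (hd : 1 ≤ d) {ε : ℝ} (hε : 0 < ε) : ∃ B : ℝ, 0 ≤ B ∧ ∀ t x, ‖Kk d m ε t x‖ ≤ B := by
  obtain ⟨C, hC, H⟩ := Kk_bound d m hd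
  have hd' : (1:ℝ) ≤ d := by exact_mod_cast hd
  refine ⟨C * ε ^ m * ε ^ (-(m + (d + 1 : ℝ) / 2)) * ε ^ (1 - (d + 1 : ℝ) / 2), by positivity, ?_⟩
  intro t x
  refine (H ε t hε x).trans ?_
  have hp := Real.pi_pos
  have h1 : (ε + abs (2 * Real.pi * ‖x‖ - |t|)) ^ (-(m + (d + 1 : ℝ) / 2)) ≤ ε ^ (-(m + (d + 1 : ℝ) / 2)) := by
    apply Real.rpow_le_rpow_of_nonpos hε
    · linarith [abs_nonneg (2 * Real.pi * ‖x‖ - |t|)]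
    · have : 0 ≤ (m + (d + 1 : ℝ) / 2) := by positivity
      linarith
  have h2 : (ε + 2 * Real.pi * ‖x‖ + |t|) ^ (1 - (d + 1 : ℝ) / 2) ≤ ε ^ (1 - (d + 1 : ℝ) / 2) := by
    apply Real.rpow_le_rpow_of_nonpos hε
    · have : 0 ≤ 2 * Real.pi * ‖x‖ := by positivity
      linarith [abs_nonneg t]
    · linarith
  gcongr

lemma Kk_L1 (d m : ℕ) (hd : 2 ≤ d) (hm : 1 ≤ m) : ∃ C : ℝ, 0 < C ∧ ∀ ε t : ℝ, 0 < ε → ε ≤ 1 → 1 ≤ t → t ≤ 2 →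
    ∫⁻ x : Ed d, ‖Kk d m ε t x‖ₑ ≤ ENNReal.ofReal (C * ε ^ (1 - (d + 1 : ℝ) / 2)) := by
  obtain ⟨C, hC, H⟩ := Kk_tail d m hd hm
  refine ⟨C, hC, fun ε t h1 h2 h3 h4 => ?_⟩
  have := H ε t 0 h1 h2 h3 h4 le_rfl
  have e : {x : Ed d | 0 ≤ |2 * Real.pi * ‖x‖ - t|} = univ := by
    ext x; simp
  rw [e] at this
  simpa using this

lemma integrable_Kk (d m : ℕ) (hd : 2 ≤ d) (hm : 1 ≤ m) {ε t : ℝ} (h1 : 0 < ε) (h2 : ε ≤ 1) (h3 : 1 ≤ t) (h4 : t ≤ 2) :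
    Integrable (Kk d m ε t) := by
  obtain ⟨C, hC, H⟩ := Kk_L1 d m hd hm
  exact ⟨(continuous_Kk d m h1 t).aestronglyMeasurable, (H ε t h1 h2 h3 h4).trans_lt ENNReal.ofReal_lt_top⟩

lemma fourier_Kk (d m : ℕ) (hd : 2 ≤ d) (hm : 1 ≤ m) {ε t : ℝ} (h1 : 0 < ε) (h2 : ε ≤ 1) (h3 : 1 ≤ t) (h4 : t ≤ 2) :
    𝓕 (Kk d m ε t) = Mk d m ε t := by
  have hi := integrable_Kk d m hd hm h1 h2 h3 h4
  rw [Kk_eq_fourierInv] at hi ⊢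
  apply (continuous_Mk d m ε t).fourier_fourierInv_eq (integrable_Mk d m h1 t)
  have : 𝓕 (Mk d m ε t) = fun x => 𝓕⁻ (Mk d m ε t) (-x) := by
    ext x; rw [Real.fourierInv_eq_fourier_neg, neg_neg]
  rw [this]
  exact hi.comp_neg

lemma Mk_mul_conj (d m : ℕ) (ε t t' : ℝ) (ξ : Ed d) :
    Mk d m ε t ξ * starRingEnd ℂ (Mk d m ε t' ξ) = (2 ^ (2 * m) : ℂ)⁻¹ * Mk d (2 * m) (2 * ε) (t - t') ξ := by
  simp only [Mk, Mz, map_mul, map_pow, Complex.conj_ofReal, ← Complex.exp_conj]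
  simp only [map_neg, map_sub, map_mul, Complex.conj_ofReal, Complex.conj_I]
  rw [show -((2 * ε : ℝ) - ((t - t' : ℝ) : ℂ) * Complex.I) * ((‖ξ‖ : ℝ) : ℂ) = -(ε - t * Complex.I) * (‖ξ‖ : ℂ) +
    -(ε - t' * -Complex.I) * (‖ξ‖ : ℂ) by push_cast; ring, Complex.exp_add]
  push_cast
  field_simp
  ring

/-- the pairing identity -/
lemma Kk_pair (d m : ℕ) (hd : 2 ≤ d) (hm : 1 ≤ m) {ε t t' : ℝ} (h1 : 0 < ε) (h2 : ε ≤ 1)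
    (h3' : 1 ≤ t') (h4' : t' ≤ 2) (x x' : Ed d) :
    ∫ y, Kk d m ε t (x - y) * starRingEnd ℂ (Kk d m ε t' (x' - y)) =
      (2 ^ (2 * m) : ℂ)⁻¹ * Kk d (2 * m) (2 * ε) (t - t') (x - x') := by
  have hi' := integrable_Kk d m hd hm h1 h2 h3' h4'
  have hf' := fourier_Kk d m hd hm h1 h2 h3' h4'
  have hK : ∀ y, Kk d m ε t (x - y) * starRingEnd ℂ (Kk d m ε t' (x' - y)) =
      ∫ v, Mk d m ε t v * (Complex.exp (↑(2 * Real.pi * inner ℝ v (x - y)) * Complex.I) * starRingEnd ℂ (Kk d m ε t' (x' - y))) := by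
    intro y
    rw [Kk_eq_fourierInv d m ε t, Real.fourierInv_eq', ← integral_mul_const]
    congr 1; ext v; simp only [smul_eq_mul]; ring
  simp_rw [hK]
  have hswap : Integrable (Function.uncurry fun (y v : Ed d) => Mk d m ε t v *
      (Complex.exp (↑(2 * Real.pi * inner ℝ v (x - y)) * Complex.I) * starRingEnd ℂ (Kk d m ε t' (x' - y))))
      (volume.prod volume) := by
    have hg : Integrable (fun y => starRingEnd ℂ (Kk d m ε t' (x' - y))) :=
      Complex.conjCLE.toContinuousLinearMap.integrable_comp (hi'.comp_sub_left x')
    have h := (hg.mul_prod (integrable_Mk d m h1 t))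
    refine h.mono ?_ ?_
    · apply Continuous.aestronglyMeasurable
      have c1 := continuous_Mk d m ε t
      have c2 := continuous_Kk d m h1 t'
      simp only [Function.uncurry_def]
      have c3 : Continuous (starRingEnd ℂ) := Complex.continuous_conj
      fun_prop
    · filter_upwards with p
      simp only [Function.uncurry_def, norm_mul, Complex.norm_exp_ofReal_mul_I, one_mul]
      rw [mul_comm]
  rw [integral_integral_swap hswap]
  have hin : ∀ v, ∫ y, Mk d m ε t v * (Complex.exp (↑(2 * Real.pi * inner ℝ v (x - y)) * Complex.I) * starRingEnd ℂ (Kk d m ε t' (x' - y)))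
      = Complex.exp (↑(2 * Real.pi * inner ℝ v (x - x')) * Complex.I) * (Mk d m ε t v * starRingEnd ℂ (Mk d m ε t' v)) := by
    intro v
    rw [integral_const_mul]
    have e1 : ∫ y, Complex.exp (↑(2 * Real.pi * inner ℝ v (x - y)) * Complex.I) * starRingEnd ℂ (Kk d m ε t' (x' - y))
      = ∫ u, Complex.exp (↑(2 * Real.pi * inner ℝ v (x - x' + u)) * Complex.I) * starRingEnd ℂ (Kk d m ε t' u) := by
      rw [← integral_sub_left_eq_self (fun u => Complex.exp (↑(2 * Real.pi * inner ℝ v (x - x' + u)) * Complex.I) * starRingEnd ℂ (Kk d m ε t' u)) volume x']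
      congr 1; ext y
      rw [show x - x' + (x' - y) = x - y by abel]
    have e2 : ∀ u, Complex.exp (↑(2 * Real.pi * inner ℝ v (x - x' + u)) * Complex.I) * starRingEnd ℂ (Kk d m ε t' u)
      = Complex.exp (↑(2 * Real.pi * inner ℝ v (x - x')) * Complex.I) * starRingEnd ℂ (Complex.exp (↑(-2 * Real.pi * inner ℝ u v) * Complex.I) • Kk d m ε t' u) := by
      intro u
      rw [smul_eq_mul, map_mul, ← mul_assoc, ← Complex.exp_conj, ← Complex.exp_add]
      congr 2
      rw [inner_add_right, real_inner_comm u v]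
      simp only [map_mul, Complex.conj_ofReal, Complex.conj_I]
      push_cast
      ring
    rw [e1]
    simp_rw [e2]
    rw [integral_const_mul, integral_conj, ← Real.fourier_eq', hf']
    ring
  simp_rw [hin, Mk_mul_conj]
  rw [Kk_eq_fourierInv, Real.fourierInv_eq', ← integral_const_mul]
  congr 1; ext v; simp only [smul_eq_mul]; ring

attribute [local irreducible] Kk

lemma pair_fubini (d m : ℕ) (hd : 2 ≤ d) (hm : 1 ≤ m) {ε : ℝ} (h1 : 0 < ε) (h2 : ε ≤ 1)
    {Ω : Type*} [MeasurableSpace Ω] (P : Measure Ω) [SFinite P] (a a' : Ω → Ed d) (τ τ' : Ω → ℝ)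
    (ha : Measurable a) (ha' : Measurable a') (hτ : Measurable τ) (hτ' : Measurable τ')
    (hI : ∀ᵐ z ∂P, τ z ∈ Icc (1:ℝ) 2) (hI' : ∀ᵐ z ∂P, τ' z ∈ Icc (1:ℝ) 2)
    (c : Ω → ℂ) (hc : Integrable c P) :
    Integrable (fun y => ∫ z, c z * (Kk d m ε (τ z) (a z - y) * starRingEnd ℂ (Kk d m ε (τ' z) (a' z - y))) ∂P) ∧
    ∫ y, ∫ z, c z * (Kk d m ε (τ z) (a z - y) * starRingEnd ℂ (Kk d m ε (τ' z) (a' z - y))) ∂P =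
    ∫ z, c z * ((2 ^ (2 * m) : ℂ)⁻¹ * Kk d (2 * m) (2 * ε) (τ z - τ' z) (a z - a' z)) ∂P := by
  obtain ⟨B, hB, HB⟩ := Kk_sup d m (by omega) h1
  obtain ⟨C, hC, HC⟩ := Kk_L1 d m hd hm
  have hmeasK : Measurable (fun p : ℝ × Ed d => Kk d m ε p.1 p.2) := (continuous_Kk_joint d m h1).measurable
  have mk : Measurable (fun p : Ed d × Ω => Kk d m ε (τ p.2) (a p.2 - p.1)) := by
    exact hmeasK.comp (Measurable.prodMk (hτ.comp measurable_snd) ((ha.comp measurable_snd).sub measurable_fst))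
  have mk' : Measurable (fun p : Ed d × Ω => Kk d m ε (τ' p.2) (a' p.2 - p.1)) := by
    exact hmeasK.comp (Measurable.prodMk (hτ'.comp measurable_snd) ((ha'.comp measurable_snd).sub measurable_fst))
  have hint : Integrable (Function.uncurry fun (y : Ed d) (z : Ω) =>
      c z * (Kk d m ε (τ z) (a z - y) * starRingEnd ℂ (Kk d m ε (τ' z) (a' z - y)))) (volume.prod P) := by
    have hms : AEStronglyMeasurable (Function.uncurry fun (y : Ed d) (z : Ω) =>
      c z * (Kk d m ε (τ z) (a z - y) * starRingEnd ℂ (Kk d m ε (τ' z) (a' z - y)))) (volume.prod P) := by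
      simp only [Function.uncurry_def]
      refine AEStronglyMeasurable.mul ?_ ?_
      · exact hc.aestronglyMeasurable.comp_snd
      · apply Measurable.aestronglyMeasurable
        exact mk.mul (Complex.continuous_conj.measurable.comp mk')
    refine ⟨hms, ?_⟩
    rw [hasFiniteIntegral_iff_enorm, lintegral_prod_symm _ hms.enorm]
    have hb : ∀ᵐ z ∂P, ∫⁻ y, ‖Function.uncurry (fun (y : Ed d) (z : Ω) =>
      c z * (Kk d m ε (τ z) (a z - y) * starRingEnd ℂ (Kk d m ε (τ' z) (a' z - y)))) (y, z)‖ₑ ≤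
      ‖c z‖ₑ * (ENNReal.ofReal B * ENNReal.ofReal (C * ε ^ (1 - (d + 1 : ℝ) / 2))) := by
      filter_upwards [hI] with z hz
      simp only [Function.uncurry_apply_pair, enorm_mul]
      rw [lintegral_const_mul]
      swap
      · refine Measurable.mul (f := fun y => ‖Kk d m ε (τ z) (a z - y)‖ₑ) (g := fun y => ‖starRingEnd ℂ (Kk d m ε (τ' z) (a' z - y))‖ₑ) ?_ ?_
        · exact (mk.comp (by fun_prop : Measurable fun y : Ed d => (y, z))).enorm
        · exact (Complex.continuous_conj.measurable.comp (mk'.comp (by fun_prop : Measurable fun y : Ed d => (y, z)))).enorm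
      gcongr
      calc ∫⁻ y, ‖Kk d m ε (τ z) (a z - y)‖ₑ * ‖starRingEnd ℂ (Kk d m ε (τ' z) (a' z - y))‖ₑ
          ≤ ∫⁻ y, ‖Kk d m ε (τ z) (a z - y)‖ₑ * ENNReal.ofReal B := by
            gcongr with y
            rw [← ofReal_norm]
            apply ENNReal.ofReal_le_ofReal
            rw [RCLike.norm_conj]
            exact HB _ _
        _ = (∫⁻ y, ‖Kk d m ε (τ z) (a z - y)‖ₑ) * ENNReal.ofReal B := by
            rw [lintegral_mul_const]
            exact (mk.comp (by fun_prop : Measurable fun y : Ed d => (y, z))).enorm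
        _ = (∫⁻ y, ‖Kk d m ε (τ z) y‖ₑ) * ENNReal.ofReal B := by
            rw [lintegral_sub_left_eq_self (fun y => ‖Kk d m ε (τ z) y‖ₑ)]
        _ ≤ _ := by
            rw [mul_comm]
            gcongr
            exact HC ε _ h1 h2 hz.1 hz.2
    refine (lintegral_mono_ae hb).trans_lt ?_
    rw [lintegral_mul_const'' _ hc.aestronglyMeasurable.enorm]
    refine ENNReal.mul_lt_top hc.2 (ENNReal.mul_lt_top ENNReal.ofReal_lt_top ENNReal.ofReal_lt_top)
  refine ⟨hint.integral_prod_left, ?_⟩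
  rw [integral_integral_swap hint]
  refine integral_congr_ae ?_
  filter_upwards [hI, hI'] with z hz hz'
  rw [integral_const_mul, Kk_pair d m hd hm h1 h2 hz'.1 hz'.2]

lemma K2_L1 (d m : ℕ) (hd : 1 ≤ d) (hm : 1 ≤ m) : ∃ C : ℝ, 0 < C ∧ ∀ ρ : ℝ, 0 < ρ →
    ∫⁻ x : Ed d, ‖Kk d m ρ 0 x‖ₑ ≤ ENNReal.ofReal C := by
  obtain ⟨C, hC, H⟩ := Kk_bound d m hd
  have hp := Real.pi_gt_three
  let f : Ed d → ℝ := fun u => (1 + 2 * Real.pi * ‖u‖) ^ (-((m + d : ℕ) : ℝ))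
  have fi : Integrable f := by
    have h := integrable_one_add_norm (E := Ed d) (μ := volume) (r := (m + d : ℕ)) (by
      simp; omega)
    refine h.mono' (by apply Measurable.aestronglyMeasurable; fun_prop) ?_
    filter_upwards with u
    simp only [f]
    rw [Real.norm_of_nonneg (by positivity)]
    apply Real.rpow_le_rpow_of_nonpos (by positivity)
    · nlinarith [norm_nonneg u]
    · have : (0:ℝ) ≤ ((m + d : ℕ) : ℝ) := by positivity
      linarith
  have f0 : ∀ u, 0 ≤ f u := fun u => by simp only [f]; positivity
  have fI0 : 0 ≤ ∫ u, f u := integral_nonneg f0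
  refine ⟨C * (∫ u, f u) + 1, by positivity, ?_⟩
  intro ρ hρ
  have hpt : ∀ x : Ed d, ‖Kk d m ρ 0 x‖ ≤ C * (ρ⁻¹) ^ d * f (ρ⁻¹ • x) := by
    intro x
    have := H ρ 0 hρ x
    rw [abs_zero, sub_zero, add_zero, abs_of_nonneg (by positivity)] at this
    refine this.trans (le_of_eq ?_)
    simp only [f]
    set X := ρ + 2 * Real.pi * ‖x‖ with hX
    have hX0 : 0 < X := by positivity
    have e : 1 + 2 * Real.pi * ‖ρ⁻¹ • x‖ = X / ρ := by
      rw [norm_smul, Real.norm_of_nonneg (by positivity)]; field_simp; rfl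
    rw [e, Real.div_rpow hX0.le hρ.le, mul_assoc, ← Real.rpow_add hX0, Real.rpow_neg hρ.le, Real.rpow_natCast]
    rw [show -(m + (d + 1 : ℝ) / 2) + (1 - (d + 1 : ℝ) / 2) = -((m + d : ℕ) : ℝ) by push_cast; ring]
    rw [inv_pow]
    field_simp
    try ring
  calc ∫⁻ x : Ed d, ‖Kk d m ρ 0 x‖ₑ ≤ ∫⁻ x : Ed d, ENNReal.ofReal (C * (ρ⁻¹) ^ d * f (ρ⁻¹ • x)) := by
        gcongr with x
        rw [← ofReal_norm]
        exact ENNReal.ofReal_le_ofReal (hpt x)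
    _ = ENNReal.ofReal (∫ x : Ed d, C * (ρ⁻¹) ^ d * f (ρ⁻¹ • x)) := by
        rw [ofReal_integral_eq_lintegral_ofReal]
        · exact (fi.comp_smul (inv_ne_zero hρ.ne')).const_mul _
        · filter_upwards with x
          have := f0 (ρ⁻¹ • x)
          positivity
    _ ≤ _ := by
        apply ENNReal.ofReal_le_ofReal
        rw [integral_const_mul, Measure.integral_comp_smul, finrank_euclideanSpace_fin, smul_eq_mul,
          abs_of_pos (by positivity)]
        have : C * ρ⁻¹ ^ d * ((ρ⁻¹ ^ d)⁻¹ * ∫ u, f u) = C * ∫ u, f u := by field_simp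
        rw [this]; linarith

/-- fixed-time operator -/
def St (d m : ℕ) (ε t : ℝ) (φ : Ed d → ℂ) (y : Ed d) : ℂ := ∫ x, Kk d m ε t (x - y) * φ x

lemma ennreal_mul_le_sq_add_sq (a b : ℝ≥0∞) : a * b ≤ a ^ 2 + b ^ 2 := by
  rcases le_total a b with h | h
  · calc a * b ≤ b * b := by gcongr
      _ = b ^ 2 := (sq b).symm
      _ ≤ _ := le_add_self
  · calc a * b ≤ a * a := by gcongr
      _ = a ^ 2 := (sq a).symm
      _ ≤ _ := le_self_add

lemma St_L2 (d m : ℕ) (hd : 2 ≤ d) (hm : 1 ≤ m) : ∃ C : ℝ, 0 < C ∧ ∀ (ε t : ℝ), 0 < ε → ε ≤ 1 → 1 ≤ t → t ≤ 2 →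
    ∀ φ : Ed d → ℂ, Integrable φ → ∫⁻ y, ‖St d m ε t φ y‖ₑ ^ 2 ≤ ENNReal.ofReal C * ∫⁻ x, ‖φ x‖ₑ ^ 2 := by
  obtain ⟨C, hC, H⟩ := K2_L1 d (2 * m) (by omega) (by omega)
  refine ⟨2 * C, by positivity, ?_⟩
  intro ε t h1 h2 h3 h4 φ hφ
  have hc : Integrable (fun p : Ed d × Ed d => φ p.1 * starRingEnd ℂ (φ p.2)) (volume.prod volume) :=
    hφ.mul_prod (Complex.conjCLE.toContinuousLinearMap.integrable_comp hφ)
  obtain ⟨hi, he⟩ := pair_fubini d m hd hm h1 h2 (volume.prod (volume : Measure (Ed d))) (fun p => p.1) (fun p => p.2)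
    (fun _ => t) (fun _ => t) measurable_fst measurable_snd measurable_const measurable_const
    (by filter_upwards with z using ⟨h3, h4⟩) (by filter_upwards with z using ⟨h3, h4⟩) _ hc
  have hin : ∀ y, ∫ z : Ed d × Ed d, φ z.1 * starRingEnd ℂ (φ z.2) * (Kk d m ε t (z.1 - y) * starRingEnd ℂ (Kk d m ε t (z.2 - y))) ∂(volume.prod volume)
      = ((‖St d m ε t φ y‖ ^ 2 : ℝ) : ℂ) := by
    intro y
    have := integral_prod_mul (μ := (volume : Measure (Ed d))) (ν := (volume : Measure (Ed d)))
      (fun x => Kk d m ε t (x - y) * φ x) (fun x => starRingEnd ℂ (Kk d m ε t (x - y) * φ x))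
    rw [integral_conj] at this
    push_cast
    rw [← Complex.mul_conj', St, ← this]
    congr 1; ext z; rw [map_mul]; ring
  simp_rw [hin] at hi he
  have hi' : Integrable (fun y => ‖St d m ε t φ y‖ ^ 2) := by
    have := hi.re
    simpa only [RCLike.re_to_complex, Complex.ofReal_re] using this
  have e1 : ∫⁻ y, ‖St d m ε t φ y‖ₑ ^ 2 = ENNReal.ofReal (∫ y, ‖St d m ε t φ y‖ ^ 2) := by
    rw [ofReal_integral_eq_lintegral_ofReal hi' (by filter_upwards with y; positivity)]
    congr 1; ext y
    rw [ENNReal.ofReal_pow (norm_nonneg _), ofReal_norm]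
  have e2 : ENNReal.ofReal (∫ y, ‖St d m ε t φ y‖ ^ 2) = ‖∫ y, ((‖St d m ε t φ y‖ ^ 2 : ℝ) : ℂ)‖ₑ := by
    rw [integral_complex_ofReal, ← ofReal_norm, Complex.norm_real, Real.norm_of_nonneg]
    exact integral_nonneg (fun y => by positivity)
  rw [e1, e2, he]
  have hcK := continuous_Kk d (2 * m) (ε := 2 * ε) (by positivity) 0
  have two : ‖((2:ℂ) ^ (2 * m))⁻¹‖ₑ ≤ 1 := by
    rw [← ofReal_norm, ← ENNReal.ofReal_one]
    apply ENNReal.ofReal_le_ofReal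
    rw [norm_inv, norm_pow, Complex.norm_ofNat]
    exact inv_le_one_of_one_le₀ (one_le_pow₀ (by norm_num))
  have hLK : ∫⁻ x : Ed d, ‖Kk d (2 * m) (2 * ε) 0 x‖ₑ ≤ ENNReal.ofReal C := H (2 * ε) (by positivity)
  set κ : Ed d → ℝ≥0∞ := fun x => ‖Kk d (2 * m) (2 * ε) 0 x‖ₑ with hκ
  have hκm : Measurable κ := hcK.measurable.enorm
  have hφm : AEMeasurable (fun x => ‖φ x‖ₑ) := hφ.aestronglyMeasurable.enorm
  have hA : AEMeasurable (fun z : Ed d × Ed d => ‖φ z.1‖ₑ ^ 2 * κ (z.1 - z.2)) (volume.prod volume) :=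
    (hφm.comp_fst.pow_const 2).mul (hκm.comp (measurable_fst.sub measurable_snd)).aemeasurable
  have hA' : AEMeasurable (fun z : Ed d × Ed d => ‖φ z.2‖ₑ ^ 2 * κ (z.1 - z.2)) (volume.prod volume) :=
    (hφm.comp_snd.pow_const 2).mul (hκm.comp (measurable_fst.sub measurable_snd)).aemeasurable
  calc ‖∫ z : Ed d × Ed d, φ z.1 * starRingEnd ℂ (φ z.2) * ((2 ^ (2 * m) : ℂ)⁻¹ * Kk d (2 * m) (2 * ε) (t - t) (z.1 - z.2)) ∂(volume.prod volume)‖ₑ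
      ≤ ∫⁻ z : Ed d × Ed d, ‖φ z.1 * starRingEnd ℂ (φ z.2) * ((2 ^ (2 * m) : ℂ)⁻¹ * Kk d (2 * m) (2 * ε) (t - t) (z.1 - z.2))‖ₑ ∂(volume.prod volume) :=
        enorm_integral_le_lintegral_enorm _
    _ ≤ ∫⁻ z : Ed d × Ed d, ((‖φ z.1‖ₑ ^ 2 * κ (z.1 - z.2)) + (‖φ z.2‖ₑ ^ 2 * κ (z.1 - z.2))) ∂(volume.prod volume) := by
        gcongr with z
        rw [sub_self, enorm_mul, enorm_mul, enorm_mul, ← add_mul]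
        calc ‖φ z.1‖ₑ * ‖starRingEnd ℂ (φ z.2)‖ₑ * (‖((2:ℂ) ^ (2 * m))⁻¹‖ₑ * ‖Kk d (2 * m) (2 * ε) 0 (z.1 - z.2)‖ₑ)
            ≤ ‖φ z.1‖ₑ * ‖starRingEnd ℂ (φ z.2)‖ₑ * (1 * ‖Kk d (2 * m) (2 * ε) 0 (z.1 - z.2)‖ₑ) := by gcongr
          _ = ‖φ z.1‖ₑ * ‖φ z.2‖ₑ * κ (z.1 - z.2) := by
            rw [one_mul, RCLike.enorm_conj]
          _ ≤ _ := by gcongr; exact ennreal_mul_le_sq_add_sq _ _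
    _ = ∫⁻ z : Ed d × Ed d, (‖φ z.1‖ₑ ^ 2 * κ (z.1 - z.2)) ∂(volume.prod volume) + ∫⁻ z : Ed d × Ed d, (‖φ z.2‖ₑ ^ 2 * κ (z.1 - z.2)) ∂(volume.prod volume) := by
        exact lintegral_add_left' hA _
    _ = (∫⁻ x, ‖φ x‖ₑ ^ 2) * (∫⁻ x, κ x) + (∫⁻ x, ‖φ x‖ₑ ^ 2) * (∫⁻ x, κ x) := by
        congr 1
        · rw [lintegral_prod _ hA]
          rw [← lintegral_mul_const'' _ (hφm.pow_const 2)]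
          congr 1; ext x
          simp only
          rw [lintegral_const_mul _ (show Measurable (fun y => κ (x - y)) from hκm.comp (measurable_const.sub measurable_id)), lintegral_sub_left_eq_self κ]
        · rw [lintegral_prod_symm _ hA']
          rw [← lintegral_mul_const'' _ (hφm.pow_const 2)]
          congr 1; ext x
          simp only
          rw [lintegral_const_mul _ (show Measurable (fun y => κ (y - x)) from hκm.comp (measurable_id.sub measurable_const)), lintegral_sub_right_eq_self κ]
    _ ≤ (∫⁻ x, ‖φ x‖ₑ ^ 2) * ENNReal.ofReal C + (∫⁻ x, ‖φ x‖ₑ ^ 2) * ENNReal.ofReal C := by gcongr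
    _ = _ := by
        rw [ENNReal.ofReal_mul (by norm_num), ENNReal.ofReal_ofNat]; ring

/-- the time measure -/
abbrev Tm : Measure ℝ := volume.restrict (Icc (1:ℝ) 2)

/-- space-time measure -/
abbrev lam (d : ℕ) : Measure (Ed d × ℝ) := volume.prod Tm

/-- dual operator -/
def Sg (d m : ℕ) (ε : ℝ) (g : Ed d × ℝ → ℂ) (y : Ed d) : ℂ := ∫ z, Kk d m ε z.2 (z.1 - y) * g z ∂(lam d)

lemma near_generic {E : Type*} [MeasurableSpace E] (μ : Measure E) [SFinite μ] (T : Measure ℝ) [SFinite T]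
    (a : E × ℝ → ℂ) (ha : Integrable a (μ.prod T)) (N : Set (ℝ × ℝ)) (hN : MeasurableSet N) :
    ‖∫ z : (E × ℝ) × (E × ℝ), N.indicator (fun _ => (1:ℂ)) (z.1.2, z.2.2) * (a z.1 * starRingEnd ℂ (a z.2)) ∂((μ.prod T).prod (μ.prod T))‖ₑ ≤
    ∫⁻ t, ∫⁻ t', N.indicator (fun _ => (1:ℝ≥0∞)) (t, t') * (‖∫ x, a (x, t) ∂μ‖ₑ * ‖∫ x, a (x, t') ∂μ‖ₑ) ∂T ∂T := by
  have ha' : Integrable (fun z => starRingEnd ℂ (a z)) (μ.prod T) :=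
    Complex.conjCLE.toContinuousLinearMap.integrable_comp ha
  have hnm : Measurable (fun p : ℝ × ℝ => N.indicator (fun _ => (1:ℂ)) p) := measurable_const.indicator hN
  have hnb : ∀ p, ‖N.indicator (fun _ => (1:ℂ)) p‖ ≤ 1 := by
    intro p; rw [indicator]; split_ifs <;> simp
  have hbig : Integrable (fun z : (E × ℝ) × (E × ℝ) => N.indicator (fun _ => (1:ℂ)) (z.1.2, z.2.2) * (a z.1 * starRingEnd ℂ (a z.2))) ((μ.prod T).prod (μ.prod T)) := by
    refine (ha.mul_prod ha').bdd_mul (c := 1) ?_ ?_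
    · exact (hnm.comp ((measurable_snd.comp measurable_fst).prodMk (measurable_snd.comp measurable_snd))).aestronglyMeasurable
    · filter_upwards with z using hnb _
  rw [integral_prod _ hbig]
  have hbig' := hbig.integral_prod_left
  set G : ℝ → ℂ := fun t => ∫ x, a (x, t) ∂μ with hG
  set H : ℝ → ℂ := fun t => ∫ t', N.indicator (fun _ => (1:ℂ)) (t, t') * starRingEnd ℂ (G t') ∂T with hH
  have hinner : ∀ z : E × ℝ, ∫ z' : E × ℝ, N.indicator (fun _ => (1:ℂ)) (z.2, z'.2) * (a z * starRingEnd ℂ (a z')) ∂(μ.prod T)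
      = a z * H z.2 := by
    intro z
    have : ∀ z' : E × ℝ, N.indicator (fun _ => (1:ℂ)) (z.2, z'.2) * (a z * starRingEnd ℂ (a z')) =
      a z * (N.indicator (fun _ => (1:ℂ)) (z.2, z'.2) * starRingEnd ℂ (a z')) := fun z' => by ring
    simp_rw [this]
    rw [integral_const_mul]
    congr 1
    rw [integral_prod_symm]
    · simp only [hH]
      congr 1; ext t'
      rw [integral_const_mul, integral_conj]
    · refine ha'.bdd_mul (c := 1) ?_ ?_
      · exact (hnm.comp (measurable_const.prodMk measurable_snd)).aestronglyMeasurable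
      · filter_upwards with z using hnb _
  simp_rw [hinner] at hbig' ⊢
  rw [integral_prod_symm _ hbig']
  simp only [integral_mul_const]
  refine (enorm_integral_le_lintegral_enorm _).trans ?_
  refine lintegral_mono (fun t => ?_)
  rw [enorm_mul]
  have e1 : ‖H t‖ₑ ≤ ∫⁻ t', N.indicator (fun _ => (1:ℝ≥0∞)) (t, t') * ‖G t'‖ₑ ∂T := by
    refine (enorm_integral_le_lintegral_enorm _).trans ?_
    refine lintegral_mono (fun t' => ?_)
    simp only
    rw [enorm_mul, RCLike.enorm_conj]
    gcongr
    simp only [indicator]; split_ifs <;> simp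
  calc ‖∫ x, a (x, t) ∂μ‖ₑ * ‖H t‖ₑ ≤ ‖G t‖ₑ * ∫⁻ t', N.indicator (fun _ => (1:ℝ≥0∞)) (t, t') * ‖G t'‖ₑ ∂T := by gcongr
    _ = ∫⁻ t', ‖G t‖ₑ * (N.indicator (fun _ => (1:ℝ≥0∞)) (t, t') * ‖G t'‖ₑ) ∂T := by
        rw [lintegral_const_mul'' ]
        refine AEMeasurable.mul ?_ ?_
        · exact ((measurable_const.indicator hN).comp (measurable_const.prodMk measurable_id)).aemeasurable
        · exact (ha.integral_prod_right.aestronglyMeasurable).enorm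
    _ = _ := by
        congr 1; ext t'; ring

lemma schur_sym {T : Measure ℝ} [SFinite T] (κ : ℝ → ℝ → ℝ≥0∞) (hκ : Measurable (Function.uncurry κ))
    (hs : ∀ t t', κ t t' = κ t' t) (c : ℝ≥0∞) (hc : ∀ t, ∫⁻ t', κ t t' ∂T ≤ c) (s : ℝ → ℝ≥0∞) (hsm : Measurable s) :
    ∫⁻ t, ∫⁻ t', κ t t' * (s t * s t') ∂T ∂T ≤ 2 * c * ∫⁻ t, s t ^ 2 ∂T := by
  have h1 : ∀ t, Measurable (κ t) := fun t => hκ.comp (measurable_const.prodMk measurable_id)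
  have hs2 : Measurable (fun t => s t ^ 2) := hsm.pow_const 2
  have hA : ∫⁻ t, ∫⁻ t', κ t t' * s t ^ 2 ∂T ∂T ≤ c * ∫⁻ t, s t ^ 2 ∂T := by
    rw [← lintegral_const_mul _ hs2]
    refine lintegral_mono (fun t => ?_)
    rw [lintegral_mul_const _ (h1 t)]
    gcongr
    exact hc t
  have hm1 : Measurable (fun q : ℝ × ℝ => κ q.1 q.2 * s q.1 ^ 2) := by
    refine Measurable.mul (f := fun q : ℝ × ℝ => κ q.1 q.2) hκ (hs2.comp measurable_fst)
  have hB : ∫⁻ t, ∫⁻ t', κ t t' * s t' ^ 2 ∂T ∂T = ∫⁻ t, ∫⁻ t', κ t t' * s t ^ 2 ∂T ∂T := by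
    rw [lintegral_lintegral_swap]
    · refine lintegral_congr (fun t => lintegral_congr (fun t' => ?_))
      rw [hs]
    · exact (Measurable.mul (f := fun q : ℝ × ℝ => κ q.1 q.2) hκ (hs2.comp measurable_snd)).aemeasurable
  calc ∫⁻ t, ∫⁻ t', κ t t' * (s t * s t') ∂T ∂T ≤ ∫⁻ t, ∫⁻ t', (κ t t' * s t ^ 2 + κ t t' * s t' ^ 2) ∂T ∂T := by
        refine lintegral_mono (fun t => lintegral_mono (fun t' => ?_))
        simp only
        rw [← mul_add]
        gcongr
        exact ennreal_mul_le_sq_add_sq _ _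
    _ = ∫⁻ t, (∫⁻ t', κ t t' * s t ^ 2 ∂T + ∫⁻ t', κ t t' * s t' ^ 2 ∂T) ∂T := by
        refine lintegral_congr (fun t => ?_)
        exact lintegral_add_left ((h1 t).mul_const _) _
    _ = ∫⁻ t, ∫⁻ t', κ t t' * s t ^ 2 ∂T ∂T + ∫⁻ t, ∫⁻ t', κ t t' * s t' ^ 2 ∂T ∂T :=
        lintegral_add_left hm1.lintegral_prod_right' _
    _ ≤ _ := by
        rw [hB, ← two_mul, mul_assoc]
        gcongr

lemma near_bound (d m : ℕ) (hd : 2 ≤ d) (hm : 1 ≤ m) : ∃ C : ℝ, 0 < C ∧ ∀ (ε : ℝ), 0 < ε → ε ≤ 1 →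
    ∀ g : Ed d × ℝ → ℂ, Measurable g → Integrable g (lam d) → ∀ W : ℝ, 0 < W →
    ∫⁻ y, ‖∫ z : (Ed d × ℝ) × (Ed d × ℝ), {p : ℝ × ℝ | |p.1 - p.2| ≤ W}.indicator (fun _ => (1:ℂ)) (z.1.2, z.2.2) *
      ((Kk d m ε z.1.2 (z.1.1 - y) * g z.1) * starRingEnd ℂ (Kk d m ε z.2.2 (z.2.1 - y) * g z.2)) ∂((lam d).prod (lam d))‖ₑ
    ≤ ENNReal.ofReal (C * W) * ∫⁻ z, ‖g z‖ₑ ^ 2 ∂(lam d) := by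
  obtain ⟨C, hC, H⟩ := St_L2 d m hd hm
  refine ⟨4 * C, by positivity, ?_⟩
  intro ε h1 h2 g hg hgi W hW
  obtain ⟨B, hB, HB⟩ := Kk_sup d m (by omega) h1
  have hmeasK : Measurable (fun p : ℝ × Ed d => Kk d m ε p.1 p.2) := (continuous_Kk_joint d m h1).measurable
  have hNm : MeasurableSet {p : ℝ × ℝ | |p.1 - p.2| ≤ W} :=
    measurableSet_le ((measurable_fst.sub measurable_snd).abs) measurable_const
  set N : Set (ℝ × ℝ) := {p : ℝ × ℝ | |p.1 - p.2| ≤ W} with hN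
  have hai : ∀ y, Integrable (fun z : Ed d × ℝ => Kk d m ε z.2 (z.1 - y) * g z) (lam d) := by
    intro y
    refine hgi.bdd_mul (c := B) ?_ ?_
    · exact (hmeasK.comp (measurable_snd.prodMk (measurable_fst.sub measurable_const))).aestronglyMeasurable
    · filter_upwards with z using HB _ _
  -- measurability of G
  have hGm : Measurable (fun p : Ed d × ℝ => St d m ε p.2 (fun x => g (x, p.2)) p.1) := by
    have : StronglyMeasurable (fun q : (Ed d × ℝ) × Ed d => Kk d m ε q.1.2 (q.2 - q.1.1) * g (q.2, q.1.2)) := by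
      apply Measurable.stronglyMeasurable
      refine Measurable.mul (f := fun q : (Ed d × ℝ) × Ed d => Kk d m ε q.1.2 (q.2 - q.1.1)) (g := fun q => g (q.2, q.1.2)) ?_ ?_
      · exact hmeasK.comp ((measurable_snd.comp measurable_fst).prodMk (measurable_snd.sub (measurable_fst.comp measurable_fst)))
      · exact hg.comp (measurable_snd.prodMk (measurable_snd.comp measurable_fst))
    exact (this.integral_prod_right (ν := (volume : Measure (Ed d)))).measurable
  set γ : Ed d → ℝ → ℝ≥0∞ := fun y t => ‖St d m ε t (fun x => g (x, t)) y‖ₑ ^ 2 with hγ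
  have hγm : Measurable (Function.uncurry γ) := (hGm.enorm).pow_const 2
  have hvol : ∀ t : ℝ, ∫⁻ t', N.indicator (fun _ => (1:ℝ≥0∞)) (t, t') ∂Tm ≤ ENNReal.ofReal (2 * W) := by
    intro t
    calc ∫⁻ t', N.indicator (fun _ => (1:ℝ≥0∞)) (t, t') ∂Tm ≤ ∫⁻ t', N.indicator (fun _ => (1:ℝ≥0∞)) (t, t') :=
          lintegral_mono' Measure.restrict_le_self le_rfl
      _ = ∫⁻ t', (Icc (t - W) (t + W)).indicator (fun _ => (1:ℝ≥0∞)) t' := by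
          congr 1; ext t'
          have : ((t, t') ∈ N) ↔ t' ∈ Icc (t - W) (t + W) := by
            simp only [hN]
            show |t - t'| ≤ W ↔ _
            rw [abs_le, mem_Icc]; constructor <;> rintro ⟨_, _⟩ <;> constructor <;> linarith
          simp only [indicator, this]
      _ = _ := by
          rw [lintegral_indicator measurableSet_Icc, lintegral_one, Measure.restrict_apply_univ, Real.volume_Icc]
          congr 1; ring
  have hsym : ∀ t t' : ℝ, N.indicator (fun _ => (1:ℝ≥0∞)) (t, t') = N.indicator (fun _ => (1:ℝ≥0∞)) (t', t) := by
    intro t t'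
    have : ((t, t') ∈ N) ↔ (t', t) ∈ N := by
      simp only [hN]
      show |t - t'| ≤ W ↔ |t' - t| ≤ W
      rw [abs_sub_comm]
    simp only [indicator, this]
  have hNi : Measurable (N.indicator (fun _ => (1:ℝ≥0∞))) := measurable_const.indicator hNm
  have hNi1 : ∀ t, Measurable (fun t' => N.indicator (fun _ => (1:ℝ≥0∞)) (t, t')) := fun t => hNi.comp (measurable_const.prodMk measurable_id)
  have step1 : ∀ y, ‖∫ z : (Ed d × ℝ) × (Ed d × ℝ), N.indicator (fun _ => (1:ℂ)) (z.1.2, z.2.2) *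
      ((Kk d m ε z.1.2 (z.1.1 - y) * g z.1) * starRingEnd ℂ (Kk d m ε z.2.2 (z.2.1 - y) * g z.2)) ∂((lam d).prod (lam d))‖ₑ
      ≤ ENNReal.ofReal (4 * W) * ∫⁻ t, γ y t ∂Tm := by
    intro y
    refine (near_generic volume Tm _ (hai y) N hNm).trans ?_
    have := schur_sym (T := Tm) (fun t t' => N.indicator (fun _ => (1:ℝ≥0∞)) (t, t')) hNi hsym _ hvol
      (fun t => ‖St d m ε t (fun x => g (x, t)) y‖ₑ) (hGm.comp (measurable_const.prodMk measurable_id)).enorm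
    refine this.trans (le_of_eq ?_)
    congr 1
    rw [← ENNReal.ofReal_ofNat, ← ENNReal.ofReal_mul (by positivity)]
    congr 1; ring
  have hgt : ∀ᵐ t ∂Tm, Integrable (fun x => g (x, t)) := hgi.prod_left_ae
  calc _ ≤ ∫⁻ y, ENNReal.ofReal (4 * W) * ∫⁻ t, γ y t ∂Tm := lintegral_mono step1
    _ = ENNReal.ofReal (4 * W) * ∫⁻ y, ∫⁻ t, γ y t ∂Tm := by
        exact lintegral_const_mul _ hγm.lintegral_prod_right'
    _ = ENNReal.ofReal (4 * W) * ∫⁻ t, (∫⁻ y, γ y t) ∂Tm := by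
        rw [lintegral_lintegral_swap hγm.aemeasurable]
    _ ≤ ENNReal.ofReal (4 * W) * ∫⁻ t, (ENNReal.ofReal C * ∫⁻ x, ‖g (x, t)‖ₑ ^ 2) ∂Tm := by
        gcongr 1
        apply lintegral_mono_ae
        filter_upwards [hgt, ae_restrict_mem measurableSet_Icc] with t ht htI
        exact H ε t h1 h2 htI.1 htI.2 _ ht
    _ = ENNReal.ofReal (4 * W) * (ENNReal.ofReal C * ∫⁻ t, (∫⁻ x, ‖g (x, t)‖ₑ ^ 2) ∂Tm) := by
        rw [lintegral_const_mul _ (hg.enorm.pow_const 2).lintegral_prod_left']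
    _ = _ := by
        rw [lintegral_prod_symm _ (hg.enorm.pow_const 2).aemeasurable, ← mul_assoc, ← ENNReal.ofReal_mul (by positivity)]
        congr 2; ring

lemma dens1 (a : ℝ) (ha : 1 < a) : ∃ C : ℝ, 0 < C ∧ ∀ {X : Type} [PseudoMetricSpace X] [MeasurableSpace X] [OpensMeasurableSpace X]
    (μ : Measure X) (A : Set X) (v : ℝ) (_ : 0 < v) (z : X)
    (_ : ∀ ρ : ℝ, 0 < ρ → ρ ≤ 1 → μ (A ∩ closedBall z ρ) ≤ ENNReal.ofReal (v * ρ)) (W : ℝ) (_ : 0 < W),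
    ∫⁻ z' in A, {z' | W < dist z z' ∧ dist z z' ≤ 1}.indicator (fun z' => ENNReal.ofReal (dist z z' ^ (-a))) z' ∂μ ≤ ENNReal.ofReal (C * v * W ^ (1 - a)) := by
  have hr0 : 0 < (2:ℝ) ^ (1 - a) := by positivity
  have hr : (2:ℝ) ^ (1 - a) < 1 := Real.rpow_lt_one_of_one_lt_of_neg (by norm_num) (by linarith)
  have hr1 : 0 < 1 - (2:ℝ) ^ (1 - a) := by linarith
  refine ⟨2 * (1 - (2:ℝ) ^ (1 - a))⁻¹, by positivity, ?_⟩
  intro X _ _ _ μ A v hv z H W hW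
  have hpt : ∀ z' : X, {z' | W < dist z z' ∧ dist z z' ≤ 1}.indicator (fun z' => ENNReal.ofReal (dist z z' ^ (-a))) z' ≤
      ∑' j : ℕ, (closedBall z (min 1 (W * 2 ^ (j + 1)))).indicator (fun _ => ENNReal.ofReal ((W * 2 ^ j) ^ (-a))) z' := by
    intro z'
    by_cases h : z' ∈ {z' | W < dist z z' ∧ dist z z' ≤ 1}
    · rw [indicator_of_mem h]
      obtain ⟨h1, h2⟩ := h
      obtain ⟨n, hn1, hn2⟩ := exists_nat_pow_near (x := dist z z' / W) (y := (2:ℝ)) (by rw [le_div_iff₀ hW]; linarith) (by norm_num)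
      rw [le_div_iff₀ hW] at hn1
      rw [div_lt_iff₀ hW] at hn2
      refine le_trans ?_ (ENNReal.le_tsum n)
      rw [indicator_of_mem]
      · apply ENNReal.ofReal_le_ofReal
        apply Real.rpow_le_rpow_of_nonpos (by positivity)
        · linarith
        · linarith
      · rw [mem_closedBall, dist_comm]
        exact le_min h2 (by linarith)
    · rw [indicator_of_notMem h]; exact bot_le
  calc _ ≤ ∫⁻ z' in A, ∑' j : ℕ, (closedBall z (min 1 (W * 2 ^ (j + 1)))).indicator (fun _ => ENNReal.ofReal ((W * 2 ^ j) ^ (-a))) z' ∂μ :=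
        lintegral_mono hpt
    _ = ∑' j : ℕ, ∫⁻ z' in A, (closedBall z (min 1 (W * 2 ^ (j + 1)))).indicator (fun _ => ENNReal.ofReal ((W * 2 ^ j) ^ (-a))) z' ∂μ := by
        rw [lintegral_tsum]
        intro j
        exact (measurable_const.indicator measurableSet_closedBall).aemeasurable
    _ ≤ ∑' j : ℕ, ENNReal.ofReal (2 * v * W ^ (1 - a) * ((2:ℝ) ^ (1 - a)) ^ j) := by
        apply ENNReal.tsum_le_tsum
        intro j
        rw [lintegral_indicator_const measurableSet_closedBall, Measure.restrict_apply measurableSet_closedBall, inter_comm]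
        have hm : 0 < min 1 (W * 2 ^ (j + 1)) := by positivity
        calc _ ≤ ENNReal.ofReal ((W * 2 ^ j) ^ (-a)) * ENNReal.ofReal (v * min 1 (W * 2 ^ (j + 1))) := by
              gcongr
              exact H _ hm (min_le_left _ _)
          _ ≤ ENNReal.ofReal ((W * 2 ^ j) ^ (-a)) * ENNReal.ofReal (v * (W * 2 ^ (j + 1))) := by
              gcongr; exact min_le_right _ _
          _ = _ := by
              rw [← ENNReal.ofReal_mul (by positivity)]
              congr 1
              have e1 : (W * 2 ^ j) ^ (1 - a) = W ^ (1 - a) * ((2:ℝ) ^ (1 - a)) ^ j := by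
                rw [Real.mul_rpow hW.le (by positivity), ← Real.rpow_natCast, ← Real.rpow_mul (by norm_num), ← Real.rpow_natCast, ← Real.rpow_mul (by norm_num)]
                congr 2; ring
              have e2 : (W * 2 ^ j) ^ (1 - a) = (W * 2 ^ j) * (W * 2 ^ j) ^ (-a) := by
                rw [sub_eq_add_neg, Real.rpow_add (by positivity), Real.rpow_one]
              rw [mul_assoc (2 * v), ← e1, e2, pow_succ]; ring
    _ = _ := by
        rw [← ENNReal.ofReal_tsum_of_nonneg]
        · congr 1
          rw [tsum_mul_left, tsum_geometric_of_lt_one hr0.le hr]; ring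
        · intro j; positivity
        · exact (summable_geometric_of_lt_one hr0.le hr).mul_left _

lemma dens2 (d : ℕ) : ∃ C : ℝ, 0 < C ∧ ∀ (A : Set (Ed d × ℝ)) (_ : MeasurableSet A) (v : ℝ) (_ : 0 < v)
    (_ : ∀ z ∈ A, z.2 ∈ Icc (1:ℝ) 2)
    (_ : ∀ z ∈ A, ∀ ρ : ℝ, 0 < ρ → ρ ≤ 1 → lam d (A ∩ closedBall z ρ) ≤ ENNReal.ofReal (v * ρ)) (x : Ed d),
    ∫⁻ z' in A, {z' : Ed d × ℝ | 1 ≤ ‖x - z'.1‖}.indicator (fun z' => ENNReal.ofReal (‖x - z'.1‖ ^ (-(d + 1 : ℝ)))) z' ∂(lam d)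
      ≤ ENNReal.ofReal (C * v) := by
  have hf : Integrable (fun w : Ed d => (1 + ‖w‖) ^ (-(d + 1 : ℝ))) := by
    apply integrable_one_add_norm; simp
  set I := ∫ w : Ed d, (1 + ‖w‖) ^ (-(d + 1 : ℝ)) with hI
  have hI0 : 0 ≤ I := integral_nonneg (fun w => by positivity)
  set c := (volume : Measure (Ed d)).real (closedBall 0 (1/2)) with hc
  have hc0 : 0 < c := by
    apply ENNReal.toReal_pos
    · exact (measure_closedBall_pos _ _ (by norm_num)).ne'
    · exact measure_closedBall_lt_top.ne
  have hvc : ∀ w : Ed d, volume (closedBall w (1/2)) = ENNReal.ofReal c := by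
    intro w
    rw [Measure.addHaar_closedBall_center, hc, ofReal_measureReal measure_closedBall_lt_top.ne]
  refine ⟨c⁻¹ * 4 ^ (d + 1 : ℝ) * I + 1, by positivity, ?_⟩
  intro A hA v hv hAI H x
  set F : Ed d × ℝ → ℝ≥0∞ := {z' : Ed d × ℝ | 1 ≤ ‖x - z'.1‖}.indicator (fun z' => ENNReal.ofReal (‖x - z'.1‖ ^ (-(d + 1 : ℝ)))) with hF
  set f : Ed d → ℝ≥0∞ := fun w => ENNReal.ofReal (4 ^ (d + 1 : ℝ) * (1 + ‖x - w‖) ^ (-(d + 1 : ℝ))) with hf'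
  have hfm : Measurable f := by simp only [hf']; fun_prop
  -- pointwise smoothing
  have hpt : ∀ z' : Ed d × ℝ, F z' * ENNReal.ofReal c ≤ ∫⁻ w, (closedBall z'.1 (1/2)).indicator f w := by
    intro z'
    rw [lintegral_indicator measurableSet_closedBall, ← hvc z'.1, ← setLIntegral_const]
    apply setLIntegral_mono hfm
    intro w hw
    simp only [hF]
    by_cases h : z' ∈ {z' : Ed d × ℝ | 1 ≤ ‖x - z'.1‖}
    · rw [indicator_of_mem h]
      have h' : 1 ≤ ‖x - z'.1‖ := h
      apply ENNReal.ofReal_le_ofReal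
      rw [mem_closedBall, dist_eq_norm] at hw
      have : ‖x - w‖ ≤ ‖x - z'.1‖ + ‖w - z'.1‖ := by
        rw [show x - w = (x - z'.1) - (w - z'.1) by abel]; exact norm_sub_le _ _
      have h3 : (1 + ‖x - w‖) / 4 ≤ ‖x - z'.1‖ := by linarith
      calc ‖x - z'.1‖ ^ (-(d + 1 : ℝ)) ≤ ((1 + ‖x - w‖) / 4) ^ (-(d + 1 : ℝ)) := by
            apply Real.rpow_le_rpow_of_nonpos (by positivity) h3
            have : (0:ℝ) ≤ d := by positivity
            linarith
        _ = _ := by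
            rw [Real.div_rpow (by positivity) (by positivity), Real.rpow_neg (by norm_num : (0:ℝ) ≤ 4)]
            field_simp
    · rw [indicator_of_notMem h]; exact bot_le
  have hball : ∀ w : Ed d, lam d (A ∩ {z' | z'.1 ∈ closedBall w (1/2)}) ≤ ENNReal.ofReal v := by
    intro w
    rcases (A ∩ {z' : Ed d × ℝ | z'.1 ∈ closedBall w (1/2)}).eq_empty_or_nonempty with h | ⟨z, hz, hzw⟩
    · rw [h]; simp
    · have := H z hz 1 one_pos le_rfl
      rw [mul_one] at this
      refine le_trans (measure_mono ?_) this
      rintro z' ⟨hz', hzw'⟩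
      refine ⟨hz', ?_⟩
      rw [mem_closedBall, Prod.dist_eq, max_le_iff]
      have a1 : dist z.1 w ≤ 1/2 := hzw
      have a2 : dist z'.1 w ≤ 1/2 := hzw'
      constructor
      · calc dist z'.1 z.1 ≤ dist z'.1 w + dist z.1 w := dist_triangle_right _ _ _
          _ ≤ 1 := by linarith
      · rw [Real.dist_eq, abs_le]
        have := hAI z hz; have := hAI z' hz'
        simp only [mem_Icc] at *
        constructor <;> linarith
  have hsym : ∀ (z' : Ed d × ℝ) (w : Ed d), (closedBall z'.1 (1/2)).indicator f w = f w * {q : Ed d × ℝ | q.1 ∈ closedBall w (1/2)}.indicator 1 z' := by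
    intro z' w
    simp only [indicator, mem_closedBall]
    have e : (z' ∈ {q : Ed d × ℝ | dist q.1 w ≤ 1/2}) ↔ dist w z'.1 ≤ 1/2 := by
      rw [dist_comm]; exact Iff.rfl
    by_cases h : dist w z'.1 ≤ 1/2
    · rw [if_pos h, if_pos (e.2 h)]; simp
    · rw [if_neg h, if_neg (fun h' => h (e.1 h'))]; simp
  have hmeas2 : MeasurableSet {q : (Ed d × ℝ) × Ed d | dist q.1.1 q.2 ≤ 1/2} :=
    measurableSet_le (Measurable.dist (measurable_fst.comp measurable_fst) measurable_snd) measurable_const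
  have hmw : ∀ w : Ed d, MeasurableSet {q : Ed d × ℝ | q.1 ∈ closedBall w (1/2)} := fun w =>
    measurable_fst measurableSet_closedBall
  have key : (∫⁻ z' in A, F z' ∂(lam d)) * ENNReal.ofReal c ≤ ENNReal.ofReal (4 ^ (d + 1 : ℝ) * I * v) := by
    have hFm : Measurable F := by
      simp only [hF]
      apply Measurable.indicator
      · fun_prop
      · exact measurableSet_le measurable_const (by fun_prop)
    calc (∫⁻ z' in A, F z' ∂(lam d)) * ENNReal.ofReal c = ∫⁻ z' in A, F z' * ENNReal.ofReal c ∂(lam d) := by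
          rw [lintegral_mul_const _ hFm]
      _ ≤ ∫⁻ z' in A, (∫⁻ w, (closedBall z'.1 (1/2)).indicator f w) ∂(lam d) := lintegral_mono hpt
      _ = ∫⁻ z' in A, (∫⁻ w, f w * {q : Ed d × ℝ | q.1 ∈ closedBall w (1/2)}.indicator 1 z') ∂(lam d) := by
          simp_rw [hsym]
      _ = ∫⁻ w, (∫⁻ z' in A, f w * {q : Ed d × ℝ | q.1 ∈ closedBall w (1/2)}.indicator 1 z' ∂(lam d)) := by
          rw [lintegral_lintegral_swap]
          apply Measurable.aemeasurable
          have : (Function.uncurry fun (z' : Ed d × ℝ) (w : Ed d) => f w * {q : Ed d × ℝ | q.1 ∈ closedBall w (1/2)}.indicator (1 : Ed d × ℝ → ℝ≥0∞) z') =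
              fun q : (Ed d × ℝ) × Ed d => f q.2 * {q : (Ed d × ℝ) × Ed d | dist q.1.1 q.2 ≤ 1/2}.indicator 1 q := by
            ext q; rfl
          rw [this]
          exact (hfm.comp measurable_snd).mul (measurable_one.indicator hmeas2)
      _ ≤ ∫⁻ w, f w * ENNReal.ofReal v := by
          refine lintegral_mono (fun w => ?_)
          rw [lintegral_const_mul _ (measurable_one.indicator (hmw w))]
          rw [lintegral_indicator_one (hmw w), Measure.restrict_apply (hmw w), inter_comm]
          gcongr
          exact hball w
      _ = (∫⁻ w, f w) * ENNReal.ofReal v := lintegral_mul_const _ hfm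
      _ = _ := by
          have : ∫⁻ w, f w = ENNReal.ofReal (4 ^ (d + 1 : ℝ) * I) := by
            simp only [hf']
            rw [← ofReal_integral_eq_lintegral_ofReal]
            · rw [integral_const_mul, integral_sub_left_eq_self (fun w : Ed d => (1 + ‖w‖) ^ (-(d + 1 : ℝ)))]
            · exact (hf.comp_sub_left x).const_mul _
            · filter_upwards with w; positivity
          rw [this, ← ENNReal.ofReal_mul (by positivity)]
  calc ∫⁻ z' in A, F z' ∂(lam d) = (∫⁻ z' in A, F z' ∂(lam d)) * ENNReal.ofReal c * ENNReal.ofReal c⁻¹ := by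
        rw [mul_assoc, ← ENNReal.ofReal_mul hc0.le, mul_inv_cancel₀ hc0.ne', ENNReal.ofReal_one, mul_one]
    _ ≤ ENNReal.ofReal (4 ^ (d + 1 : ℝ) * I * v) * ENNReal.ofReal c⁻¹ := by gcongr
    _ ≤ _ := by
        rw [← ENNReal.ofReal_mul (by positivity)]
        apply ENNReal.ofReal_le_ofReal
        nlinarith [hv]

lemma K2_pt (d m : ℕ) (hd : 2 ≤ d) (hm : 1 ≤ m) : ∃ C : ℝ, 0 < C ∧ ∀ ε : ℝ, 0 < ε → ε ≤ 1 → ∀ z z' : Ed d × ℝ,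
    |z.2 - z'.2| ≤ 1 → ∀ W : ℝ, 0 < W → W < dist z z' →
    ‖Kk d (2 * m) (2 * ε) (z.2 - z'.2) (z.1 - z'.1)‖ₑ ≤ ENNReal.ofReal (C * ε ^ (-((d + 1 : ℝ) / 2))) *
      ({z' | W < dist z z' ∧ dist z z' ≤ 1}.indicator (fun z' => ENNReal.ofReal (dist z z' ^ (-((d - 1 : ℝ) / 2)))) z' +
      {z' : Ed d × ℝ | 1 ≤ ‖z.1 - z'.1‖}.indicator (fun z' => ENNReal.ofReal (‖z.1 - z'.1‖ ^ (-(d + 1 : ℝ)))) z') := by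
  obtain ⟨C, hC, H⟩ := Kk_bound d (2 * m) (by omega)
  refine ⟨C * 2 ^ (2 * m), by positivity, ?_⟩
  intro ε h1 h2 z z' hz W hW hWD
  have hd' : (2:ℝ) ≤ d := by exact_mod_cast hd
  have hm' : (1:ℝ) ≤ m := by exact_mod_cast hm
  have hp := Real.pi_gt_three
  have hb := H (2 * ε) (z.2 - z'.2) (by positivity) (z.1 - z'.1)
  have hdist : dist z z' = max ‖z.1 - z'.1‖ |z.2 - z'.2| := by
    rw [Prod.dist_eq, dist_eq_norm, Real.dist_eq]
  set X := ‖z.1 - z'.1‖ with hX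
  set τ := |z.2 - z'.2| with hτ
  have hX0 : 0 ≤ X := norm_nonneg _
  have hτ0 : 0 ≤ τ := abs_nonneg _
  set D := dist z z' with hD
  have hD0 : 0 < D := hW.trans hWD
  have hDle : D ≤ 2 * Real.pi * X + τ := by
    rw [hdist]; apply max_le <;> nlinarith
  have hεβ : (1:ℝ) ≤ ε ^ (-((d + 1 : ℝ) / 2)) := Real.one_le_rpow_of_pos_of_le_one_of_nonpos h1 h2 (by linarith)
  rw [← ofReal_norm]
  by_cases hcase : D ≤ 1
  · refine le_trans ?_ (mul_le_mul_right (le_self_add) _)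
    rw [indicator_of_mem (show z' ∈ {z' | W < dist z z' ∧ dist z z' ≤ 1} from ⟨hWD, hcase⟩)]
    rw [← ENNReal.ofReal_mul (by positivity)]
    apply ENNReal.ofReal_le_ofReal
    refine hb.trans ?_
    have b1 : (2 * ε + abs (2 * Real.pi * X - τ)) ^ (-(((2 * m : ℕ):ℝ) + (d + 1 : ℝ) / 2)) ≤ ε ^ (-(((2 * m : ℕ):ℝ) + (d + 1 : ℝ) / 2)) := by
      apply Real.rpow_le_rpow_of_nonpos h1
      · have := abs_nonneg (2 * Real.pi * X - τ); linarith
      · push_cast; linarith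
    have b2 : (2 * ε + 2 * Real.pi * X + τ) ^ (1 - (d + 1 : ℝ) / 2) ≤ D ^ (-((d - 1 : ℝ) / 2)) := by
      rw [show 1 - (d + 1 : ℝ) / 2 = -((d - 1 : ℝ) / 2) by ring]
      apply Real.rpow_le_rpow_of_nonpos hD0
      · linarith
      · linarith
    calc C * (2 * ε) ^ (2 * m) * (2 * ε + abs (2 * Real.pi * X - τ)) ^ (-(((2 * m : ℕ):ℝ) + (d + 1 : ℝ) / 2)) * (2 * ε + 2 * Real.pi * X + τ) ^ (1 - (d + 1 : ℝ) / 2)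
        ≤ C * (2 * ε) ^ (2 * m) * ε ^ (-(((2 * m : ℕ):ℝ) + (d + 1 : ℝ) / 2)) * D ^ (-((d - 1 : ℝ) / 2)) := by gcongr
      _ = _ := by
        rw [neg_add, Real.rpow_add h1, Real.rpow_neg h1.le, Real.rpow_natCast, mul_pow]
        rw [← hD]
        field_simp
  · have hX1 : 1 ≤ X := by
      rw [not_le, hdist, lt_max_iff] at hcase
      rcases hcase with h | h
      · exact h.le
      · linarith
    refine le_trans ?_ (mul_le_mul_right (le_add_self) _)
    rw [indicator_of_mem (show z' ∈ {z' : Ed d × ℝ | 1 ≤ ‖z.1 - z'.1‖} from hX1)]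
    rw [← ENNReal.ofReal_mul (by positivity)]
    apply ENNReal.ofReal_le_ofReal
    refine hb.trans ?_
    have habs : X ≤ abs (2 * Real.pi * X - τ) := by
      rw [abs_of_nonneg (by nlinarith)]; nlinarith
    have b1 : (2 * ε + abs (2 * Real.pi * X - τ)) ^ (-(((2 * m : ℕ):ℝ) + (d + 1 : ℝ) / 2)) ≤ X ^ (-(((2 * m : ℕ):ℝ) + (d + 1 : ℝ) / 2)) := by
      apply Real.rpow_le_rpow_of_nonpos (by linarith)
      · linarith
      · push_cast; linarith
    have b2 : (2 * ε + 2 * Real.pi * X + τ) ^ (1 - (d + 1 : ℝ) / 2) ≤ X ^ (1 - (d + 1 : ℝ) / 2) := by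
      apply Real.rpow_le_rpow_of_nonpos (by linarith)
      · nlinarith
      · linarith
    have hXp : 0 < X := by linarith
    calc C * (2 * ε) ^ (2 * m) * (2 * ε + abs (2 * Real.pi * X - τ)) ^ (-(((2 * m : ℕ):ℝ) + (d + 1 : ℝ) / 2)) * (2 * ε + 2 * Real.pi * X + τ) ^ (1 - (d + 1 : ℝ) / 2)
        ≤ C * (2 * 1) ^ (2 * m) * X ^ (-(((2 * m : ℕ):ℝ) + (d + 1 : ℝ) / 2)) * X ^ (1 - (d + 1 : ℝ) / 2) := by gcongr
      _ = C * 2 ^ (2 * m) * 1 * X ^ (-(((2 * m : ℕ):ℝ) + (d + 1 : ℝ) / 2) + (1 - (d + 1 : ℝ) / 2)) := by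
        rw [Real.rpow_add hXp]; ring
      _ ≤ C * 2 ^ (2 * m) * ε ^ (-((d + 1 : ℝ) / 2)) * X ^ (-(d + 1 : ℝ)) := by
        gcongr
        push_cast; linarith

lemma W_identity (d : ℕ) (hd : 4 ≤ d) {ε v : ℝ} (h1 : 0 < ε) (hv : 0 < v) :
    ε ^ (-((d + 1 : ℝ) / 2)) * (v * (ε * (v * ε ^ (-(d:ℝ))) ^ (2 / (d - 1 : ℝ))) ^ (1 - (d - 1 : ℝ) / 2)) = ε * (v * ε ^ (-(d:ℝ))) ^ (2 / (d - 1 : ℝ)) := by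
  have hd' : (4:ℝ) ≤ d := by exact_mod_cast hd
  set W := ε * (v * ε ^ (-(d:ℝ))) ^ (2 / (d - 1 : ℝ)) with hW
  have hW0 : 0 < W := by positivity
  have e : v = W ^ ((d - 1 : ℝ) / 2) * ε ^ ((d + 1 : ℝ) / 2) := by
    rw [hW, Real.mul_rpow h1.le (by positivity), ← Real.rpow_mul (by positivity), div_mul_div_comm, mul_comm 2 (d - 1 : ℝ), div_self (by nlinarith),
      Real.rpow_one]
    rw [show ε ^ ((d - 1 : ℝ) / 2) * (v * ε ^ (-(d:ℝ))) * ε ^ ((d + 1 : ℝ) / 2) = v * (ε ^ ((d - 1 : ℝ) / 2) * ε ^ (-(d:ℝ)) * ε ^ ((d + 1 : ℝ) / 2)) by ring,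
      ← Real.rpow_add h1, ← Real.rpow_add h1, show (d - 1 : ℝ) / 2 + -(d:ℝ) + (d + 1 : ℝ) / 2 = 0 by ring, Real.rpow_zero, mul_one]
  calc ε ^ (-((d + 1 : ℝ) / 2)) * (v * W ^ (1 - (d - 1 : ℝ) / 2)) = (ε ^ (-((d + 1 : ℝ) / 2)) * ε ^ ((d + 1 : ℝ) / 2)) * (W ^ ((d - 1 : ℝ) / 2) * W ^ (1 - (d - 1 : ℝ) / 2)) := by
        nth_rewrite 1 [e]; ring
    _ = W := by
        rw [← Real.rpow_add h1, ← Real.rpow_add hW0]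
        rw [neg_add_cancel, Real.rpow_zero, one_mul, show (d - 1 : ℝ) / 2 + (1 - (d - 1 : ℝ) / 2) = 1 by ring, Real.rpow_one]

lemma meas_sect {X Y : Type} [MeasurableSpace X] [MeasurableSpace Y] (F : X → Y → ℝ≥0∞)
    (h : Measurable (fun q : X × Y => F q.1 q.2)) (z : X) : Measurable (F z) :=
  h.comp (measurable_prodMk_left (x := z))

lemma far_bound (d m : ℕ) (hd : 4 ≤ d) (hm : 1 ≤ m) : ∃ C : ℝ, 0 < C ∧ ∀ (ε : ℝ), 0 < ε → ε ≤ 1 →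
    ∀ (A : Set (Ed d × ℝ)) (_ : MeasurableSet A) (v : ℝ) (_ : 0 < v)
    (_ : ∀ z ∈ A, z.2 ∈ Icc (1:ℝ) 2)
    (_ : ∀ z ∈ A, ∀ ρ : ℝ, 0 < ρ → ρ ≤ 1 → lam d (A ∩ closedBall z ρ) ≤ ENNReal.ofReal (v * ρ))
    (W : ℝ) (_ : 0 < W) (c : (Ed d × ℝ) × (Ed d × ℝ) → ℂ) (_ : ∀ p, ‖c p‖ ≤ 1) (_ : ∀ p, p.1 ∉ A → c p = 0) (_ : ∀ p, p.2 ∉ A → c p = 0)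
    (_ : ∀ p, |p.1.2 - p.2.2| ≤ W → c p = 0),
    ∫⁻ z : (Ed d × ℝ) × (Ed d × ℝ), ‖c z * ((2 ^ (2 * m) : ℂ)⁻¹ * Kk d (2 * m) (2 * ε) (z.1.2 - z.2.2) (z.1.1 - z.2.1))‖ₑ ∂((lam d).prod (lam d))
    ≤ ENNReal.ofReal (C * (ε ^ (-((d + 1 : ℝ) / 2)) * (v * W ^ (1 - (d - 1 : ℝ) / 2)))) * lam d A := by
  have hd' : (4:ℝ) ≤ d := by exact_mod_cast hd
  obtain ⟨C, hC, H⟩ := K2_pt d m (by omega) hm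
  obtain ⟨C1, hC1, H1⟩ := dens1 ((d - 1 : ℝ) / 2) (by linarith)
  obtain ⟨C2, hC2, H2⟩ := dens2 d
  refine ⟨C * (C1 + C2), by positivity, ?_⟩
  intro ε h1 h2 A hA v hv hAI hdens W hW c hc hcA hcA' hcW
  by_cases hW1 : 1 ≤ W
  · have : ∀ z, c z = 0 := by
      intro z
      by_cases h : z.1 ∈ A
      · by_cases h' : z.2 ∈ A
        · apply hcW
          have := hAI _ h; have := hAI _ h'
          simp only [mem_Icc] at *
          rw [abs_le]; constructor <;> linarith
        · exact hcA' _ h'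
      · exact hcA _ h
    simp [this]
  rw [not_le] at hW1
  have two : ‖((2:ℂ) ^ (2 * m))⁻¹‖ₑ ≤ 1 := by
    rw [← ofReal_norm, ← ENNReal.ofReal_one]
    apply ENNReal.ofReal_le_ofReal
    rw [norm_inv, norm_pow, Complex.norm_ofNat]
    exact inv_le_one_of_one_le₀ (one_le_pow₀ (by norm_num))
  set I1 : Ed d × ℝ → Ed d × ℝ → ℝ≥0∞ := fun z => {z' | W < dist z z' ∧ dist z z' ≤ 1}.indicator (fun z' => ENNReal.ofReal (dist z z' ^ (-((d - 1 : ℝ) / 2)))) with hI1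
  set I2 : Ed d × ℝ → Ed d × ℝ → ℝ≥0∞ := fun z => {z' : Ed d × ℝ | 1 ≤ ‖z.1 - z'.1‖}.indicator (fun z' => ENNReal.ofReal (‖z.1 - z'.1‖ ^ (-(d + 1 : ℝ)))) with hI2
  have m1 : Measurable (fun q : (Ed d × ℝ) × (Ed d × ℝ) => I1 q.1 q.2) := by
    have : (fun q : (Ed d × ℝ) × (Ed d × ℝ) => I1 q.1 q.2) = {q : (Ed d × ℝ) × (Ed d × ℝ) | W < dist q.1 q.2 ∧ dist q.1 q.2 ≤ 1}.indicator (fun q => ENNReal.ofReal (dist q.1 q.2 ^ (-((d - 1 : ℝ) / 2)))) := by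
      ext q; rfl
    rw [this]
    have hdm : Measurable (fun q : (Ed d × ℝ) × (Ed d × ℝ) => dist q.1 q.2) := continuous_dist.measurable
    apply Measurable.indicator
    · exact (hdm.pow_const _).ennreal_ofReal
    · exact (measurableSet_lt measurable_const hdm).inter (measurableSet_le hdm measurable_const)
  have m2 : Measurable (fun q : (Ed d × ℝ) × (Ed d × ℝ) => I2 q.1 q.2) := by
    have : (fun q : (Ed d × ℝ) × (Ed d × ℝ) => I2 q.1 q.2) = {q : (Ed d × ℝ) × (Ed d × ℝ) | 1 ≤ ‖q.1.1 - q.2.1‖}.indicator (fun q => ENNReal.ofReal (‖q.1.1 - q.2.1‖ ^ (-(d + 1 : ℝ)))) := by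
      ext q; rfl
    rw [this]
    have hdm : Measurable (fun q : (Ed d × ℝ) × (Ed d × ℝ) => ‖q.1.1 - q.2.1‖) :=
      (Continuous.norm ((continuous_fst.comp continuous_fst).sub (continuous_fst.comp continuous_snd))).measurable
    apply Measurable.indicator
    · exact (hdm.pow_const _).ennreal_ofReal
    · exact measurableSet_le measurable_const hdm
  set K0 := ENNReal.ofReal (C * ε ^ (-((d + 1 : ℝ) / 2))) with hK0
  have mtot : Measurable (fun q : (Ed d × ℝ) × (Ed d × ℝ) => K0 * (I1 q.1 q.2 + I2 q.1 q.2)) := (m1.add m2).const_mul _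
  have hpt : ∀ z : (Ed d × ℝ) × (Ed d × ℝ), ‖c z * ((2 ^ (2 * m) : ℂ)⁻¹ * Kk d (2 * m) (2 * ε) (z.1.2 - z.2.2) (z.1.1 - z.2.1))‖ₑ ≤
      (A ×ˢ A).indicator (fun q => K0 * (I1 q.1 q.2 + I2 q.1 q.2)) z := by
    intro z
    by_cases h : z ∈ A ×ˢ A
    · rw [indicator_of_mem h]
      by_cases hw : |z.1.2 - z.2.2| ≤ W
      · rw [hcW z hw]; simp
      have ht : |z.1.2 - z.2.2| ≤ 1 := by
        have := hAI _ h.1; have := hAI _ h.2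
        simp only [mem_Icc] at *
        rw [abs_le]; constructor <;> linarith
      have hb := H ε h1 h2 z.1 z.2 ht W hW (lt_of_lt_of_le (not_le.1 hw) (by
        rw [Prod.dist_eq, ← Real.dist_eq]; exact le_max_right _ _))
      rw [enorm_mul, enorm_mul]
      have hc1 : ‖c z‖ₑ ≤ 1 := by
        rw [← ofReal_norm, ← ENNReal.ofReal_one]
        exact ENNReal.ofReal_le_ofReal (hc z)
      calc _ ≤ 1 * (1 * ‖Kk d (2 * m) (2 * ε) (z.1.2 - z.2.2) (z.1.1 - z.2.1)‖ₑ) := by gcongr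
        _ ≤ _ := by rw [one_mul, one_mul]; exact hb
    · have : c z = 0 := by
        by_cases h' : z.1 ∈ A
        · apply hcA'
          intro h''; exact h ⟨h', h''⟩
        · exact hcA _ h'
      rw [this]; simp
  have hstep : ∀ z ∈ A, ∫⁻ z' in A, K0 * (I1 z z' + I2 z z') ∂(lam d) ≤ ENNReal.ofReal (C * (C1 + C2) * (ε ^ (-((d + 1 : ℝ) / 2)) * (v * W ^ (1 - (d - 1 : ℝ) / 2)))) := by
    intro z hz
    have mz1 : Measurable (I1 z) := meas_sect I1 m1 z
    have mz2 : Measurable (I2 z) := meas_sect I2 m2 z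
    have j1 : ∫⁻ z' in A, I1 z z' ∂(lam d) ≤ ENNReal.ofReal (C1 * v * W ^ (1 - (d - 1 : ℝ) / 2)) := H1 (lam d) A v hv z (hdens z hz) W hW
    have j2 : ∫⁻ z' in A, I2 z z' ∂(lam d) ≤ ENNReal.ofReal (C2 * v) := H2 A hA v hv hAI hdens z.1
    have q1 : ∫⁻ z' in A, K0 * (I1 z z' + I2 z z') ∂(lam d) = K0 * ∫⁻ z' in A, (I1 z z' + I2 z z') ∂(lam d) :=
      lintegral_const_mul K0 (mz1.add mz2)
    have q2 : ∫⁻ z' in A, (I1 z z' + I2 z z') ∂(lam d) = ∫⁻ z' in A, I1 z z' ∂(lam d) + ∫⁻ z' in A, I2 z z' ∂(lam d) :=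
      lintegral_add_left mz1 _
    rw [q1, q2]
    have hW2 : 1 ≤ W ^ (1 - (d - 1 : ℝ) / 2) := Real.one_le_rpow_of_pos_of_le_one_of_nonpos hW hW1.le (by linarith)
    have q3 : K0 * (∫⁻ z' in A, I1 z z' ∂(lam d) + ∫⁻ z' in A, I2 z z' ∂(lam d)) ≤ K0 * (ENNReal.ofReal (C1 * v * W ^ (1 - (d - 1 : ℝ) / 2)) + ENNReal.ofReal (C2 * v)) := by gcongr
    refine q3.trans ?_
    clear q3 q2 q1 j1 j2 mz1 mz2 hpt mtot m1 m2
    rw [hK0, ← ENNReal.ofReal_add (by positivity) (by positivity), ← ENNReal.ofReal_mul (by positivity)]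
    apply ENNReal.ofReal_le_ofReal
    have : C2 * v ≤ C2 * v * W ^ (1 - (d - 1 : ℝ) / 2) := le_mul_of_one_le_right (by positivity) hW2
    calc C * ε ^ (-((d + 1 : ℝ) / 2)) * (C1 * v * W ^ (1 - (d - 1 : ℝ) / 2) + C2 * v) ≤ C * ε ^ (-((d + 1 : ℝ) / 2)) * (C1 * v * W ^ (1 - (d - 1 : ℝ) / 2) + C2 * v * W ^ (1 - (d - 1 : ℝ) / 2)) := by
          gcongr
      _ = _ := by ring
  calc _ ≤ ∫⁻ z : (Ed d × ℝ) × (Ed d × ℝ), (A ×ˢ A).indicator (fun q => K0 * (I1 q.1 q.2 + I2 q.1 q.2)) z ∂((lam d).prod (lam d)) := lintegral_mono hpt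
    _ = ∫⁻ q in A ×ˢ A, K0 * (I1 q.1 q.2 + I2 q.1 q.2) ∂((lam d).prod (lam d)) := lintegral_indicator (hA.prod hA) _
    _ = ∫⁻ z in A, ∫⁻ z' in A, K0 * (I1 z z' + I2 z z') ∂(lam d) ∂(lam d) := by
        rw [← Measure.prod_restrict, lintegral_prod _ mtot.aemeasurable]
    _ ≤ ∫⁻ z in A, ENNReal.ofReal (C * (C1 + C2) * (ε ^ (-((d + 1 : ℝ) / 2)) * (v * W ^ (1 - (d - 1 : ℝ) / 2)))) ∂(lam d) := by
        exact setLIntegral_mono measurable_const hstep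
    _ = _ := setLIntegral_const _ _

/-- The density hypothesis -/
def Dens (d : ℕ) (A : Set (Ed d × ℝ)) (v : ℝ) : Prop :=
  ∀ z ∈ A, ∀ ρ : ℝ, 0 < ρ → ρ ≤ 1 → lam d (A ∩ closedBall z ρ) ≤ ENNReal.ofReal (v * ρ)

lemma Kg_integrable (d m : ℕ) (hd : 1 ≤ d) {ε : ℝ} (h1 : 0 < ε) (g : Ed d × ℝ → ℂ) (hgi : Integrable g (lam d)) (y : Ed d) :
    Integrable (fun z : Ed d × ℝ => Kk d m ε z.2 (z.1 - y) * g z) (lam d) := by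
  obtain ⟨B, hB, HB⟩ := Kk_sup d m hd h1
  have hmeasK : Measurable (fun p : ℝ × Ed d => Kk d m ε p.1 p.2) := (continuous_Kk_joint d m h1).measurable
  refine hgi.bdd_mul (c := B) ?_ ?_
  · exact (hmeasK.comp (measurable_snd.prodMk (measurable_fst.sub measurable_const))).aestronglyMeasurable
  · filter_upwards with z using HB _ _

lemma bdd_set_integrable {d : ℕ} {A : Set (Ed d × ℝ)} (hA : MeasurableSet A) (hfin : lam d A ≠ ⊤) {g : Ed d × ℝ → ℂ}
    (hg : Measurable g) (hg1 : ∀ z, ‖g z‖ ≤ 1) (hgA : ∀ z, z ∉ A → g z = 0) : Integrable g (lam d) := by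
  have : Integrable (A.indicator (fun _ => (1:ℝ))) (lam d) := by
    rw [integrable_indicator_iff hA]
    exact integrableOn_const hfin
  refine this.mono' hg.aestronglyMeasurable ?_
  filter_upwards with z
  by_cases h : z ∈ A
  · rw [indicator_of_mem h]; exact hg1 z
  · rw [hgA z h]; simp [h]

lemma S_L2_density (d m : ℕ) (hd : 4 ≤ d) (hm : 1 ≤ m) : ∃ C : ℝ, 0 < C ∧ ∀ (ε : ℝ), 0 < ε → ε ≤ 1 →
    ∀ (A : Set (Ed d × ℝ)) (_ : MeasurableSet A) (_ : lam d A ≠ ⊤) (v : ℝ) (_ : 0 < v)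
    (_ : ∀ z ∈ A, z.2 ∈ Icc (1:ℝ) 2) (_ : Dens d A v)
    (g : Ed d × ℝ → ℂ) (_ : Measurable g) (_ : ∀ z, ‖g z‖ ≤ 1) (_ : ∀ z, z ∉ A → g z = 0),
    ∫⁻ y, ‖Sg d m ε g y‖ₑ ^ 2 ≤ ENNReal.ofReal (C * (ε * (v * ε ^ (-(d:ℝ))) ^ (2 / (d - 1 : ℝ)))) * lam d A := by
  obtain ⟨C1, hC1, H1⟩ := near_bound d m (by omega) hm
  obtain ⟨C2, hC2, H2⟩ := far_bound d m hd hm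
  refine ⟨C1 + C2, by positivity, ?_⟩
  intro ε h1 h2 A hA hfin v hv hAI hdens g hg hg1 hgA
  set W := ε * (v * ε ^ (-(d:ℝ))) ^ (2 / (d - 1 : ℝ)) with hW
  have hW0 : 0 < W := by positivity
  have hgi := bdd_set_integrable hA hfin hg hg1 hgA
  have hNm : MeasurableSet {p : ℝ × ℝ | |p.1 - p.2| ≤ W} :=
    measurableSet_le ((measurable_fst.sub measurable_snd).abs) measurable_const
  have near := H1 ε h1 h2 g hg hgi W hW0
  set N : Set (ℝ × ℝ) := {p : ℝ × ℝ | |p.1 - p.2| ≤ W} with hN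
  have hcg : Integrable (fun z : (Ed d × ℝ) × (Ed d × ℝ) => g z.1 * starRingEnd ℂ (g z.2)) ((lam d).prod (lam d)) :=
    hgi.mul_prod (Complex.conjCLE.toContinuousLinearMap.integrable_comp hgi)
  have hind : ∀ (M : Set (ℝ × ℝ)), MeasurableSet M → AEStronglyMeasurable (fun z : (Ed d × ℝ) × (Ed d × ℝ) => M.indicator (fun _ => (1:ℂ)) (z.1.2, z.2.2)) ((lam d).prod (lam d)) := by
    intro M hM
    exact ((measurable_const.indicator hM).comp ((measurable_snd.comp measurable_fst).prodMk (measurable_snd.comp measurable_snd))).aestronglyMeasurable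
  have hindb : ∀ (M : Set (ℝ × ℝ)) p, ‖M.indicator (fun _ => (1:ℂ)) p‖ ≤ 1 := by
    intro M p; rw [indicator]; split_ifs <;> simp
  have hcM : ∀ (M : Set (ℝ × ℝ)), MeasurableSet M → Integrable (fun z : (Ed d × ℝ) × (Ed d × ℝ) => M.indicator (fun _ => (1:ℂ)) (z.1.2, z.2.2) * (g z.1 * starRingEnd ℂ (g z.2))) ((lam d).prod (lam d)) := by
    intro M hM
    refine hcg.bdd_mul (c := 1) (hind M hM) ?_
    filter_upwards with z using hindb _ _
  have hIcc : ∀ᵐ z ∂(lam d), z.2 ∈ Icc (1:ℝ) 2 := by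
    have : ∀ᵐ t ∂Tm, t ∈ Icc (1:ℝ) 2 := ae_restrict_mem measurableSet_Icc
    exact Measure.quasiMeasurePreserving_snd.ae this
  have hIcc1 : ∀ᵐ z ∂((lam d).prod (lam d)), z.1.2 ∈ Icc (1:ℝ) 2 := Measure.quasiMeasurePreserving_fst.ae hIcc
  have hIcc2 : ∀ᵐ z ∂((lam d).prod (lam d)), z.2.2 ∈ Icc (1:ℝ) 2 := Measure.quasiMeasurePreserving_snd.ae hIcc
  have pf := fun (M : Set (ℝ × ℝ)) (hM : MeasurableSet M) =>
    pair_fubini d m (by omega) hm h1 h2 ((lam d).prod (lam d)) (fun z => z.1.1) (fun z => z.2.1)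
    (fun z => z.1.2) (fun z => z.2.2) (measurable_fst.comp measurable_fst) (measurable_fst.comp measurable_snd)
    (measurable_snd.comp measurable_fst) (measurable_snd.comp measurable_snd) hIcc1 hIcc2 _ (hcM M hM)
  obtain ⟨pN, _⟩ := pf N hNm
  obtain ⟨pF, eF⟩ := pf Nᶜ hNm.compl
  have hre : ∀ (M : Set (ℝ × ℝ)) (y : Ed d) (z : (Ed d × ℝ) × (Ed d × ℝ)), M.indicator (fun _ => (1:ℂ)) (z.1.2, z.2.2) *
      ((Kk d m ε z.1.2 (z.1.1 - y) * g z.1) * starRingEnd ℂ (Kk d m ε z.2.2 (z.2.1 - y) * g z.2)) =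
      M.indicator (fun _ => (1:ℂ)) (z.1.2, z.2.2) * (g z.1 * starRingEnd ℂ (g z.2)) * (Kk d m ε z.1.2 (z.1.1 - y) * starRingEnd ℂ (Kk d m ε z.2.2 (z.2.1 - y))) := by
    intro M y z; rw [map_mul]; ring
  simp_rw [hre] at near
  set nearF : Ed d → ℂ := fun y => ∫ z : (Ed d × ℝ) × (Ed d × ℝ), N.indicator (fun _ => (1:ℂ)) (z.1.2, z.2.2) * (g z.1 * starRingEnd ℂ (g z.2)) * (Kk d m ε z.1.2 (z.1.1 - y) * starRingEnd ℂ (Kk d m ε z.2.2 (z.2.1 - y))) ∂((lam d).prod (lam d)) with hnear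
  set farF : Ed d → ℂ := fun y => ∫ z : (Ed d × ℝ) × (Ed d × ℝ), Nᶜ.indicator (fun _ => (1:ℂ)) (z.1.2, z.2.2) * (g z.1 * starRingEnd ℂ (g z.2)) * (Kk d m ε z.1.2 (z.1.1 - y) * starRingEnd ℂ (Kk d m ε z.2.2 (z.2.1 - y))) ∂((lam d).prod (lam d)) with hfar
  have hsplit : ∀ y, ((‖Sg d m ε g y‖ ^ 2 : ℝ) : ℂ) = nearF y + farF y := by
    intro y
    have hK := Kg_integrable d m (by omega) h1 g hgi y
    have hKK : Integrable (fun z : (Ed d × ℝ) × (Ed d × ℝ) => (Kk d m ε z.1.2 (z.1.1 - y) * g z.1) * starRingEnd ℂ (Kk d m ε z.2.2 (z.2.1 - y) * g z.2)) ((lam d).prod (lam d)) :=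
      hK.mul_prod (Complex.conjCLE.toContinuousLinearMap.integrable_comp hK)
    have hKM : ∀ (M : Set (ℝ × ℝ)), MeasurableSet M → Integrable (fun z : (Ed d × ℝ) × (Ed d × ℝ) => M.indicator (fun _ => (1:ℂ)) (z.1.2, z.2.2) * ((Kk d m ε z.1.2 (z.1.1 - y) * g z.1) * starRingEnd ℂ (Kk d m ε z.2.2 (z.2.1 - y) * g z.2))) ((lam d).prod (lam d)) := by
      intro M hM
      refine hKK.bdd_mul (c := 1) (hind M hM) ?_
      filter_upwards with z using hindb _ _
    simp only [hnear, hfar]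
    simp_rw [← hre]
    rw [← integral_add (hKM N hNm) (hKM Nᶜ hNm.compl)]
    have := integral_prod_mul (μ := lam d) (ν := lam d) (fun z => Kk d m ε z.2 (z.1 - y) * g z)
      (fun z => starRingEnd ℂ (Kk d m ε z.2 (z.1 - y) * g z))
    rw [integral_conj] at this
    push_cast
    rw [← Complex.mul_conj', Sg, ← this]
    congr 1; ext z
    rw [← add_mul]
    have : N.indicator (fun _ => (1:ℂ)) (z.1.2, z.2.2) + Nᶜ.indicator (fun _ => (1:ℂ)) (z.1.2, z.2.2) = 1 := by
      by_cases h : (z.1.2, z.2.2) ∈ N <;> simp [h]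
    rw [this, one_mul]
  have hi' : Integrable (fun y => ‖Sg d m ε g y‖ ^ 2) := by
    have := (pN.add pF).re
    refine this.congr ?_
    filter_upwards with y
    have h := hsplit y
    simp only [Pi.add_apply]
    change RCLike.re (nearF y + farF y) = _
    rw [← h]; rfl
  have e1 : ∫⁻ y, ‖Sg d m ε g y‖ₑ ^ 2 = ENNReal.ofReal (∫ y, ‖Sg d m ε g y‖ ^ 2) := by
    rw [ofReal_integral_eq_lintegral_ofReal hi' (by filter_upwards with y; positivity)]
    congr 1; ext y
    rw [ENNReal.ofReal_pow (norm_nonneg _), ofReal_norm]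
  have e2 : ENNReal.ofReal (∫ y, ‖Sg d m ε g y‖ ^ 2) = ‖∫ y, ((‖Sg d m ε g y‖ ^ 2 : ℝ) : ℂ)‖ₑ := by
    rw [integral_complex_ofReal, ← ofReal_norm, Complex.norm_real, Real.norm_of_nonneg]
    exact integral_nonneg (fun y => by positivity)
  rw [e1, e2]
  simp_rw [hsplit]
  rw [integral_add pN pF]
  have b1 : ‖∫ y, nearF y‖ₑ ≤ ENNReal.ofReal (C1 * W) * lam d A := by
    refine (enorm_integral_le_lintegral_enorm _).trans (near.trans ?_)
    gcongr
    calc ∫⁻ z, ‖g z‖ₑ ^ 2 ∂(lam d) ≤ ∫⁻ z, A.indicator 1 z ∂(lam d) := by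
          refine lintegral_mono (fun z => ?_)
          by_cases h : z ∈ A
          · simp only [indicator_of_mem h, Pi.one_apply]
            apply pow_le_one₀ (by positivity)
            rw [← ofReal_norm, ← ENNReal.ofReal_one]
            exact ENNReal.ofReal_le_ofReal (hg1 z)
          · simp [hgA z h]
      _ = _ := lintegral_indicator_one hA
  have b2 : ‖∫ y, farF y‖ₑ ≤ ENNReal.ofReal (C2 * W) * lam d A := by
    rw [show ∫ y, farF y = _ from eF]
    refine (enorm_integral_le_lintegral_enorm _).trans ?_
    have := H2 ε h1 h2 A hA v hv hAI hdens W hW0 (fun z => Nᶜ.indicator (fun _ => (1:ℂ)) (z.1.2, z.2.2) * (g z.1 * starRingEnd ℂ (g z.2)))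
      (fun p => by
        rw [norm_mul, norm_mul, RCLike.norm_conj]
        have := hindb Nᶜ (p.1.2, p.2.2)
        calc _ ≤ (1:ℝ) * (1 * 1) := by gcongr <;> first | exact hg1 _ | assumption
          _ = 1 := by norm_num)
      (fun p hp => by rw [hgA _ hp]; simp) (fun p hp => by rw [hgA _ hp]; simp)
      (fun p hp => by
        have : (p.1.2, p.2.2) ∉ Nᶜ := fun h => h hp
        rw [indicator_of_notMem this, zero_mul])
    rw [W_identity d hd h1 hv] at this
    exact this
  calc ‖(∫ y, nearF y) + ∫ y, farF y‖ₑ ≤ ‖∫ y, nearF y‖ₑ + ‖∫ y, farF y‖ₑ := enorm_add_le _ _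
    _ ≤ ENNReal.ofReal (C1 * W) * lam d A + ENNReal.ofReal (C2 * W) * lam d A := add_le_add b1 b2
    _ = _ := by
      rw [← add_mul, ← ENNReal.ofReal_add (by positivity) (by positivity)]; congr 2; ring

lemma lam_ball (d : ℕ) : ∃ C : ℝ, 0 < C ∧ ∀ (z : Ed d × ℝ) (ρ : ℝ), 0 < ρ → lam d (closedBall z ρ) ≤ ENNReal.ofReal (C * ρ ^ (d + 1)) := by
  set c := (volume : Measure (Ed d)).real (ball 0 1) with hc
  refine ⟨2 * c + 1, by positivity, ?_⟩
  intro z ρ hρ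
  have h1 : lam d (closedBall z ρ) = volume (closedBall z.1 ρ) * Tm (closedBall z.2 ρ) := by
    rw [← Measure.prod_prod, closedBall_prod_same]
  have h2 : volume (closedBall z.1 ρ) = ENNReal.ofReal (ρ ^ d * c) := by
    rw [Measure.addHaar_closedBall _ _ hρ.le, finrank_euclideanSpace_fin, ENNReal.ofReal_mul (by positivity), hc,
      ofReal_measureReal measure_ball_lt_top.ne]
  have h3 : Tm (closedBall z.2 ρ) ≤ ENNReal.ofReal (2 * ρ) := by
    refine (Measure.restrict_le_self _).trans ?_
    rw [Real.volume_closedBall]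
  rw [h1, h2]
  calc _ ≤ ENNReal.ofReal (ρ ^ d * c) * ENNReal.ofReal (2 * ρ) := by gcongr
    _ ≤ _ := by
      rw [← ENNReal.ofReal_mul (by positivity)]
      apply ENNReal.ofReal_le_ofReal
      rw [pow_succ]
      nlinarith [pow_pos hρ d, mul_pos (pow_pos hρ d) hρ]

/-- indices of bad balls -/
def badI (d : ℕ) (E : Set (Ed d × ℝ)) (v : ℝ) : Set ((Ed d × ℝ) × ℝ) :=
  {i | i.1 ∈ E ∧ 0 < i.2 ∧ i.2 ≤ 2 ∧ ENNReal.ofReal (v * i.2) < lam d (E ∩ ball i.1 i.2)}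

def badU (d : ℕ) (E : Set (Ed d × ℝ)) (v : ℝ) : Set (Ed d × ℝ) := ⋃ i ∈ badI d E v, ball i.1 i.2

lemma isOpen_badU (d : ℕ) (E : Set (Ed d × ℝ)) (v : ℝ) : IsOpen (badU d E v) :=
  isOpen_biUnion (fun _ _ => isOpen_ball)

lemma dens_rem (d : ℕ) (E : Set (Ed d × ℝ)) (v : ℝ) : Dens d (E \ badU d E v) (2 * v) := by
  intro z hz ρ h0 h1
  by_contra hcon
  rw [not_le] at hcon
  apply hz.2
  refine mem_biUnion (x := (z, 2 * ρ)) ⟨hz.1, by positivity, by linarith, ?_⟩ (mem_ball_self (by positivity))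
  refine lt_of_lt_of_le (by rwa [show v * (2 * ρ) = 2 * v * ρ by ring]) (measure_mono ?_)
  exact inter_subset_inter sdiff_subset (closedBall_subset_ball (by linarith))

/-- covering of a set by balls with controlled total radius -/
def Cover (d : ℕ) (A : Set (Ed d × ℝ)) (v : ℝ) (C0 : ℝ) : Prop :=
  ∃ u : Set ((Ed d × ℝ) × ℝ), u.Countable ∧ (∀ i ∈ u, 0 < i.2 ∧ i.2 ≤ 2 ∧ v ≤ C0 * i.2 ^ d ∧ i.1.2 ∈ Icc (1:ℝ) 2) ∧
    A ⊆ (⋃ i ∈ u, closedBall i.1 (5 * i.2)) ∧ ∑' i : u, ENNReal.ofReal (v * i.1.2) ≤ lam d A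

lemma cover_bad (d : ℕ) (E : Set (Ed d × ℝ)) (hE : MeasurableSet E) (hEI : ∀ z ∈ E, z.2 ∈ Icc (1:ℝ) 2) (v : ℝ) (C0 : ℝ) (hC0 : 0 < C0)
    (H0 : ∀ (z : Ed d × ℝ) (ρ : ℝ), 0 < ρ → lam d (closedBall z ρ) ≤ ENNReal.ofReal (C0 * ρ ^ (d + 1))) :
    Cover d (E ∩ badU d E v) v C0 := by
  obtain ⟨u, hut, hdis, hcov⟩ := Vitali.exists_disjoint_subfamily_covering_enlargement_closedBall (badI d E v)
    (fun i => i.1) (fun i => i.2) 2 (fun i hi => hi.2.2.1) 5 (by norm_num)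
  have hdis' : u.PairwiseDisjoint (fun i => ball i.1 i.2) :=
    hdis.mono_on (fun i _ => ball_subset_closedBall)
  have hcount : u.Countable := by
    apply hdis'.countable_of_isOpen (fun i _ => isOpen_ball)
    intro i hi
    exact ⟨i.1, mem_ball_self (hut hi).2.1⟩
  refine ⟨u, hcount, ?_, ?_, ?_⟩
  · intro i hi
    obtain ⟨b1, b2, b3, b4⟩ := hut hi
    refine ⟨b2, b3, ?_, hEI _ b1⟩
    have : ENNReal.ofReal (v * i.2) < ENNReal.ofReal (C0 * i.2 ^ (d + 1)) :=
      b4.trans_le ((measure_mono (inter_subset_right.trans ball_subset_closedBall)).trans (H0 i.1 i.2 b2))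
    rw [ENNReal.ofReal_lt_ofReal_iff (by positivity), pow_succ, ← mul_assoc] at this
    exact (lt_of_mul_lt_mul_right this b2.le).le
  · rintro z ⟨hzE, hz⟩
    rw [badU, mem_iUnion₂] at hz
    obtain ⟨i, hi, hzi⟩ := hz
    obtain ⟨b, hb, hsub⟩ := hcov i hi
    exact mem_biUnion hb (hsub (ball_subset_closedBall hzi))
  · have := hcount.to_subtype
    calc ∑' i : u, ENNReal.ofReal (v * i.1.2) ≤ ∑' i : u, lam d (E ∩ ball i.1.1 i.1.2) := by
          apply ENNReal.tsum_le_tsum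
          intro i
          exact (hut i.2).2.2.2.le
      _ = lam d (⋃ i ∈ u, E ∩ ball i.1 i.2) := by
          rw [measure_biUnion hcount]
          · exact hdis'.mono_on (fun i _ => inter_subset_right)
          · intro i _; exact hE.inter measurableSet_ball
      _ ≤ _ := by
          apply measure_mono
          apply iUnion₂_subset
          intro i hi
          refine inter_subset_inter_right _ ?_
          exact subset_biUnion_of_mem (u := fun i : (Ed d × ℝ) × ℝ => ball i.1 i.2) (hut hi)

lemma Dens.mono {d : ℕ} {A B : Set (Ed d × ℝ)} {v : ℝ} (h : Dens d B v) (hAB : A ⊆ B) : Dens d A v :=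
  fun z hz ρ h0 h1 => (measure_mono (inter_subset_inter_left _ hAB)).trans (h z (hAB hz) ρ h0 h1)

def Es (d : ℕ) (E : Set (Ed d × ℝ)) (v : ℕ → ℝ) : ℕ → Set (Ed d × ℝ)
  | 0 => E
  | n + 1 => Es d E v n \ badU d (Es d E v n) (v n)

lemma density_decomp (d : ℕ) (hd : 1 ≤ d) : ∃ V C0 : ℝ, 0 < V ∧ 0 < C0 ∧ ∀ (E : Set (Ed d × ℝ)) (_ : MeasurableSet E)
    (_ : ∀ z ∈ E, z.2 ∈ Icc (1:ℝ) 2), ∃ A : ℕ → Set (Ed d × ℝ), (∀ n, MeasurableSet (A n)) ∧ (∀ n, A n ⊆ E) ∧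
      Pairwise (fun i j => Disjoint (A i) (A j)) ∧ lam d (E \ ⋃ n, A n) = 0 ∧
      (∀ n, Dens d (A n) (2 ^ (d + 1) * (V * ((2:ℝ) ^ (-(n:ℝ))) ^ d))) ∧ (∀ n, Cover d (A n) (V * ((2:ℝ) ^ (-(n:ℝ))) ^ d) C0) := by
  obtain ⟨C0, hC0, H0⟩ := lam_ball d
  refine ⟨C0 * 2 ^ d, C0, by positivity, hC0, ?_⟩
  intro E hE hEI
  set v : ℕ → ℝ := fun n => C0 * 2 ^ d * ((2:ℝ) ^ (-(n:ℝ))) ^ d with hv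
  have hv0 : ∀ n, 0 < v n := fun n => by simp only [hv]; positivity
  have hv1 : ∀ n, v n = 2 ^ d * v (n + 1) := by
    intro n
    simp only [hv]
    rw [show ((n + 1 : ℕ) : ℝ) = (n:ℝ) + 1 by push_cast; ring, neg_add, Real.rpow_add (by norm_num), mul_pow, Real.rpow_neg_one, inv_pow]
    field_simp
  set F := Es d E v with hF
  have hFs : ∀ n, F (n + 1) = F n \ badU d (F n) (v n) := fun n => rfl
  have hFm : ∀ n, MeasurableSet (F n) := by
    intro n
    induction n with
    | zero => exact hE
    | succ n ih => rw [hFs]; exact ih.diff (isOpen_badU _ _ _).measurableSet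
  have hanti : Antitone F := antitone_nat_of_succ_le (fun n => by rw [hFs]; exact sdiff_subset)
  have hFE : ∀ n, F n ⊆ E := fun n => hanti (Nat.zero_le n)
  have hbad0 : badI d (F 0) (v 0) = ∅ := by
    rw [eq_empty_iff_forall_notMem]
    rintro i ⟨_, b2, b3, b4⟩
    apply absurd b4
    rw [not_lt]
    refine (measure_mono (inter_subset_right.trans ball_subset_closedBall)).trans ((H0 i.1 i.2 b2).trans ?_)
    apply ENNReal.ofReal_le_ofReal
    simp only [hv]
    have : i.2 ^ d ≤ 2 ^ d := by gcongr
    simp only [Nat.cast_zero, neg_zero, Real.rpow_zero, one_pow, mul_one]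
    rw [pow_succ, ← mul_assoc]
    gcongr
  refine ⟨fun n => F n ∩ badU d (F n) (v n), fun n => (hFm n).inter (isOpen_badU _ _ _).measurableSet,
    fun n => inter_subset_left.trans (hFE n), ?_, ?_, ?_, ?_⟩
  · have hlt : ∀ i j, i < j → Disjoint (F i ∩ badU d (F i) (v i)) (F j ∩ badU d (F j) (v j)) := by
      intro i j hij
      rw [Set.disjoint_left]
      rintro z ⟨_, hz⟩ ⟨hz', _⟩
      have : z ∈ F (i + 1) := hanti hij hz'
      rw [hFs] at this
      exact this.2 hz
    intro i j hij
    rcases lt_or_gt_of_ne hij with h | h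
    · exact hlt i j h
    · exact (hlt j i h).symm
  · set R := E \ ⋃ n, F n ∩ badU d (F n) (v n) with hR
    have hRF : ∀ n, R ⊆ F n := by
      intro n
      induction n with
      | zero => exact sdiff_subset
      | succ n ih =>
        intro z hz
        rw [hFs]
        refine ⟨ih hz, fun h => hz.2 (mem_iUnion.2 ⟨n, ih hz, h⟩)⟩
    apply measure_null_of_locally_null
    intro z hz
    refine ⟨R ∩ closedBall z 1, Filter.inter_mem self_mem_nhdsWithin (mem_nhdsWithin_of_mem_nhds (closedBall_mem_nhds z one_pos)), ?_⟩
    have hle : ∀ n, lam d (R ∩ closedBall z 1) ≤ ENNReal.ofReal (2 * v n * 1) := by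
      intro n
      have h1 : Dens d (F (n + 1)) (2 * v n) := by rw [hFs]; exact dens_rem d _ _
      exact (h1.mono (hRF (n + 1))) z hz 1 one_pos le_rfl
    have hlim : Filter.Tendsto (fun n => ENNReal.ofReal (2 * v n * 1)) Filter.atTop (nhds 0) := by
      rw [← ENNReal.ofReal_zero]
      apply ENNReal.tendsto_ofReal
      have hle : ∀ n, v n ≤ v 0 * (1/2) ^ n := by
        intro n
        induction n with
        | zero => simp
        | succ n ih =>
          have h1 := hv1 n
          have h2 : (2:ℝ) ≤ 2 ^ d := by
            calc (2:ℝ) = 2 ^ 1 := by norm_num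
              _ ≤ 2 ^ d := pow_le_pow_right₀ (by norm_num) hd
          have h3 := hv0 (n + 1)
          rw [pow_succ]
          nlinarith
      have hg : Filter.Tendsto (fun n => 2 * (v 0 * (1/2) ^ n) * 1) Filter.atTop (nhds 0) := by
        have := (tendsto_pow_atTop_nhds_zero_of_lt_one (r := (1/2:ℝ)) (by norm_num) (by norm_num)).const_mul (2 * v 0)
        rw [mul_zero] at this
        refine this.congr (fun n => by ring)
      refine squeeze_zero (fun n => ?_) (fun n => ?_) hg
      · have := hv0 n; positivity
      · have := hle n; linarith
    exact le_antisymm (ge_of_tendsto' hlim hle) bot_le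
  · intro n
    rcases n with _ | n
    · intro z hz
      exfalso
      have h := hz.2
      rw [badU, hbad0] at h
      simp at h
    · have h1 : Dens d (F (n + 1)) (2 * v n) := by rw [hFs]; exact dens_rem d _ _
      have h2 := h1.mono (A := F (n+1) ∩ badU d (F (n+1)) (v (n+1))) inter_subset_left
      rw [hv1 n] at h2
      convert h2 using 1
      simp only [hv]; ring
  · intro n
    exact cover_bad d (F n) (hFm n) (fun z hz => hEI z (hFE n hz)) (v n) C0 hC0 H0

lemma interp12 {X : Type*} [MeasurableSpace X] {μ : Measure X} {F : X → ℝ≥0∞} (hF : AEMeasurable F μ) {p : ℝ} (h1 : 1 ≤ p) (h2 : p ≤ 2) :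
    ∫⁻ x, F x ^ p ∂μ ≤ (∫⁻ x, F x ∂μ) ^ (2 - p) * (∫⁻ x, F x ^ 2 ∂μ) ^ (p - 1) := by
  have h := ENNReal.lintegral_mul_norm_pow_le (μ := μ) (f := F) (g := fun x => F x ^ 2) hF (hF.pow_const 2)
    (p := 2 - p) (q := p - 1) (by linarith) (by linarith) (by ring)
  refine le_trans (lintegral_mono fun x => ?_) h
  simp only
  rw [← ENNReal.rpow_natCast, ← ENNReal.rpow_mul, ← ENNReal.rpow_add_of_nonneg _ _ (by linarith) (by push_cast; linarith)]
  apply le_of_eq; congr 1; push_cast; ring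

lemma interp2 {X : Type*} [MeasurableSpace X] {μ : Measure X} {F : X → ℝ≥0∞} (hF : AEMeasurable F μ) {p : ℝ} (h1 : 1 ≤ p) (h2 : p ≤ 2) :
    ∫⁻ x, F x ^ p ∂μ ≤ (μ univ) ^ (1 - p / 2) * (∫⁻ x, F x ^ 2 ∂μ) ^ (p / 2) := by
  have h := ENNReal.lintegral_mul_norm_pow_le (μ := μ) (f := fun _ => 1) (g := fun x => F x ^ 2) aemeasurable_const (hF.pow_const 2)
    (p := 1 - p / 2) (q := p / 2) (by linarith) (by linarith) (by ring)
  rw [lintegral_one] at h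
  refine le_trans (lintegral_mono fun x => ?_) h
  simp only
  rw [ENNReal.one_rpow, one_mul, ← ENNReal.rpow_natCast, ← ENNReal.rpow_mul]
  apply le_of_eq; congr 1; push_cast; ring

lemma measurable_Kker (d m : ℕ) {ε : ℝ} (h1 : 0 < ε) :
    Measurable (fun q : Ed d × (Ed d × ℝ) => Kk d m ε q.2.2 (q.2.1 - q.1)) :=
  (continuous_Kk_joint d m h1).measurable.comp
    (Measurable.prodMk (measurable_snd.comp measurable_snd) ((measurable_fst.comp measurable_snd).sub measurable_fst))

lemma measurable_Sg (d m : ℕ) {ε : ℝ} (h1 : 0 < ε) {g : Ed d × ℝ → ℂ} (hg : Measurable g) : Measurable (Sg d m ε g) := by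
  have h : Measurable (fun q : Ed d × (Ed d × ℝ) => Kk d m ε q.2.2 (q.2.1 - q.1) * g q.2) :=
    (measurable_Kker d m h1).mul (hg.comp measurable_snd)
  have := StronglyMeasurable.integral_prod_right (ν := lam d) (f := fun (y : Ed d) (z : Ed d × ℝ) => Kk d m ε z.2 (z.1 - y) * g z) h.stronglyMeasurable
  exact this.measurable

lemma enorm_Sg_le (d m : ℕ) (ε : ℝ) (g : Ed d × ℝ → ℂ) (y : Ed d) :
    ‖Sg d m ε g y‖ₑ ≤ ∫⁻ z, ‖Kk d m ε z.2 (z.1 - y)‖ₑ * ‖g z‖ₑ ∂(lam d) := by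
  refine (enorm_integral_le_lintegral_enorm _).trans (lintegral_mono fun z => ?_)
  rw [enorm_mul]

lemma Sg_L1_set (d m : ℕ) {ε : ℝ} (h1 : 0 < ε) {A : Set (Ed d × ℝ)} (hA : MeasurableSet A)
    {g : Ed d × ℝ → ℂ} (hg : Measurable g) (hg1 : ∀ z, ‖g z‖ ≤ 1) (hgA : ∀ z, z ∉ A → g z = 0)
    (S : Set (Ed d)) (c : ℝ≥0∞)
    (H : ∀ z ∈ A, ∫⁻ y in S, ‖Kk d m ε z.2 (z.1 - y)‖ₑ ≤ c) :
    ∫⁻ y in S, ‖Sg d m ε g y‖ₑ ≤ c * lam d A := by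
  calc _ ≤ ∫⁻ y in S, (∫⁻ z, ‖Kk d m ε z.2 (z.1 - y)‖ₑ * ‖g z‖ₑ ∂(lam d)) :=
        lintegral_mono fun y => enorm_Sg_le d m ε g y
    _ = ∫⁻ z, (∫⁻ y in S, ‖Kk d m ε z.2 (z.1 - y)‖ₑ * ‖g z‖ₑ) ∂(lam d) := by
        apply lintegral_lintegral_swap (f := fun y z => ‖Kk d m ε z.2 (z.1 - y)‖ₑ * ‖g z‖ₑ)
        exact (Measurable.mul (f := fun q : Ed d × (Ed d × ℝ) => ‖Kk d m ε q.2.2 (q.2.1 - q.1)‖ₑ) (g := fun q => ‖g q.2‖ₑ)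
          (measurable_Kker d m h1).enorm (hg.comp measurable_snd).enorm).aemeasurable
    _ ≤ ∫⁻ z, A.indicator (fun _ => c) z ∂(lam d) := by
        refine lintegral_mono fun z => ?_
        show ∫⁻ y in S, ‖Kk d m ε z.2 (z.1 - y)‖ₑ * ‖g z‖ₑ ≤ _
        rw [lintegral_mul_const' _ _ enorm_ne_top]
        by_cases hz : z ∈ A
        · rw [indicator_of_mem hz]
          calc _ ≤ c * 1 := by
                apply mul_le_mul' (H z hz)
                rw [← ofReal_norm]
                simpa using ENNReal.ofReal_le_ofReal (hg1 z)
            _ = c := mul_one c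
        · rw [hgA z hz]; simp
    _ = _ := by rw [lintegral_indicator hA]; simp

lemma Kk_tail' (d m : ℕ) (hd : 2 ≤ d) (hm : 1 ≤ m) : ∃ C : ℝ, 0 < C ∧ ∀ ε t s : ℝ, 0 < ε → ε ≤ 1 → 1 ≤ t → t ≤ 2 → 0 ≤ s →
    ∀ (x : Ed d) (S : Set (Ed d)), (∀ y ∈ S, s ≤ |2 * Real.pi * ‖x - y‖ - t|) →
    ∫⁻ y in S, ‖Kk d m ε t (x - y)‖ₑ ≤
      ENNReal.ofReal (C * ε ^ (1 - (d + 1 : ℝ) / 2) * (1 + s / ε) ^ (-(m - 1 : ℝ))) := by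
  obtain ⟨C, hC, H⟩ := Kk_tail d m hd hm
  refine ⟨C, hC, fun ε t s h1 h2 h3 h4 h5 x S hS => ?_⟩
  refine le_trans ?_ (H ε t s h1 h2 h3 h4 h5)
  have hm : MeasurableSet {x : Ed d | s ≤ |2 * Real.pi * ‖x‖ - t|} :=
    (isClosed_le continuous_const (by fun_prop)).measurableSet
  rw [← lintegral_indicator hm, ← lintegral_sub_left_eq_self (μ := (volume : Measure (Ed d))) ({x : Ed d | s ≤ |2 * Real.pi * ‖x‖ - t|}.indicator fun x => ‖Kk d m ε t x‖ₑ) x]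
  have hm' : MeasurableSet {y : Ed d | s ≤ |2 * Real.pi * ‖x - y‖ - t|} :=
    (isClosed_le continuous_const (by fun_prop)).measurableSet
  calc _ ≤ ∫⁻ y in {y : Ed d | s ≤ |2 * Real.pi * ‖x - y‖ - t|}, ‖Kk d m ε t (x - y)‖ₑ :=
        lintegral_mono_set hS
    _ = _ := by
      rw [← lintegral_indicator hm']
      rfl

lemma annulus_vol (d : ℕ) (hd : 1 ≤ d) : ∃ C : ℝ, 0 < C ∧ ∀ (x : Ed d) (t ρ : ℝ), 1 ≤ t → t ≤ 2 → 0 < ρ → ρ ≤ 2 →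
    volume {y : Ed d | |2 * Real.pi * ‖y - x‖ - t| ≤ 40 * ρ} ≤ ENNReal.ofReal (C * ρ) := by
  have : Nontrivial (Ed d) := by
    apply Module.nontrivial_of_finrank_pos (R := ℝ)
    rw [finrank_euclideanSpace_fin]; omega
  set c := (volume : Measure (Ed d)).real (ball 0 1) with hc
  have hc0 : 0 ≤ c := measureReal_nonneg
  have hp := Real.pi_gt_three
  refine ⟨c * (d * 14 ^ (d - 1) * 14) + 1, by positivity, ?_⟩
  intro x t ρ h1 h2 h3 h4
  set b := (t + 40 * ρ) / (2 * Real.pi) with hb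
  set a := max 0 ((t - 40 * ρ) / (2 * Real.pi)) with ha
  have ha0 : 0 ≤ a := le_max_left _ _
  have hab : a ≤ b := by
    apply max_le
    · positivity
    · rw [hb]; gcongr; linarith
  have hb0 : 0 ≤ b := ha0.trans hab
  have hb14 : b ≤ 14 := by
    rw [hb, div_le_iff₀ (by positivity)]; nlinarith
  have hba : b - a ≤ 14 * ρ := by
    have : (t - 40 * ρ) / (2 * Real.pi) ≤ a := le_max_right _ _
    have e : b - (t - 40 * ρ) / (2 * Real.pi) ≤ 14 * ρ := by
      rw [hb, ← sub_div, div_le_iff₀ (by positivity)]; nlinarith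
    linarith
  have hsub : {y : Ed d | |2 * Real.pi * ‖y - x‖ - t| ≤ 40 * ρ} ⊆ closedBall x b \ ball x a := by
    intro y hy
    have hy' : |2 * Real.pi * ‖y - x‖ - t| ≤ 40 * ρ := hy
    rw [abs_le] at hy'
    refine ⟨?_, ?_⟩
    · rw [mem_closedBall, dist_eq_norm, hb, le_div_iff₀ (by positivity)]; linarith
    · rw [mem_ball, dist_eq_norm, not_lt]
      apply max_le (norm_nonneg _)
      rw [div_le_iff₀ (by positivity)]; linarith
  refine (measure_mono hsub).trans ?_
  rw [measure_sdiff (ball_subset_closedBall.trans (closedBall_subset_closedBall hab)) measurableSet_ball.nullMeasurableSet measure_ball_lt_top.ne]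
  rw [Measure.addHaar_closedBall _ _ hb0, Measure.addHaar_ball _ _ ha0, finrank_euclideanSpace_fin,
    ← ofReal_measureReal (μ := volume) (s := ball (0 : Ed d) 1) measure_ball_lt_top.ne, ← hc, ← ENNReal.ofReal_mul (by positivity),
    ← ENNReal.ofReal_mul (by positivity), ← ENNReal.ofReal_sub _ (by positivity)]
  apply ENNReal.ofReal_le_ofReal
  have k := abs_pow_sub_pow_le b a d
  rw [abs_of_nonneg hb0, abs_of_nonneg ha0, max_eq_left hab, abs_of_nonneg (by linarith : 0 ≤ b - a)] at k
  have k2 : b ^ d - a ^ d ≤ (14 * ρ) * d * 14 ^ (d - 1) := by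
    refine (le_abs_self _).trans (k.trans ?_)
    gcongr
  calc b ^ d * c - a ^ d * c = c * (b ^ d - a ^ d) := by ring
    _ ≤ c * ((14 * ρ) * d * 14 ^ (d - 1)) := by gcongr
    _ ≤ _ := by nlinarith

lemma ei_combine {C1 C2 ε u a1 a2 b1 b2 θ σ : ℝ} (hC1 : 0 < C1) (hC2 : 0 < C2) (hε : 0 < ε) (hu : 0 < u)
    (hθ : 0 ≤ θ) (hσ : 0 ≤ σ) (hs : θ + σ = 1) (Λ : ℝ≥0∞) :
    (ENNReal.ofReal (C1 * (ε ^ a1 * u ^ a2)) * Λ) ^ θ * (ENNReal.ofReal (C2 * (ε ^ b1 * u ^ b2)) * Λ) ^ σ =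
    ENNReal.ofReal (C1 ^ θ * C2 ^ σ * (ε ^ (a1 * θ + b1 * σ) * u ^ (a2 * θ + b2 * σ))) * Λ := by
  rw [ENNReal.mul_rpow_of_nonneg _ _ hθ, ENNReal.mul_rpow_of_nonneg _ _ hσ, mul_mul_mul_comm,
    ← ENNReal.rpow_add_of_nonneg _ _ hθ hσ, hs, ENNReal.rpow_one,
    ENNReal.ofReal_rpow_of_pos (by positivity), ENNReal.ofReal_rpow_of_pos (by positivity), ← ENNReal.ofReal_mul (by positivity)]
  congr 2
  rw [Real.mul_rpow hC1.le (by positivity), Real.mul_rpow hC2.le (by positivity), Real.mul_rpow (by positivity) (by positivity),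
    Real.mul_rpow (by positivity) (by positivity), ← Real.rpow_mul hε.le, ← Real.rpow_mul hε.le, ← Real.rpow_mul hu.le,
    ← Real.rpow_mul hu.le, Real.rpow_add hε, Real.rpow_add hu]
  ring

lemma piece_L2 (d m : ℕ) (hd : 4 ≤ d) (hm : 1 ≤ m) : ∃ C : ℝ, 0 < C ∧ ∀ (ε : ℝ), 0 < ε → ε ≤ 1 →
    ∀ (A : Set (Ed d × ℝ)) (_ : MeasurableSet A) (_ : lam d A ≠ ⊤) (v u : ℝ) (_ : 0 < v) (_ : u = v * ε ^ (-(d:ℝ)))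
    (_ : ∀ z ∈ A, z.2 ∈ Icc (1:ℝ) 2) (_ : Dens d A (2 ^ (d + 1) * v))
    (g : Ed d × ℝ → ℂ) (_ : Measurable g) (_ : ∀ z, ‖g z‖ ≤ 1) (_ : ∀ z, z ∉ A → g z = 0),
    ∫⁻ y, ‖Sg d m ε g y‖ₑ ^ 2 ≤ ENNReal.ofReal (C * (ε ^ (1:ℝ) * u ^ (2 / (d - 1 : ℝ)))) * lam d A := by
  obtain ⟨C, hC, H⟩ := S_L2_density d m hd hm
  refine ⟨C * (2 ^ (d + 1)) ^ (2 / (d - 1 : ℝ)), by positivity, ?_⟩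
  intro ε h1 h2 A hA hfin v u hv hu hI hD g hg hg1 hgA
  refine (H ε h1 h2 A hA hfin _ (by positivity) hI hD g hg hg1 hgA).trans (le_of_eq ?_)
  congr 2
  rw [mul_assoc (2 ^ (d + 1)), ← hu, Real.mul_rpow (by positivity) (by rw [hu]; positivity), Real.rpow_one]
  ring

lemma piece_L1 (d m : ℕ) (hd : 4 ≤ d) (hm : 1 ≤ m) : ∃ C : ℝ, 0 < C ∧ ∀ (ε : ℝ), 0 < ε → ε ≤ 1 →
    ∀ (A : Set (Ed d × ℝ)) (_ : MeasurableSet A) (_ : ∀ z ∈ A, z.2 ∈ Icc (1:ℝ) 2)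
    (g : Ed d × ℝ → ℂ) (_ : Measurable g) (_ : ∀ z, ‖g z‖ ≤ 1) (_ : ∀ z, z ∉ A → g z = 0) (u : ℝ),
    ∫⁻ y, ‖Sg d m ε g y‖ₑ ≤ ENNReal.ofReal (C * (ε ^ (1 - (d + 1 : ℝ) / 2) * u ^ (0:ℝ))) * lam d A := by
  obtain ⟨C, hC, H⟩ := Kk_tail' d m (by omega) hm
  refine ⟨C, hC, ?_⟩
  intro ε h1 h2 A hA hI g hg hg1 hgA u
  have := Sg_L1_set d m h1 hA hg hg1 hgA univ (ENNReal.ofReal (C * (ε ^ (1 - (d + 1 : ℝ) / 2) * u ^ (0:ℝ)))) (fun z hz => by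
    have := H ε z.2 0 h1 h2 (hI z hz).1 (hI z hz).2 le_rfl z.1 univ (fun y _ => abs_nonneg _)
    simpa using this)
  simpa using this

/-- exceptional set of a cover -/
def Om (d : ℕ) (u : Set ((Ed d × ℝ) × ℝ)) : Set (Ed d) :=
  ⋃ i ∈ u, {y : Ed d | |2 * Real.pi * ‖y - i.1.1‖ - i.1.2| ≤ 40 * i.2}

lemma measurableSet_Om (d : ℕ) {u : Set ((Ed d × ℝ) × ℝ)} (hu : u.Countable) : MeasurableSet (Om d u) :=
  MeasurableSet.biUnion hu (fun i _ => (isClosed_le (by fun_prop) continuous_const).measurableSet)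

lemma piece_cover (d m : ℕ) (hd : 4 ≤ d) (hm : 1 ≤ m) (C0 : ℝ) (hC0 : 0 < C0) : ∃ C : ℝ, 0 < C ∧ ∀ (ε : ℝ), 0 < ε → ε ≤ 1 →
    ∀ (A : Set (Ed d × ℝ)) (_ : MeasurableSet A) (v u : ℝ) (_ : 0 < v) (_ : u = v * ε ^ (-(d:ℝ)))
    (_ : ∀ z ∈ A, z.2 ∈ Icc (1:ℝ) 2) (_ : Cover d A v C0)
    (g : Ed d × ℝ → ℂ) (_ : Measurable g) (_ : ∀ z, ‖g z‖ ≤ 1) (_ : ∀ z, z ∉ A → g z = 0),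
    ∃ Ω : Set (Ed d), MeasurableSet Ω ∧ volume Ω ≤ ENNReal.ofReal (C * (ε ^ (-(d:ℝ)) * u ^ (-1:ℝ))) * lam d A ∧
      ∫⁻ y in Ωᶜ, ‖Sg d m ε g y‖ₑ ≤ ENNReal.ofReal (C * (ε ^ (1 - (d + 1 : ℝ) / 2) * u ^ (-(m - 1 : ℝ) / d))) * lam d A := by
  obtain ⟨C1, hC1, H1⟩ := Kk_tail' d m (by omega) hm
  obtain ⟨C2, hC2, H2⟩ := annulus_vol d (by omega)
  have hm' : (0:ℝ) ≤ m - 1 := by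
    have : (1:ℝ) ≤ m := by exact_mod_cast hm
    linarith
  have hd0 : (0:ℝ) < d := by have : 0 < d := by omega
                             exact_mod_cast this
  have hp := Real.pi_gt_three
  have hp' := Real.pi_lt_d2
  set C3 := C1 * C0⁻¹ ^ (-(m - 1 : ℝ) / d) with hC3
  have hC3' : 0 < C3 := by positivity
  refine ⟨C3 + C2, by positivity, ?_⟩
  intro ε h1 h2 A hA v u hv hu hI hcov g hg hg1 hgA
  obtain ⟨U, hUc, hUi, hAU, hsum⟩ := hcov
  have hu0 : 0 < u := by rw [hu]; positivity
  have hvu : v = u * ε ^ (d:ℝ) := by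
    rw [hu, mul_assoc, ← Real.rpow_add h1]; simp
  refine ⟨Om d U, measurableSet_Om d hUc, ?_, ?_⟩
  · have hc : ENNReal.ofReal (C2 * v⁻¹) ≤ ENNReal.ofReal ((C3 + C2) * (ε ^ (-(d:ℝ)) * u ^ (-1:ℝ))) := by
      apply ENNReal.ofReal_le_ofReal
      have e : v⁻¹ = ε ^ (-(d:ℝ)) * u ^ (-1:ℝ) := by
        rw [hvu, mul_inv, Real.rpow_neg_one, Real.rpow_neg h1.le]; ring
      rw [e]
      gcongr; linarith
    refine le_trans ?_ (mul_le_mul' hc hsum)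
    have : Countable U := hUc
    rw [Om, biUnion_eq_iUnion]
    refine (measure_iUnion_le _).trans ?_
    rw [← ENNReal.tsum_mul_left]
    refine ENNReal.tsum_le_tsum fun i => ?_
    obtain ⟨a1, a2, a3, a4⟩ := hUi i.1 i.2
    refine (H2 i.1.1.1 i.1.1.2 i.1.2 a4.1 a4.2 a1 a2).trans ?_
    rw [← ENNReal.ofReal_mul (by positivity)]
    apply ENNReal.ofReal_le_ofReal
    apply le_of_eq; field_simp
  · have hc : ENNReal.ofReal (C3 * (ε ^ (1 - (d + 1 : ℝ) / 2) * u ^ (-(m - 1 : ℝ) / d))) ≤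
        ENNReal.ofReal ((C3 + C2) * (ε ^ (1 - (d + 1 : ℝ) / 2) * u ^ (-(m - 1 : ℝ) / d))) := by
      apply ENNReal.ofReal_le_ofReal
      gcongr; linarith
    refine le_trans ?_ (mul_le_mul' hc le_rfl)
    apply Sg_L1_set d m h1 hA hg hg1 hgA
    intro z hz
    obtain ⟨i, hi, hzi⟩ := mem_iUnion₂.1 (hAU hz)
    obtain ⟨a1, a2, a3, a4⟩ := hUi i hi
    refine (H1 ε z.2 (3 * i.2) h1 h2 (hI z hz).1 (hI z hz).2 (by positivity) z.1 _ ?_).trans ?_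
    · intro y hy
      have hy1 : ¬ (|2 * Real.pi * ‖y - i.1.1‖ - i.1.2| ≤ 40 * i.2) := by
        intro h
        exact hy (mem_iUnion₂.2 ⟨i, hi, h⟩)
      rw [mem_closedBall, Prod.dist_eq, max_le_iff] at hzi
      obtain ⟨b1, b2⟩ := hzi
      rw [Real.dist_eq] at b2
      rw [dist_eq_norm] at b1
      have b3 : |‖z.1 - y‖ - ‖y - i.1.1‖| ≤ 5 * i.2 := by
        refine le_trans ?_ b1
        rw [norm_sub_rev y]
        have := abs_norm_sub_norm_le (z.1 - y) (i.1.1 - y)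
        simpa using this
      rw [not_le] at hy1
      have b4 := abs_le.1 b3
      have b5 := abs_le.1 b2
      have b6 : 2 * Real.pi * (‖z.1 - y‖ - ‖y - i.1.1‖) ≤ 32 * i.2 := by nlinarith
      have b7 : -(32 * i.2) ≤ 2 * Real.pi * (‖z.1 - y‖ - ‖y - i.1.1‖) := by nlinarith
      rw [mul_sub] at b6 b7
      rcases lt_abs.1 hy1 with h | h
      · apply le_abs.2; left; linarith
      · apply le_abs.2; right; linarith
    · apply ENNReal.ofReal_le_ofReal
      have k1 : (v / C0) ^ (1 / (d:ℝ)) ≤ i.2 := by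
        have : v / C0 ≤ i.2 ^ (d:ℝ) := by
          rw [div_le_iff₀ hC0, Real.rpow_natCast]; linarith
        calc _ ≤ (i.2 ^ (d:ℝ)) ^ (1 / (d:ℝ)) := by gcongr
          _ = i.2 := by rw [← Real.rpow_mul a1.le]; field_simp; simp
      have k2 : (u * C0⁻¹) ^ (1 / (d:ℝ)) ≤ 1 + 3 * i.2 / ε := by
        have : (u * C0⁻¹) ^ (1 / (d:ℝ)) = (v / C0) ^ (1 / (d:ℝ)) / ε := by
          rw [hvu, mul_div_right_comm, Real.mul_rpow (x := u / C0) (by positivity) (by positivity), ← Real.rpow_mul h1.le,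
            mul_one_div_cancel hd0.ne', Real.rpow_one, mul_div_assoc, div_self h1.ne', mul_one, div_eq_mul_inv u C0]
        rw [this]
        have : (v / C0) ^ (1 / (d:ℝ)) / ε ≤ i.2 / ε := by gcongr
        have h3 : 0 ≤ i.2 / ε := by positivity
        rw [mul_div_assoc]; linarith
      have k3 : (1 + 3 * i.2 / ε) ^ (-(m - 1 : ℝ)) ≤ u ^ (-(m - 1 : ℝ) / d) * C0⁻¹ ^ (-(m - 1 : ℝ) / d) := by
        rw [← Real.mul_rpow hu0.le (by positivity)]
        refine (Real.rpow_le_rpow_of_nonpos (by positivity) k2 (by linarith)).trans (le_of_eq ?_)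
        rw [← Real.rpow_mul (by positivity)]; congr 1; ring
      calc _ ≤ C1 * ε ^ (1 - (d + 1 : ℝ) / 2) * (u ^ (-(m - 1 : ℝ) / d) * C0⁻¹ ^ (-(m - 1 : ℝ) / d)) := by gcongr
        _ = _ := by rw [hC3]; ring

/-- the order used for the kernels -/
def mm (d : ℕ) : ℕ := d * (d + 1) + 1

lemma piece_bound (d : ℕ) (hd : 4 ≤ d) (p : ℝ) (hp1 : 1 < p) (hp2 : p * (d + 1) < 2 * (d - 1)) (C0 : ℝ) (hC0 : 0 < C0) :
    ∃ C δ : ℝ, 0 < C ∧ 0 < δ ∧ ∀ (ε : ℝ), 0 < ε → ε ≤ 1 →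
    ∀ (A : Set (Ed d × ℝ)) (_ : MeasurableSet A) (_ : lam d A ≠ ⊤) (v u : ℝ) (_ : 0 < v) (_ : u = v * ε ^ (-(d:ℝ)))
    (_ : ∀ z ∈ A, z.2 ∈ Icc (1:ℝ) 2) (_ : Dens d A (2 ^ (d + 1) * v)) (_ : Cover d A v C0)
    (g : Ed d × ℝ → ℂ) (_ : Measurable g) (_ : ∀ z, ‖g z‖ ≤ 1) (_ : ∀ z, z ∉ A → g z = 0),
    ∫⁻ y, ‖Sg d (mm d) ε g y‖ₑ ^ p ≤ ENNReal.ofReal (C * (ε ^ (p * ((d + 1) / 2) - d : ℝ) * (min u u⁻¹) ^ δ)) * lam d A := by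
  have hm : 1 ≤ mm d := by unfold mm; omega
  obtain ⟨C2, hC2, H2⟩ := piece_L2 d (mm d) hd hm
  obtain ⟨C1, hC1, H1⟩ := piece_L1 d (mm d) hd hm
  obtain ⟨C3, hC3, H3⟩ := piece_cover d (mm d) hd hm C0 hC0
  have hd4 : (4:ℝ) ≤ d := by exact_mod_cast hd
  have hplt : p < 2 := by nlinarith
  have hmm : ((mm d : ℕ) : ℝ) - 1 = d * (d + 1) := by unfold mm; push_cast; ring
  set e1 : ℝ := 0 * (2 - p) + 2 / (d - 1 : ℝ) * (p - 1) with he1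
  set e2 : ℝ := (-1:ℝ) * (1 - p / 2) + 2 / (d - 1 : ℝ) * (p / 2) with he2
  set e3 : ℝ := -((mm d : ℕ) - 1 : ℝ) / d * (2 - p) + 2 / (d - 1 : ℝ) * (p - 1) with he3
  have hd1 : (0:ℝ) < d - 1 := by linarith
  have p1 : 0 < e1 := by
    rw [he1, zero_mul, zero_add]
    have : 0 < p - 1 := by linarith
    positivity
  have p2 : e2 < 0 := by
    have : e2 = (p * (d + 1) - 2 * (d - 1)) / (2 * (d - 1)) := by rw [he2]; field_simp; ring
    rw [this]
    apply div_neg_of_neg_of_pos <;> linarith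
  have p3 : e3 < 0 := by
    rw [he3, hmm]
    have a1 : -((d:ℝ) * (d + 1)) / d = -(d + 1) := by field_simp
    rw [a1]
    have a2 : 2 / (d - 1 : ℝ) * (p - 1) < 1 := by
      rw [div_mul_eq_mul_div, div_lt_one hd1]; linarith
    nlinarith
  set δ := min e1 (min (-e2) (-e3)) with hδ
  have hδ0 : 0 < δ := lt_min p1 (lt_min (by linarith) (by linarith))
  have hδ1 : δ ≤ e1 := min_le_left _ _
  have hδ2 : e2 ≤ -δ := by
    have : δ ≤ -e2 := (min_le_right _ _).trans (min_le_left _ _)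
    linarith
  have hδ3 : e3 ≤ -δ := by
    have : δ ≤ -e3 := (min_le_right _ _).trans (min_le_right _ _)
    linarith
  set K1 := C1 ^ (2 - p) * C2 ^ (p - 1) with hK1
  set K2 := C3 ^ (1 - p / 2) * C2 ^ (p / 2) with hK2
  set K3 := C3 ^ (2 - p) * C2 ^ (p - 1) with hK3
  have hK1' : 0 < K1 := by positivity
  have hK2' : 0 < K2 := by positivity
  have hK3' : 0 < K3 := by positivity
  refine ⟨K1 + (K2 + K3), δ, by positivity, hδ0, ?_⟩
  intro ε h1 h2 A hA hfin v u hv hu hI hD hcov g hg hg1 hgA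
  have hu0 : 0 < u := by rw [hu]; positivity
  have hL2 := H2 ε h1 h2 A hA hfin v u hv hu hI hD g hg hg1 hgA
  have hL1 := H1 ε h1 h2 A hA hI g hg hg1 hgA u
  obtain ⟨Ω, hΩ, hΩv, hΩ1⟩ := H3 ε h1 h2 A hA v u hv hu hI hcov g hg hg1 hgA
  have hF : Measurable (fun y => ‖Sg d (mm d) ε g y‖ₑ) := (measurable_Sg d (mm d) h1 hg).enorm
  have hE : (0:ℝ) < ε ^ (p * ((d + 1) / 2) - d : ℝ) := by positivity
  set E := ε ^ (p * ((d + 1) / 2) - d : ℝ) with hEdef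
  rcases le_total u 1 with hu1 | hu1
  · have hmin : min u u⁻¹ = u := min_eq_left (hu1.trans ((one_le_inv₀ hu0).2 hu1))
    calc _ ≤ _ := interp12 hF.aemeasurable hp1.le hplt.le
      _ ≤ _ := mul_le_mul' (ENNReal.rpow_le_rpow hL1 (by linarith)) (ENNReal.rpow_le_rpow hL2 (by linarith))
      _ = _ := ei_combine hC1 hC2 h1 hu0 (by linarith) (by linarith) (by ring) _
      _ ≤ _ := by
        rw [← he1, ← hK1]
        apply mul_le_mul' _ le_rfl
        apply ENNReal.ofReal_le_ofReal
        rw [hmin]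
        have : (1 - (d + 1 : ℝ) / 2) * (2 - p) + 1 * (p - 1) = p * ((d + 1) / 2) - d := by ring
        rw [this, ← hEdef]
        apply mul_le_mul (by linarith) _ (by positivity) (by positivity)
        apply mul_le_mul_of_nonneg_left _ hE.le
        exact Real.rpow_le_rpow_of_exponent_ge hu0 hu1 hδ1
  · have hmin : min u u⁻¹ = u⁻¹ := min_eq_right ((inv_le_one_of_one_le₀ hu1).trans hu1)
    have hminδ : (min u u⁻¹) ^ δ = u ^ (-δ) := by rw [hmin, Real.inv_rpow hu0.le, Real.rpow_neg hu0.le]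
    have q1 : ∫⁻ y in Ω, ‖Sg d (mm d) ε g y‖ₑ ^ p ≤ ENNReal.ofReal (K2 * (E * u ^ (-δ))) * lam d A := by
      calc _ ≤ _ := interp2 hF.aemeasurable hp1.le hplt.le
        _ ≤ (ENNReal.ofReal (C3 * (ε ^ (-(d:ℝ)) * u ^ (-1:ℝ))) * lam d A) ^ (1 - p / 2) *
            (ENNReal.ofReal (C2 * (ε ^ (1:ℝ) * u ^ (2 / (d - 1 : ℝ)))) * lam d A) ^ (p / 2) := by
            apply mul_le_mul' (ENNReal.rpow_le_rpow _ (by linarith)) (ENNReal.rpow_le_rpow _ (by linarith))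
            · rw [Measure.restrict_apply_univ]; exact hΩv
            · exact (setLIntegral_le_lintegral _ _).trans hL2
        _ = _ := ei_combine hC3 hC2 h1 hu0 (by linarith) (by linarith) (by ring) _
        _ ≤ _ := by
          rw [← he2, ← hK2]
          apply mul_le_mul' _ le_rfl
          apply ENNReal.ofReal_le_ofReal
          have : -(d:ℝ) * (1 - p / 2) + 1 * (p / 2) = p * ((d + 1) / 2) - d := by ring
          rw [this, ← hEdef]
          gcongr
    have q2 : ∫⁻ y in Ωᶜ, ‖Sg d (mm d) ε g y‖ₑ ^ p ≤ ENNReal.ofReal (K3 * (E * u ^ (-δ))) * lam d A := by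
      calc _ ≤ _ := interp12 hF.aemeasurable hp1.le hplt.le
        _ ≤ _ := mul_le_mul' (ENNReal.rpow_le_rpow hΩ1 (by linarith)) (ENNReal.rpow_le_rpow ((setLIntegral_le_lintegral _ _).trans hL2) (by linarith))
        _ = _ := ei_combine hC3 hC2 h1 hu0 (by linarith) (by linarith) (by ring) _
        _ ≤ _ := by
          rw [← he3, ← hK3]
          apply mul_le_mul' _ le_rfl
          apply ENNReal.ofReal_le_ofReal
          have : (1 - (d + 1 : ℝ) / 2) * (2 - p) + 1 * (p - 1) = p * ((d + 1) / 2) - d := by ring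
          rw [this, ← hEdef]
          gcongr
    rw [← lintegral_add_compl _ hΩ]
    refine (add_le_add q1 q2).trans ?_
    rw [← add_mul, ← ENNReal.ofReal_add (by positivity) (by positivity), hminδ]
    apply mul_le_mul' _ le_rfl
    apply ENNReal.ofReal_le_ofReal
    rw [← add_mul]
    apply mul_le_mul_of_nonneg_right _ (by positivity)
    linarith

lemma tsum_pow_weight {ι : Type*} {p : ℝ} (hp : 1 < p) (w F : ι → ℝ≥0∞) (hw0 : ∀ i, w i ≠ 0) (hwt : ∀ i, w i ≠ ⊤) :
    (∑' i, F i) ^ p ≤ (∑' i, w i) ^ (p - 1) * ∑' i, w i ^ (1 - p) * F i ^ p := by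
  let _ : MeasurableSpace ι := ⊤
  have hp0 : 0 < p := by linarith
  have h := ENNReal.lintegral_mul_norm_pow_le (μ := Measure.count) (f := w) (g := fun i => w i ^ (1 - p) * F i ^ p)
    measurable_from_top.aemeasurable measurable_from_top.aemeasurable (p := (p - 1) / p) (q := 1 / p)
    (div_nonneg (by linarith) hp0.le) (by positivity) (by field_simp; ring)
  have e : ∀ i, w i ^ ((p - 1) / p) * (w i ^ (1 - p) * F i ^ p) ^ (1 / p) = F i := by
    intro i
    rw [ENNReal.mul_rpow_of_nonneg _ _ (by positivity), ← ENNReal.rpow_mul, ← ENNReal.rpow_mul, ← mul_assoc,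
      ← ENNReal.rpow_add _ _ (hw0 i) (hwt i), mul_one_div_cancel hp0.ne', ENNReal.rpow_one]
    have : (p - 1) / p + (1 - p) * (1 / p) = 0 := by field_simp; ring
    rw [this]; simp
  simp only [lintegral_count, e] at h
  have h2 := ENNReal.rpow_le_rpow h hp0.le
  rw [ENNReal.mul_rpow_of_nonneg _ _ hp0.le, ← ENNReal.rpow_mul, ← ENNReal.rpow_mul, one_div_mul_cancel hp0.ne', ENNReal.rpow_one,
    div_mul_cancel₀ _ hp0.ne'] at h2
  exact h2

/-- dyadic scale -/
def ek (k : ℕ) : ℝ := (2:ℝ) ^ (-(k:ℝ))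
lemma ek_pos (k : ℕ) : 0 < ek k := by unfold ek; positivity
lemma ek_le (k : ℕ) : ek k ≤ 1 := Real.rpow_le_one_of_one_le_of_nonpos (by norm_num) (by simp)

lemma min_weight (d : ℕ) (V δ : ℝ) (hV : 0 < V) (hδ : 0 < δ) : ∀ k n : ℕ, ∀ u : ℝ,
    u = V * ((2:ℝ) ^ (-(n:ℝ))) ^ d * ek k ^ (-(d:ℝ)) →
    (min u u⁻¹) ^ δ ≤ (max V V⁻¹) ^ δ * ((2:ℝ) ^ (-(d * δ))) ^ ((k:ℤ) - n).natAbs := by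
  intro k n u hu
  have hu' : u = V * (2:ℝ) ^ ((d:ℝ) * (k - n)) := by
    rw [hu, ek, ← Real.rpow_natCast, ← Real.rpow_mul (by norm_num), ← Real.rpow_mul (by norm_num), mul_assoc, ← Real.rpow_add (by norm_num)]
    congr 2; ring
  have hu0 : 0 < u := by rw [hu']; positivity
  have key : min u u⁻¹ ≤ max V V⁻¹ * (2:ℝ) ^ (-(d * (((k:ℤ) - n).natAbs : ℝ))) := by
    rcases le_total n k with h | h
    · have e : (((k:ℤ) - n).natAbs : ℝ) = k - n := by
        have : ((k:ℤ) - n).natAbs = k - n := by omega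
        rw [this, Nat.cast_sub h]
      rw [e]
      refine (min_le_right _ _).trans ?_
      rw [hu', mul_inv, Real.rpow_neg (by norm_num)]
      gcongr
      exact le_max_right _ _
    · have e : (((k:ℤ) - n).natAbs : ℝ) = n - k := by
        have : ((k:ℤ) - n).natAbs = n - k := by omega
        rw [this, Nat.cast_sub h]
      rw [e]
      refine (min_le_left _ _).trans ?_
      rw [hu']
      have : (d:ℝ) * (k - n) = -(d * (n - k)) := by ring
      rw [this]
      gcongr
      exact le_max_left _ _
  have hM : 0 < max V V⁻¹ := lt_max_of_lt_left hV
  calc _ ≤ (max V V⁻¹ * (2:ℝ) ^ (-(d * (((k:ℤ) - n).natAbs : ℝ)))) ^ δ := by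
        apply Real.rpow_le_rpow _ key hδ.le
        exact le_min hu0.le (by positivity)
    _ = _ := by
      rw [Real.mul_rpow hM.le (by positivity), ← Real.rpow_mul (by norm_num), ← Real.rpow_natCast, ← Real.rpow_mul (by norm_num)]
      congr 2; ring

lemma weight_sum (b : ℝ) (hb : 0 < b) (hb1 : b < 1) : ∑' j : ℤ, ENNReal.ofReal (b ^ j.natAbs) ≠ ⊤ := by
  have : Summable (fun j : ℤ => b ^ j.natAbs) := by
    apply Summable.of_nat_of_neg
    · simpa using summable_geometric_of_lt_one hb.le hb1
    · simpa using summable_geometric_of_lt_one hb.le hb1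
  exact this.tsum_ofReal_ne_top

lemma Sg_indicator (d m : ℕ) (ε : ℝ) (g : Ed d × ℝ → ℂ) (A : Set (Ed d × ℝ)) (hA : MeasurableSet A) (y : Ed d) :
    Sg d m ε (A.indicator g) y = ∫ z in A, Kk d m ε z.2 (z.1 - y) * g z ∂(lam d) := by
  rw [Sg, ← integral_indicator hA]
  congr 1; ext z
  by_cases h : z ∈ A <;> simp [h]

lemma enorm_Sg_le_tsum {ι : Type} [Countable ι] (d m : ℕ) (hd : 1 ≤ d) {ε : ℝ} (h1 : 0 < ε) (g : Ed d × ℝ → ℂ) (hgi : Integrable g (lam d))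
    (A : ι → Set (Ed d × ℝ)) (hA : ∀ n, MeasurableSet (A n)) (hdis : Pairwise (fun i j => Disjoint (A i) (A j)))
    (hz : ∀ᵐ z ∂(lam d), z ∉ ⋃ n, A n → g z = 0) (y : Ed d) :
    ‖Sg d m ε g y‖ₑ ≤ ∑' n, ‖Sg d m ε ((A n).indicator g) y‖ₑ := by
  have hK := Kg_integrable d m hd h1 g hgi y
  have e1 : Sg d m ε g y = ∫ z in ⋃ n, A n, Kk d m ε z.2 (z.1 - y) * g z ∂(lam d) := by
    rw [Sg, ← integral_indicator (MeasurableSet.iUnion hA)]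
    apply integral_congr_ae
    filter_upwards [hz] with z hz
    by_cases h : z ∈ ⋃ n, A n
    · rw [indicator_of_mem h]
    · rw [indicator_of_notMem h, hz h, mul_zero]
  have hs := hasSum_integral_iUnion (μ := lam d) hA hdis hK.integrableOn
  rw [e1, ← hs.tsum_eq]
  simp only [Sg_indicator _ _ _ _ _ (hA _)]
  exact enorm_tsum_le_tsum_enorm

lemma restricted (d : ℕ) (hd : 4 ≤ d) (p : ℝ) (hp1 : 1 < p) (hp2 : p * (d + 1) < 2 * (d - 1)) :
    ∃ C : ℝ, 0 < C ∧ ∀ (E : Set (Ed d × ℝ)) (_ : MeasurableSet E) (_ : lam d E ≠ ⊤) (_ : ∀ z ∈ E, z.2 ∈ Icc (1:ℝ) 2)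
    (g : ℕ → Ed d × ℝ → ℂ) (_ : ∀ k, Measurable (g k)) (_ : ∀ k z, ‖g k z‖ ≤ 1) (_ : ∀ k z, z ∉ E → g k z = 0),
    ∑' k, ENNReal.ofReal (ek k ^ (-(p * ((d + 1) / 2) - d) : ℝ)) * ∫⁻ y, ‖Sg d (mm d) (ek k) (g k) y‖ₑ ^ p ≤ ENNReal.ofReal C * lam d E := by
  obtain ⟨V, C0, hV, hC0, Hd⟩ := density_decomp d (by omega)
  obtain ⟨C1, δ, hC1, hδ, Hp⟩ := piece_bound d hd p hp1 hp2 C0 hC0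
  have hd0 : (0:ℝ) < d := by have : 0 < d := by omega
                             exact_mod_cast this
  have hp0 : 0 < p := by linarith
  set b : ℝ := (2:ℝ) ^ (-(d * δ) / p) with hb
  have hb0 : 0 < b := by positivity
  have hb1 : b < 1 := by
    apply Real.rpow_lt_one_of_one_lt_of_neg (by norm_num)
    apply div_neg_of_neg_of_pos _ hp0
    have : 0 < d * δ := by positivity
    linarith
  set w : ℤ → ℝ≥0∞ := fun j => ENNReal.ofReal (b ^ j.natAbs) with hw
  have hw0 : ∀ j, w j ≠ 0 := fun j => by simp only [hw]; rw [ENNReal.ofReal_ne_zero_iff]; positivity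
  have hwt : ∀ j, w j ≠ ⊤ := fun j => ENNReal.ofReal_ne_top
  set B := ∑' j, w j with hB
  have hBt : B ≠ ⊤ := weight_sum b hb0 hb1
  set K := C1 * (max V V⁻¹) ^ δ with hK
  have hM : 0 < max V V⁻¹ := lt_max_of_lt_left hV
  have hK0 : 0 < K := by positivity
  have hfin : B ^ p * ENNReal.ofReal K ≠ ⊤ := ENNReal.mul_ne_top (ENNReal.rpow_ne_top_of_nonneg hp0.le hBt) ENNReal.ofReal_ne_top
  refine ⟨(B ^ p * ENNReal.ofReal K).toReal + 1, by positivity, ?_⟩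
  intro E hE hEfin hEI g hg hg1 hgE
  obtain ⟨A, hA, hAE, hdis, hnull, hDens, hCov⟩ := Hd E hE hEI
  have hAfin : ∀ n, lam d (A n) ≠ ⊤ := fun n => ((measure_mono (hAE n)).trans_lt hEfin.lt_top).ne
  set γ : ℝ := p * ((d + 1) / 2) - d with hγ
  have step : ∀ k n, ∫⁻ y, ‖Sg d (mm d) (ek k) ((A n).indicator (g k)) y‖ₑ ^ p ≤
      ENNReal.ofReal (ek k ^ γ) * (ENNReal.ofReal K * w (k - n) ^ p * lam d (A n)) := by
    intro k n
    have h := Hp (ek k) (ek_pos k) (ek_le k) (A n) (hA n) (hAfin n) (V * ((2:ℝ) ^ (-(n:ℝ))) ^ d) _ (by positivity) rfl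
      (fun z hz => hEI z (hAE n hz)) (hDens n) (hCov n) ((A n).indicator (g k)) ((hg k).indicator (hA n))
      (fun z => by
        by_cases h : z ∈ A n
        · rw [indicator_of_mem h]; exact hg1 k z
        · rw [indicator_of_notMem h]; simp)
      (fun z hz => indicator_of_notMem hz _)
    refine h.trans ?_
    rw [← mul_assoc (ENNReal.ofReal (ek k ^ γ))]
    refine mul_le_mul' ?_ le_rfl
    simp only [hw]
    have hek := ek_pos k
    rw [ENNReal.ofReal_rpow_of_pos (by positivity), ← ENNReal.ofReal_mul (by positivity), ← ENNReal.ofReal_mul (by positivity)]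
    apply ENNReal.ofReal_le_ofReal
    have mw := min_weight d V δ hV hδ k n _ rfl
    have e : (b ^ ((k:ℤ) - n).natAbs) ^ p = ((2:ℝ) ^ (-(d * δ))) ^ ((k:ℤ) - n).natAbs := by
      rw [← Real.rpow_natCast, ← Real.rpow_natCast, ← Real.rpow_mul hb0.le, hb, ← Real.rpow_mul (by norm_num), ← Real.rpow_mul (by norm_num)]
      congr 1; field_simp
    rw [e]
    calc _ ≤ C1 * (ek k ^ γ * ((max V V⁻¹) ^ δ * ((2:ℝ) ^ (-(d * δ))) ^ ((k:ℤ) - n).natAbs)) := by gcongr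
      _ = _ := by rw [hK]; ring
  have stepk : ∀ k, ENNReal.ofReal (ek k ^ (-γ)) * ∫⁻ y, ‖Sg d (mm d) (ek k) (g k) y‖ₑ ^ p ≤
      B ^ (p - 1) * ∑' n : ℕ, ENNReal.ofReal K * (w (k - n) * lam d (A n)) := by
    intro k
    have hek := ek_pos k
    have hgi := bdd_set_integrable hE hEfin (hg k) (hg1 k) (hgE k)
    have hz : ∀ᵐ z ∂(lam d), z ∉ ⋃ n, A n → g k z = 0 := by
      have h0 : ∀ᵐ z ∂(lam d), z ∉ E \ ⋃ n, A n := measure_eq_zero_iff_ae_notMem.1 hnull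
      filter_upwards [h0] with z hz hzn
      by_cases hzE : z ∈ E
      · exact absurd ⟨hzE, hzn⟩ hz
      · exact hgE k z hzE
    have a1 : ∫⁻ y, ‖Sg d (mm d) (ek k) (g k) y‖ₑ ^ p ≤
        B ^ (p - 1) * ∑' n : ℕ, w (k - n) ^ (1 - p) * ∫⁻ y, ‖Sg d (mm d) (ek k) ((A n).indicator (g k)) y‖ₑ ^ p := by
      calc _ ≤ ∫⁻ y, B ^ (p - 1) * ∑' n : ℕ, w (k - n) ^ (1 - p) * ‖Sg d (mm d) (ek k) ((A n).indicator (g k)) y‖ₑ ^ p := by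
            refine lintegral_mono fun y => ?_
            have h := enorm_Sg_le_tsum d (mm d) (by omega) hek (g k) hgi A hA hdis hz y
            refine (ENNReal.rpow_le_rpow h hp0.le).trans ?_
            refine (tsum_pow_weight hp1 (fun n : ℕ => w (k - n)) _ (fun n => hw0 _) (fun n => hwt _)).trans ?_
            refine mul_le_mul' (ENNReal.rpow_le_rpow ?_ (by linarith)) le_rfl
            apply ENNReal.tsum_comp_le_tsum_of_injective (f := fun n : ℕ => ((k:ℤ) - n))
            intro a b hab
            simp only at hab
            omega
        _ = _ := by
            rw [lintegral_const_mul' _ _ (ENNReal.rpow_ne_top_of_nonneg (by linarith) hBt), lintegral_tsum]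
            · congr 2; ext n
              rw [lintegral_const_mul' _ _ (ENNReal.rpow_ne_top_of_ne_zero (hw0 _) (hwt _))]
            · intro n
              exact (((measurable_Sg d (mm d) hek ((hg k).indicator (hA n))).enorm.pow_const p).const_mul _).aemeasurable
    calc _ ≤ ENNReal.ofReal (ek k ^ (-γ)) * (B ^ (p - 1) * ∑' n : ℕ, w (k - n) ^ (1 - p) * (ENNReal.ofReal (ek k ^ γ) * (ENNReal.ofReal K * w (k - n) ^ p * lam d (A n)))) := by
          refine mul_le_mul' le_rfl (a1.trans (mul_le_mul' le_rfl (ENNReal.tsum_le_tsum fun n => mul_le_mul' le_rfl (step k n))))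
      _ = _ := by
          rw [mul_left_comm, ← ENNReal.tsum_mul_left]
          congr 2; ext n
          have e1 : w (k - n) ^ (1 - p) * w (k - n) ^ p = w (k - n) := by
            rw [← ENNReal.rpow_add _ _ (hw0 _) (hwt _)]; simp
          have e2 : ENNReal.ofReal (ek k ^ (-γ)) * ENNReal.ofReal (ek k ^ γ) = 1 := by
            rw [← ENNReal.ofReal_mul (by positivity), ← Real.rpow_add hek]; simp
          calc _ = (ENNReal.ofReal (ek k ^ (-γ)) * ENNReal.ofReal (ek k ^ γ)) * (ENNReal.ofReal K * ((w (k - n) ^ (1 - p) * w (k - n) ^ p) * lam d (A n))) := by ring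
            _ = _ := by rw [e1, e2, one_mul]
  calc _ ≤ ∑' k : ℕ, B ^ (p - 1) * ∑' n : ℕ, ENNReal.ofReal K * (w (k - n) * lam d (A n)) := ENNReal.tsum_le_tsum stepk
    _ = B ^ (p - 1) * (ENNReal.ofReal K * ∑' n : ℕ, (∑' k : ℕ, w (k - n)) * lam d (A n)) := by
        simp only [ENNReal.tsum_mul_left]
        rw [ENNReal.tsum_comm]
        simp only [ENNReal.tsum_mul_right]
    _ ≤ B ^ (p - 1) * (ENNReal.ofReal K * ∑' n : ℕ, B * lam d (A n)) := by
        gcongr with n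
        apply ENNReal.tsum_comp_le_tsum_of_injective (f := fun k : ℕ => ((k:ℤ) - n))
        intro a b hab
        simp only at hab
        omega
    _ ≤ B ^ (p - 1) * (ENNReal.ofReal K * (B * lam d E)) := by
        rw [ENNReal.tsum_mul_left, ← measure_iUnion hdis hA]
        gcongr
        exact iUnion_subset hAE
    _ = (B ^ p * ENNReal.ofReal K) * lam d E := by
        have : B ^ p = B ^ (p - 1) * B := by
          conv_rhs => rw [← ENNReal.rpow_one B, ← ENNReal.rpow_mul, ← ENNReal.rpow_add_of_nonneg _ _ (by linarith) (by norm_num)]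
          congr 1; ring
        rw [this]; ring
    _ ≤ _ := by
        refine mul_le_mul' ?_ le_rfl
        rw [← ENNReal.ofReal_toReal hfin]
        apply ENNReal.ofReal_le_ofReal
        rw [ENNReal.ofReal_toReal hfin]
        linarith

lemma two_rpow_ne (x : ℝ) : (2:ℝ≥0∞) ^ x ≠ 0 ∧ (2:ℝ≥0∞) ^ x ≠ ⊤ :=
  ⟨(ENNReal.rpow_pos (by norm_num) (by norm_num)).ne', ENNReal.rpow_ne_top_of_ne_zero (by norm_num) (by norm_num)⟩

lemma two_rpow_add (x y : ℝ) : (2:ℝ≥0∞) ^ (x + y) = (2:ℝ≥0∞) ^ x * (2:ℝ≥0∞) ^ y :=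
  ENNReal.rpow_add _ _ (by norm_num) (by norm_num)

lemma two_weight_sum (κ : ℝ) (hκ : 0 < κ) : ∃ B : ℝ≥0∞, B ≠ ⊤ ∧ ∀ L : ℤ, ∑' l : ℤ, (2:ℝ≥0∞) ^ (-(κ * |(l:ℝ) - L|)) ≤ B := by
  set b : ℝ := (2:ℝ) ^ (-κ) with hb
  have hb0 : 0 < b := by positivity
  have hb1 : b < 1 := Real.rpow_lt_one_of_one_lt_of_neg (by norm_num) (by linarith)
  refine ⟨_, weight_sum b hb0 hb1, fun L => ?_⟩
  have e : ∀ l : ℤ, (2:ℝ≥0∞) ^ (-(κ * |(l:ℝ) - L|)) = ENNReal.ofReal (b ^ (l - L).natAbs) := by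
    intro l
    have : (2:ℝ≥0∞) = ENNReal.ofReal 2 := by simp
    rw [this, ENNReal.ofReal_rpow_of_pos (by norm_num), hb, ← Real.rpow_natCast, ← Real.rpow_mul (by norm_num)]
    congr 2
    rw [Nat.cast_natAbs]; push_cast; ring
  simp only [e]
  apply ENNReal.tsum_comp_le_tsum_of_injective (f := fun l : ℤ => l - L) (g := fun j : ℤ => ENNReal.ofReal (b ^ j.natAbs))
  intro a b hab
  simp only at hab
  omega

lemma ptw_half (p r : ℝ) (hr : 1 < r) (hpr : p ≠ r) : ∃ B : ℝ≥0∞, B ≠ ⊤ ∧ ∀ (L : ℤ) (b : ℤ → ℝ≥0∞),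
    (∀ l, b l ≠ 0 → 0 ≤ (r - p) * (L - l)) →
    (∑' l : ℤ, (2:ℝ≥0∞) ^ (l:ℝ) * b l) ^ r ≤ B * (2:ℝ≥0∞) ^ ((L:ℝ) * (r - p)) * ∑' l : ℤ, (2:ℝ≥0∞) ^ ((l:ℝ) * p) * b l ^ r := by
  have hr0 : 0 < r - 1 := by linarith
  set κ := |r - p| / (r - 1) with hκ
  have hκ0 : 0 < κ := div_pos (abs_pos.2 (sub_ne_zero.2 hpr.symm)) hr0
  obtain ⟨B, hB, H⟩ := two_weight_sum κ hκ0
  refine ⟨B ^ (r - 1), ENNReal.rpow_ne_top_of_nonneg hr0.le hB, fun L b hb => ?_⟩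
  refine (tsum_pow_weight hr (fun l : ℤ => (2:ℝ≥0∞) ^ (-(κ * |(l:ℝ) - L|))) _ (fun l => (two_rpow_ne _).1) (fun l => (two_rpow_ne _).2)).trans ?_
  rw [mul_assoc, ← ENNReal.tsum_mul_left (a := (2:ℝ≥0∞) ^ ((L:ℝ) * (r - p)))]
  refine mul_le_mul' (ENNReal.rpow_le_rpow (H L) hr0.le) (ENNReal.tsum_le_tsum fun l => ?_)
  by_cases h0 : b l = 0
  · rw [h0]; simp [ENNReal.zero_rpow_of_pos (by linarith : 0 < r)]
  have h := hb l h0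
  rw [ENNReal.mul_rpow_of_nonneg _ _ (by linarith), ← ENNReal.rpow_mul, ← ENNReal.rpow_mul, ← mul_assoc, ← mul_assoc, ← two_rpow_add, ← two_rpow_add]
  apply le_of_eq
  congr 2
  have e : κ * (r - 1) = |r - p| := by rw [hκ]; field_simp
  have e2 : |r - p| * |(l:ℝ) - L| = (r - p) * (L - l) := by
    rw [← abs_mul, ← abs_neg]
    rw [abs_of_nonneg (by linarith)]; ring
  calc _ = (κ * (r - 1)) * |(l:ℝ) - L| + l * r := by ring
    _ = _ := by rw [e, e2]; ring

lemma ptw_fin (p0 p p1 : ℝ) (h0 : 1 < p0) (h1 : p0 < p) (h2 : p < p1) : ∃ C : ℝ≥0∞, C ≠ ⊤ ∧ ∀ b : ℤ → ℝ≥0∞,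
    ∑' l : ℤ, (2:ℝ≥0∞) ^ (l:ℝ) * b l ≠ ⊤ →
    (∑' l : ℤ, (2:ℝ≥0∞) ^ (l:ℝ) * b l) ^ p ≤ C * ∑' l : ℤ, (2:ℝ≥0∞) ^ ((l:ℝ) * p) * (b l ^ p0 + b l ^ p1) := by
  obtain ⟨B0, hB0, H0⟩ := ptw_half p p0 h0 h1.ne'
  obtain ⟨B1, hB1, H1⟩ := ptw_half p p1 (by linarith) h2.ne
  refine ⟨2 ^ p0 * B0 * 2 ^ (p - p0) + 2 ^ p1 * B1, ?_, ?_⟩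
  · exact ENNReal.add_ne_top.2 ⟨ENNReal.mul_ne_top (ENNReal.mul_ne_top (two_rpow_ne _).2 hB0) (two_rpow_ne _).2,
      ENNReal.mul_ne_top (two_rpow_ne _).2 hB1⟩
  intro b hS
  set S := ∑' l : ℤ, (2:ℝ≥0∞) ^ (l:ℝ) * b l with hSdef
  set R := ∑' l : ℤ, (2:ℝ≥0∞) ^ ((l:ℝ) * p) * (b l ^ p0 + b l ^ p1) with hR
  by_cases hS0 : S = 0
  · rw [hS0, ENNReal.zero_rpow_of_pos (by linarith)]; exact zero_le
  have hSr : 0 < S.toReal := ENNReal.toReal_pos hS0 hS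
  obtain ⟨L, hL1, hL2⟩ := exists_mem_Ico_zpow hSr (by norm_num : (1:ℝ) < 2)
  have hL1' : (2:ℝ≥0∞) ^ (L:ℝ) ≤ S := by
    rw [← ENNReal.ofReal_toReal hS]
    have : (2:ℝ≥0∞) = ENNReal.ofReal 2 := by simp
    rw [this, ENNReal.ofReal_rpow_of_pos (by norm_num), Real.rpow_intCast]
    exact ENNReal.ofReal_le_ofReal hL1
  have hL2' : S ≤ (2:ℝ≥0∞) ^ ((L:ℝ) + 1) := by
    rw [← ENNReal.ofReal_toReal hS]
    have : (2:ℝ≥0∞) = ENNReal.ofReal 2 := by simp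
    have e : (L:ℝ) + 1 = ((L + 1 : ℤ) : ℝ) := by push_cast; ring
    rw [e, this, ENNReal.ofReal_rpow_of_pos (by norm_num), Real.rpow_intCast]
    exact ENNReal.ofReal_le_ofReal hL2.le
  set b1 : ℤ → ℝ≥0∞ := fun l => if l ≤ L then b l else 0 with hb1
  set b0 : ℤ → ℝ≥0∞ := fun l => if l ≤ L then 0 else b l with hb0
  have hsplit : S = (∑' l : ℤ, (2:ℝ≥0∞) ^ (l:ℝ) * b1 l) + ∑' l : ℤ, (2:ℝ≥0∞) ^ (l:ℝ) * b0 l := by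
    rw [← ENNReal.tsum_add, hSdef]
    congr 1; ext l
    simp only [hb1, hb0]
    split_ifs <;> simp
  have K1 := H1 L b1 (fun l hl => by
    simp only [hb1] at hl
    split_ifs at hl with h
    · have : (l:ℝ) ≤ L := by exact_mod_cast h
      apply mul_nonneg <;> linarith
    · exact absurd rfl hl)
  have K0 := H0 L b0 (fun l hl => by
    simp only [hb0] at hl
    split_ifs at hl with h
    · exact absurd rfl hl
    · have : (L:ℝ) ≤ l := by push Not at h; exact_mod_cast h.le
      apply mul_nonneg_of_nonpos_of_nonpos <;> linarith)
  have R1 : ∑' l : ℤ, (2:ℝ≥0∞) ^ ((l:ℝ) * p) * b1 l ^ p1 ≤ R := by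
    refine ENNReal.tsum_le_tsum fun l => mul_le_mul' le_rfl ?_
    simp only [hb1]
    split_ifs
    · exact le_add_self
    · rw [ENNReal.zero_rpow_of_pos (by linarith)]; exact zero_le
  have R0 : ∑' l : ℤ, (2:ℝ≥0∞) ^ ((l:ℝ) * p) * b0 l ^ p0 ≤ R := by
    refine ENNReal.tsum_le_tsum fun l => mul_le_mul' le_rfl ?_
    simp only [hb0]
    split_ifs
    · rw [ENNReal.zero_rpow_of_pos (by linarith)]; exact zero_le
    · exact le_self_add
  set S1 := ∑' l : ℤ, (2:ℝ≥0∞) ^ (l:ℝ) * b1 l with hS1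
  set S0 := ∑' l : ℤ, (2:ℝ≥0∞) ^ (l:ℝ) * b0 l with hS0'
  rcases le_total S0 S1 with h | h
  · have a1 : S ≤ 2 * S1 := by rw [hsplit, two_mul]; gcongr
    have a2 : S ^ p1 ≤ 2 ^ p1 * (B1 * (2:ℝ≥0∞) ^ ((L:ℝ) * (p1 - p)) * R) := by
      calc _ ≤ (2 * S1) ^ p1 := ENNReal.rpow_le_rpow a1 (by linarith)
        _ = 2 ^ p1 * S1 ^ p1 := ENNReal.mul_rpow_of_nonneg _ _ (by linarith)
        _ ≤ _ := mul_le_mul' le_rfl (K1.trans (mul_le_mul' le_rfl R1))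
    have a3 : (2:ℝ≥0∞) ^ ((L:ℝ) * (p1 - p)) ≤ S ^ (p1 - p) := by
      rw [ENNReal.rpow_mul]; exact ENNReal.rpow_le_rpow hL1' (by linarith)
    have hc0 : S ^ (p1 - p) ≠ 0 := (ENNReal.rpow_pos (pos_iff_ne_zero.2 hS0) hS).ne'
    have hct : S ^ (p1 - p) ≠ ⊤ := ENNReal.rpow_ne_top_of_nonneg (by linarith) hS
    have a4 : S ^ (p1 - p) * S ^ p ≤ S ^ (p1 - p) * (2 ^ p1 * B1 * R) := by
      rw [← ENNReal.rpow_add _ _ hS0 hS, sub_add_cancel]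
      refine a2.trans ?_
      calc _ ≤ 2 ^ p1 * (B1 * S ^ (p1 - p) * R) := by gcongr
        _ = _ := by ring
    have a5 := (ENNReal.mul_le_mul_iff_right hc0 hct).1 a4
    exact a5.trans (mul_le_mul' le_add_self le_rfl)
  · have a1 : S ≤ 2 * S0 := by rw [hsplit, two_mul]; gcongr
    have a2 : S ^ p0 ≤ 2 ^ p0 * (B0 * (2:ℝ≥0∞) ^ ((L:ℝ) * (p0 - p)) * R) := by
      calc _ ≤ (2 * S0) ^ p0 := ENNReal.rpow_le_rpow a1 (by linarith)
        _ = 2 ^ p0 * S0 ^ p0 := ENNReal.mul_rpow_of_nonneg _ _ (by linarith)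
        _ ≤ _ := mul_le_mul' le_rfl (K0.trans (mul_le_mul' le_rfl R0))
    have a3 : S ^ (p - p0) ≤ (2:ℝ≥0∞) ^ ((L + 1 : ℝ) * (p - p0)) := by
      rw [ENNReal.rpow_mul]; exact ENNReal.rpow_le_rpow hL2' (by linarith)
    have a4 : S ^ p ≤ 2 ^ p0 * B0 * 2 ^ (p - p0) * R := by
      have e : S ^ p = S ^ p0 * S ^ (p - p0) := by
        rw [← ENNReal.rpow_add _ _ hS0 hS]; congr 1; ring
      rw [e]
      refine (mul_le_mul' a2 a3).trans (le_of_eq ?_)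
      have e2 : (2:ℝ≥0∞) ^ ((L:ℝ) * (p0 - p)) * (2:ℝ≥0∞) ^ ((L + 1 : ℝ) * (p - p0)) = 2 ^ (p - p0) := by
        rw [← two_rpow_add]; congr 1; ring
      rw [← e2]; ring
    exact a4.trans (mul_le_mul' le_self_add le_rfl)

lemma ptw (p0 p p1 : ℝ) (h0 : 1 < p0) (h1 : p0 < p) (h2 : p < p1) : ∃ C : ℝ≥0∞, C ≠ ⊤ ∧ ∀ b : ℤ → ℝ≥0∞, (∀ l, b l ≠ ⊤) →
    (∑' l : ℤ, (2:ℝ≥0∞) ^ (l:ℝ) * b l) ^ p ≤ C * ∑' l : ℤ, (2:ℝ≥0∞) ^ ((l:ℝ) * p) * (b l ^ p0 + b l ^ p1) := by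
  obtain ⟨C, hC, H⟩ := ptw_fin p0 p p1 h0 h1 h2
  refine ⟨C, hC, fun b hb => ?_⟩
  set X := C * ∑' l : ℤ, (2:ℝ≥0∞) ^ ((l:ℝ) * p) * (b l ^ p0 + b l ^ p1) with hX
  have hp0 : 0 < p := by linarith
  rw [← ENNReal.le_rpow_inv_iff hp0, ENNReal.tsum_eq_iSup_sum]
  refine iSup_le fun s => ?_
  rw [ENNReal.le_rpow_inv_iff hp0]
  set b' : ℤ → ℝ≥0∞ := fun l => if l ∈ s then b l else 0 with hb'
  have e : ∑ l ∈ s, (2:ℝ≥0∞) ^ (l:ℝ) * b l = ∑' l : ℤ, (2:ℝ≥0∞) ^ (l:ℝ) * b' l := by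
    rw [tsum_eq_sum (s := s)]
    · refine Finset.sum_congr rfl fun l hl => ?_
      simp [hb', hl]
    · intro l hl; simp [hb', hl]
  have hfin : ∑' l : ℤ, (2:ℝ≥0∞) ^ (l:ℝ) * b' l ≠ ⊤ := by
    rw [← e]
    exact (ENNReal.sum_lt_top.2 fun l _ => (ENNReal.mul_ne_top (two_rpow_ne _).2 (hb l)).lt_top).ne
  rw [e]
  refine (H b' hfin).trans (mul_le_mul' le_rfl (ENNReal.tsum_le_tsum fun l => mul_le_mul' le_rfl ?_))
  have : b' l ≤ b l := by simp only [hb']; split_ifs <;> simp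
  exact add_le_add (ENNReal.rpow_le_rpow this (by linarith)) (ENNReal.rpow_le_rpow this (by linarith))

/-- dyadic level sets -/
def Lev (d : ℕ) (G : Ed d × ℝ → ℝ) (l : ℤ) : Set (Ed d × ℝ) := {z | (2:ℝ) ^ (l - 1) < G z ∧ G z ≤ (2:ℝ) ^ l}

lemma Lev_disj (d : ℕ) (G : Ed d × ℝ → ℝ) : Pairwise (fun i j => Disjoint (Lev d G i) (Lev d G j)) := by
  have key : ∀ i j : ℤ, i < j → Disjoint (Lev d G i) (Lev d G j) := by
    intro i j hij
    rw [Set.disjoint_left]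
    intro z hz hz'
    have h1 := hz.2
    have h2 := hz'.1
    have : (2:ℝ) ^ i ≤ (2:ℝ) ^ (j - 1) := zpow_le_zpow_right₀ (by norm_num) (by omega)
    linarith
  intro i j hij
  rcases lt_or_gt_of_ne hij with h | h
  · exact key i j h
  · exact (key j i h).symm

lemma Sg_smul (d m : ℕ) (ε : ℝ) (c : ℂ) (g : Ed d × ℝ → ℂ) (y : Ed d) :
    Sg d m ε (fun z => c * g z) y = c * Sg d m ε g y := by
  rw [Sg, Sg, ← integral_const_mul]
  congr 1; ext z; ring

lemma two_rpow_ofReal (x : ℝ) : (2:ℝ≥0∞) ^ x = ENNReal.ofReal ((2:ℝ) ^ x) := by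
  have : (2:ℝ≥0∞) = ENNReal.ofReal 2 := by simp
  rw [this, ENNReal.ofReal_rpow_of_pos (by norm_num)]

lemma strong_k (d : ℕ) (hd : 4 ≤ d) (p0 p p1 : ℝ) (h0 : 1 < p0) (h1 : p0 < p) (h2 : p < p1) : ∃ C : ℝ≥0∞, C ≠ ⊤ ∧
    ∀ (k : ℕ) (G : Ed d × ℝ → ℝ) (_ : Measurable G) (_ : Integrable G (lam d))
    (g : Ed d × ℝ → ℂ) (_ : Measurable g) (_ : ∀ z, ‖g z‖ ≤ G z) (h : ℤ → Ed d × ℝ → ℂ)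
    (_ : ∀ l z, h l z = (2:ℂ) ^ (-l) * (Lev d G l).indicator g z),
    ENNReal.ofReal (ek k ^ (-(p * ((d + 1) / 2) - d) : ℝ)) * ∫⁻ y, ‖Sg d (mm d) (ek k) g y‖ₑ ^ p ≤
      C * ∑' l : ℤ, (2:ℝ≥0∞) ^ ((l:ℝ) * p) *
       (ENNReal.ofReal (ek k ^ (-(p0 * ((d + 1) / 2) - d) : ℝ)) * (∫⁻ y, ‖Sg d (mm d) (ek k) (h l) y‖ₑ ^ p0) +
        ENNReal.ofReal (ek k ^ (-(p1 * ((d + 1) / 2) - d) : ℝ)) * ∫⁻ y, ‖Sg d (mm d) (ek k) (h l) y‖ₑ ^ p1) := by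
  obtain ⟨C, hC, H⟩ := ptw p0 p p1 h0 h1 h2
  refine ⟨C, hC, ?_⟩
  intro k G hG hGi g hg hgG h hh
  have hek := ek_pos k
  have hgi : Integrable g (lam d) := hGi.mono' hg.aestronglyMeasurable (Filter.Eventually.of_forall hgG)
  have hLm : ∀ l, MeasurableSet (Lev d G l) := fun l =>
    (measurableSet_lt measurable_const hG).inter (measurableSet_le hG measurable_const)
  have hhm : ∀ l, Measurable (h l) := fun l => by
    have : h l = fun z => (2:ℂ) ^ (-l) * (Lev d G l).indicator g z := funext (hh l)
    rw [this]; exact (hg.indicator (hLm l)).const_mul _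
  set X : ℝ≥0∞ := ENNReal.ofReal (ek k ^ (-((d + 1) / 2) : ℝ)) with hX
  have hXr : ∀ r : ℝ, ENNReal.ofReal (ek k ^ (d:ℝ)) * X ^ r = ENNReal.ofReal (ek k ^ (-(r * ((d + 1) / 2) - d) : ℝ)) := by
    intro r
    rw [hX, ENNReal.ofReal_rpow_of_pos (by positivity), ← ENNReal.ofReal_mul (by positivity), ← Real.rpow_mul hek.le, ← Real.rpow_add hek]
    congr 2; ring
  have hbd : ∀ y, (X * ‖Sg d (mm d) (ek k) g y‖ₑ) ^ p ≤
      C * ∑' l : ℤ, (2:ℝ≥0∞) ^ ((l:ℝ) * p) * ((X * ‖Sg d (mm d) (ek k) (h l) y‖ₑ) ^ p0 + (X * ‖Sg d (mm d) (ek k) (h l) y‖ₑ) ^ p1) := by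
    intro y
    refine le_trans ?_ (H _ (fun l => ENNReal.mul_ne_top ENNReal.ofReal_ne_top enorm_ne_top))
    apply ENNReal.rpow_le_rpow _ (by linarith)
    have hz : ∀ᵐ z ∂(lam d), z ∉ ⋃ l, Lev d G l → g z = 0 := by
      refine Filter.Eventually.of_forall fun z hz => ?_
      by_contra hne
      have hpos : 0 < G z := (norm_pos_iff.2 hne).trans_le (hgG z)
      obtain ⟨n, hn⟩ := exists_mem_Ioc_zpow hpos (by norm_num : (1:ℝ) < 2)
      exact hz (mem_iUnion.2 ⟨n + 1, by simpa [Lev] using hn⟩)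
    have := enorm_Sg_le_tsum d (mm d) (by omega) hek g hgi (Lev d G) hLm (Lev_disj d G) hz y
    calc _ ≤ X * ∑' l, ‖Sg d (mm d) (ek k) ((Lev d G l).indicator g) y‖ₑ := by gcongr
      _ = _ := by
        rw [← ENNReal.tsum_mul_left]
        congr 1; ext l
        rw [mul_left_comm]
        congr 1
        have e : (Lev d G l).indicator g = fun z => (2:ℂ) ^ l * h l z := by
          ext z
          rw [hh, ← mul_assoc, ← zpow_add₀ (by norm_num)]; simp
        rw [e, Sg_smul, enorm_mul]
        congr 1
        rw [← ofReal_norm, norm_zpow, two_rpow_ofReal, Real.rpow_intCast]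
        simp
  have hm : ∀ l, Measurable (fun y => ‖Sg d (mm d) (ek k) (h l) y‖ₑ) := fun l => (measurable_Sg d (mm d) hek (hhm l)).enorm
  have hXt : X ≠ ⊤ := ENNReal.ofReal_ne_top
  have hXpt : ∀ r : ℝ, 0 ≤ r → X ^ r ≠ ⊤ := fun r hr => ENNReal.rpow_ne_top_of_nonneg hr hXt
  have eint : ∀ (r : ℝ) (hr : 0 ≤ r) (u : Ed d → ℂ), ∫⁻ y, (X * ‖u y‖ₑ) ^ r = X ^ r * ∫⁻ y, ‖u y‖ₑ ^ r := by
    intro r hr u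
    rw [← lintegral_const_mul' _ _ (hXpt r hr)]
    congr 1; ext y; rw [ENNReal.mul_rpow_of_nonneg _ _ hr]
  calc _ = ENNReal.ofReal (ek k ^ (d:ℝ)) * ∫⁻ y, (X * ‖Sg d (mm d) (ek k) g y‖ₑ) ^ p := by
        rw [← hXr, mul_assoc, eint p (by linarith)]
    _ ≤ ENNReal.ofReal (ek k ^ (d:ℝ)) * ∫⁻ y, C * ∑' l : ℤ, (2:ℝ≥0∞) ^ ((l:ℝ) * p) * ((X * ‖Sg d (mm d) (ek k) (h l) y‖ₑ) ^ p0 + (X * ‖Sg d (mm d) (ek k) (h l) y‖ₑ) ^ p1) :=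
        mul_le_mul' le_rfl (lintegral_mono hbd)
    _ = _ := by
        rw [lintegral_const_mul' _ _ hC, lintegral_tsum, mul_left_comm, ← ENNReal.tsum_mul_left]
        · congr 2; ext l
          rw [lintegral_const_mul' _ _ (two_rpow_ne _).2, lintegral_add_left (((hm l).const_mul X).pow_const p0),
            eint p0 (by linarith), eint p1 (by linarith), ← hXr, ← hXr]
          ring
        · intro l
          exact ((((hm l).const_mul X).pow_const p0).add (((hm l).const_mul X).pow_const p1)).const_mul _ |>.aemeasurable

lemma strong (d : ℕ) (hd : 4 ≤ d) (p : ℝ) (hp1 : 1 < p) (hp2 : p * (d + 1) < 2 * (d - 1)) :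
    ∃ C : ℝ≥0∞, C ≠ ⊤ ∧ ∀ (G : Ed d × ℝ → ℝ) (_ : Measurable G) (_ : Integrable G (lam d)) (_ : ∀ z, z.2 ∉ Icc (1:ℝ) 2 → G z = 0)
    (g : ℕ → Ed d × ℝ → ℂ) (_ : ∀ k, Measurable (g k)) (_ : ∀ k z, ‖g k z‖ ≤ G z),
    ∑' k, ENNReal.ofReal (ek k ^ (-(p * ((d + 1) / 2) - d) : ℝ)) * ∫⁻ y, ‖Sg d (mm d) (ek k) (g k) y‖ₑ ^ p ≤
      C * ∫⁻ z, ENNReal.ofReal (G z) ^ p ∂(lam d) := by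
  have hd4 : (4:ℝ) ≤ d := by exact_mod_cast hd
  set p0 := (1 + p) / 2 with hp0
  set p1 := (p + 2 * (d - 1) / (d + 1)) / 2 with hp1'
  have hq : p < 2 * (d - 1) / (d + 1) := by rw [lt_div_iff₀ (by linarith)]; exact hp2
  have hq1 : p1 < 2 * (d - 1) / (d + 1) := by rw [hp1']; linarith
  rw [lt_div_iff₀ (by linarith)] at hq1
  have i1 : 1 < p0 := by rw [hp0]; linarith
  have i2 : p0 < p := by rw [hp0]; linarith
  have i3 : p < p1 := by rw [hp1']; linarith
  have i4 : p0 * (d + 1) < 2 * (d - 1) := lt_trans (mul_lt_mul_of_pos_right i2 (by linarith)) hp2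
  obtain ⟨C, hC, H⟩ := strong_k d hd p0 p p1 i1 i2 i3
  obtain ⟨C0, hC0, H0⟩ := restricted d hd p0 i1 i4
  obtain ⟨C1, hC1, H1⟩ := restricted d hd p1 (by linarith) hq1
  refine ⟨C * (2 ^ p * (ENNReal.ofReal C0 + ENNReal.ofReal C1)), by finiteness, ?_⟩
  intro G hG hGi hGI g hg hgG
  have hG0 : ∀ z, 0 ≤ G z := fun z => (norm_nonneg _).trans (hgG 0 z)
  have hLm : ∀ l, MeasurableSet (Lev d G l) := fun l =>
    (measurableSet_lt measurable_const hG).inter (measurableSet_le hG measurable_const)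
  have hpos : ∀ l : ℤ, (0:ℝ) < 2 ^ l := fun l => by positivity
  have hLI : ∀ l, ∀ z ∈ Lev d G l, z.2 ∈ Icc (1:ℝ) 2 := by
    intro l z hz
    by_contra hne
    have := hz.1
    rw [hGI z hne] at this
    linarith [hpos (l - 1)]
  have hLfin : ∀ l, lam d (Lev d G l) ≠ ⊤ := by
    intro l
    have := hGi.measure_gt_lt_top (hpos (l - 1))
    exact ((measure_mono (fun z hz => hz.1)).trans_lt this).ne
  set h : ℕ → ℤ → Ed d × ℝ → ℂ := fun k l z => (2:ℂ) ^ (-l) * (Lev d G l).indicator (g k) z with hh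
  have hhm : ∀ k l, Measurable (h k l) := fun k l => ((hg k).indicator (hLm l)).const_mul _
  have hh1 : ∀ k l z, ‖h k l z‖ ≤ 1 := by
    intro k l z
    simp only [hh]
    by_cases hz : z ∈ Lev d G l
    · rw [indicator_of_mem hz, norm_mul, norm_zpow]
      have := (hgG k z).trans hz.2
      calc _ ≤ ‖(2:ℂ)‖ ^ (-l) * (2:ℝ) ^ l := by gcongr
        _ = 1 := by rw [zpow_neg, Complex.norm_ofNat]; exact inv_mul_cancel₀ (hpos l).ne'
    · rw [indicator_of_notMem hz]; simp
  have hh0 : ∀ k l z, z ∉ Lev d G l → h k l z = 0 := by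
    intro k l z hz
    simp only [hh]; rw [indicator_of_notMem hz]; simp
  have R0 := fun l => H0 (Lev d G l) (hLm l) (hLfin l) (hLI l) (fun k => h k l) (fun k => hhm k l) (fun k => hh1 k l) (fun k => hh0 k l)
  have R1 := fun l => H1 (Lev d G l) (hLm l) (hLfin l) (hLI l) (fun k => h k l) (fun k => hhm k l) (fun k => hh1 k l) (fun k => hh0 k l)
  calc _ ≤ ∑' k, C * ∑' l : ℤ, (2:ℝ≥0∞) ^ ((l:ℝ) * p) *
       (ENNReal.ofReal (ek k ^ (-(p0 * ((d + 1) / 2) - d) : ℝ)) * (∫⁻ y, ‖Sg d (mm d) (ek k) (h k l) y‖ₑ ^ p0) +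
        ENNReal.ofReal (ek k ^ (-(p1 * ((d + 1) / 2) - d) : ℝ)) * ∫⁻ y, ‖Sg d (mm d) (ek k) (h k l) y‖ₑ ^ p1) :=
        ENNReal.tsum_le_tsum fun k => H k G hG hGi (g k) (hg k) (hgG k) (h k) (fun l z => rfl)
    _ = C * ∑' l : ℤ, (2:ℝ≥0∞) ^ ((l:ℝ) * p) *
       ((∑' k, ENNReal.ofReal (ek k ^ (-(p0 * ((d + 1) / 2) - d) : ℝ)) * (∫⁻ y, ‖Sg d (mm d) (ek k) (h k l) y‖ₑ ^ p0)) +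
        ∑' k, ENNReal.ofReal (ek k ^ (-(p1 * ((d + 1) / 2) - d) : ℝ)) * ∫⁻ y, ‖Sg d (mm d) (ek k) (h k l) y‖ₑ ^ p1) := by
        rw [ENNReal.tsum_mul_left, ENNReal.tsum_comm]
        simp only [ENNReal.tsum_mul_left, ENNReal.tsum_add]
    _ ≤ C * ∑' l : ℤ, (2:ℝ≥0∞) ^ ((l:ℝ) * p) * (ENNReal.ofReal C0 * lam d (Lev d G l) + ENNReal.ofReal C1 * lam d (Lev d G l)) := by
        refine mul_le_mul' le_rfl (ENNReal.tsum_le_tsum fun l => mul_le_mul' le_rfl (add_le_add (R0 l) (R1 l)))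
    _ ≤ C * ∑' l : ℤ, (2 ^ p * (ENNReal.ofReal C0 + ENNReal.ofReal C1)) * ∫⁻ z in Lev d G l, ENNReal.ofReal (G z) ^ p ∂(lam d) := by
        refine mul_le_mul' le_rfl (ENNReal.tsum_le_tsum fun l => ?_)
        have : (2:ℝ≥0∞) ^ (((l:ℝ) - 1) * p) * lam d (Lev d G l) ≤ ∫⁻ z in Lev d G l, ENNReal.ofReal (G z) ^ p ∂(lam d) := by
          rw [← setLIntegral_const]
          refine setLIntegral_mono' (hLm l) fun z hz => ?_
          rw [ENNReal.rpow_mul]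
          refine ENNReal.rpow_le_rpow ?_ (by linarith)
          rw [two_rpow_ofReal]
          apply ENNReal.ofReal_le_ofReal
          have e : (l:ℝ) - 1 = ((l - 1 : ℤ) : ℝ) := by push_cast; ring
          rw [e, Real.rpow_intCast]
          exact hz.1.le
        have e : (2:ℝ≥0∞) ^ ((l:ℝ) * p) = 2 ^ p * 2 ^ (((l:ℝ) - 1) * p) := by
          rw [← two_rpow_add]; congr 1; ring
        calc _ = (2 ^ p * (ENNReal.ofReal C0 + ENNReal.ofReal C1)) * ((2:ℝ≥0∞) ^ (((l:ℝ) - 1) * p) * lam d (Lev d G l)) := by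
              rw [e]; ring
          _ ≤ _ := by gcongr
    _ ≤ _ := by
        rw [ENNReal.tsum_mul_left, ← mul_assoc, ← lintegral_iUnion hLm (Lev_disj d G)]
        exact mul_le_mul' le_rfl (setLIntegral_le_lintegral _ _)

/-- the forward operator -/
def Tg (d m : ℕ) (ε : ℝ) (h : Ed d → ℂ) (z : Ed d × ℝ) : ℂ := ∫ y, Kk d m ε z.2 (z.1 - y) * h y

lemma measurable_Kker' (d m : ℕ) {ε : ℝ} (h1 : 0 < ε) :
    Measurable (fun q : (Ed d × ℝ) × Ed d => Kk d m ε q.1.2 (q.1.1 - q.2)) :=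
  (continuous_Kk_joint d m h1).measurable.comp
    (Measurable.prodMk (measurable_snd.comp measurable_fst) ((measurable_fst.comp measurable_fst).sub measurable_snd))

lemma measurable_Tg (d m : ℕ) {ε : ℝ} (h1 : 0 < ε) {h : Ed d → ℂ} (hh : Measurable h) : Measurable (Tg d m ε h) := by
  have hm : Measurable (fun q : (Ed d × ℝ) × Ed d => Kk d m ε q.1.2 (q.1.1 - q.2) * h q.2) :=
    (measurable_Kker' d m h1).mul (hh.comp measurable_snd)
  have := StronglyMeasurable.integral_prod_right (ν := (volume : Measure (Ed d)))
    (f := fun (z : Ed d × ℝ) (y : Ed d) => Kk d m ε z.2 (z.1 - y) * h y) hm.stronglyMeasurable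
  exact this.measurable

lemma dual_integrable (d m : ℕ) (hd : 2 ≤ d) (hm : 1 ≤ m) {ε : ℝ} (h1 : 0 < ε) (h2 : ε ≤ 1) {h : Ed d → ℂ} (hh : Measurable h) {H : ℝ}
    (hH : ∀ y, ‖h y‖ ≤ H) {g : Ed d × ℝ → ℂ} (hg : Measurable g) (hgi : Integrable g (lam d)) (hgI : ∀ z, z.2 ∉ Icc (1:ℝ) 2 → g z = 0) :
    Integrable (fun q : (Ed d × ℝ) × Ed d => Kk d m ε q.1.2 (q.1.1 - q.2) * g q.1 * h q.2) ((lam d).prod volume) := by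
  have hmeas : Measurable (fun q : (Ed d × ℝ) × Ed d => Kk d m ε q.1.2 (q.1.1 - q.2) * g q.1 * h q.2) :=
    ((measurable_Kker' d m h1).mul (hg.comp measurable_fst)).mul (hh.comp measurable_snd)
  refine ⟨hmeas.aestronglyMeasurable, ?_⟩
  obtain ⟨C, hC, HC⟩ := Kk_tail' d m hd hm
  rw [hasFiniteIntegral_iff_enorm, lintegral_prod _ hmeas.enorm.aemeasurable]
  have hb : ∀ z, ∫⁻ y, ‖Kk d m ε z.2 (z.1 - y) * g z * h y‖ₑ ≤ ENNReal.ofReal (C * ε ^ (1 - (d + 1 : ℝ) / 2)) * ENNReal.ofReal H * ‖g z‖ₑ := by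
    intro z
    by_cases hz : z.2 ∈ Icc (1:ℝ) 2
    · have k := HC ε z.2 0 h1 h2 hz.1 hz.2 le_rfl z.1 univ (fun y _ => abs_nonneg _)
      simp only [zero_div, add_zero, Real.one_rpow, mul_one, Measure.restrict_univ] at k
      calc _ ≤ ∫⁻ y, ‖Kk d m ε z.2 (z.1 - y)‖ₑ * (‖g z‖ₑ * ENNReal.ofReal H) := by
            refine lintegral_mono fun y => ?_
            rw [enorm_mul, enorm_mul, mul_assoc]
            gcongr
            rw [← ofReal_norm]
            exact ENNReal.ofReal_le_ofReal (hH y)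
        _ = (∫⁻ y, ‖Kk d m ε z.2 (z.1 - y)‖ₑ) * (‖g z‖ₑ * ENNReal.ofReal H) :=
            lintegral_mul_const' _ _ (ENNReal.mul_ne_top enorm_ne_top ENNReal.ofReal_ne_top)
        _ ≤ ENNReal.ofReal (C * ε ^ (1 - (d + 1 : ℝ) / 2)) * (‖g z‖ₑ * ENNReal.ofReal H) := by gcongr
        _ = _ := by ring
    · simp [hgI z hz]
  refine (lintegral_mono hb).trans_lt ?_
  rw [lintegral_const_mul' _ _ (ENNReal.mul_ne_top ENNReal.ofReal_ne_top ENNReal.ofReal_ne_top)]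
  exact ENNReal.mul_lt_top (ENNReal.mul_lt_top ENNReal.ofReal_lt_top ENNReal.ofReal_lt_top) hgi.2

lemma dual_pair (d m : ℕ) (hd : 2 ≤ d) (hm : 1 ≤ m) {ε : ℝ} (h1 : 0 < ε) (h2 : ε ≤ 1) {h : Ed d → ℂ} (hh : Measurable h) {H : ℝ}
    (hH : ∀ y, ‖h y‖ ≤ H) {g : Ed d × ℝ → ℂ} (hg : Measurable g) (hgi : Integrable g (lam d)) (hgI : ∀ z, z.2 ∉ Icc (1:ℝ) 2 → g z = 0) :
    ∫ z, g z * Tg d m ε h z ∂(lam d) = ∫ y, h y * Sg d m ε g y := by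
  have hint := dual_integrable d m hd hm h1 h2 hh hH hg hgi hgI
  have sw := integral_integral_swap (f := fun (z : Ed d × ℝ) (y : Ed d) => Kk d m ε z.2 (z.1 - y) * g z * h y) hint
  have e1 : ∀ z, g z * Tg d m ε h z = ∫ y, Kk d m ε z.2 (z.1 - y) * g z * h y := by
    intro z
    rw [Tg, ← integral_const_mul]
    congr 1; ext y; ring
  have e2 : ∀ y, h y * Sg d m ε g y = ∫ z, Kk d m ε z.2 (z.1 - y) * g z * h y ∂(lam d) := by
    intro y
    rw [Sg, ← integral_const_mul]
    congr 1; ext z; ring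
  simp only [e1, e2]
  exact sw

/-- phase -/
def ph (w : ℂ) : ℂ := (starRingEnd ℂ w) / ‖w‖

lemma ph_mul (w : ℂ) : ph w * w = ‖w‖ := by
  unfold ph
  by_cases h : w = 0
  · simp [h]
  · have : (‖w‖ : ℂ) ≠ 0 := by simpa using h
    rw [div_mul_eq_mul_div, div_eq_iff this, mul_comm, Complex.mul_conj']; ring

lemma norm_ph (w : ℂ) : ‖ph w‖ ≤ 1 := by
  unfold ph
  by_cases h : w = 0
  · simp [h]
  · rw [norm_div]; simp [h]

lemma measurable_ph : Measurable ph := by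
  unfold ph
  exact (Complex.continuous_conj.measurable).div (Complex.measurable_ofReal.comp measurable_norm)

lemma dual_k (d m : ℕ) (hd : 2 ≤ d) (hm : 1 ≤ m) {ε : ℝ} (h1 : 0 < ε) (h2 : ε ≤ 1) {h : Ed d → ℂ} (hh : Measurable h) {H : ℝ}
    (hH : ∀ y, ‖h y‖ ≤ H) {G : Ed d × ℝ → ℝ} (hG : Measurable G) (hG0 : ∀ z, 0 ≤ G z) (hGi : Integrable G (lam d))
    (hGI : ∀ z, z.2 ∉ Icc (1:ℝ) 2 → G z = 0) {q p : ℝ} (hpq : q.HolderConjugate p) :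
    ∫⁻ z, ENNReal.ofReal (G z) * ‖Tg d m ε h z‖ₑ ∂(lam d) ≤
     (∫⁻ y, ‖h y‖ₑ ^ q) ^ (1 / q) * (∫⁻ y, ‖Sg d m ε (fun z => G z * ph (Tg d m ε h z)) y‖ₑ ^ p) ^ (1 / p) := by
  have hT := measurable_Tg d m h1 hh
  set g : Ed d × ℝ → ℂ := fun z => G z * ph (Tg d m ε h z) with hgdef
  have hg : Measurable g := (Complex.measurable_ofReal.comp hG).mul (measurable_ph.comp hT)
  have hgn : ∀ z, ‖g z‖ ≤ G z := by
    intro z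
    simp only [hgdef, norm_mul, Complex.norm_real, Real.norm_eq_abs, abs_of_nonneg (hG0 z)]
    exact mul_le_of_le_one_right (hG0 z) (norm_ph _)
  have hgi : Integrable g (lam d) := hGi.mono' hg.aestronglyMeasurable (Filter.Eventually.of_forall hgn)
  have hgI : ∀ z, z.2 ∉ Icc (1:ℝ) 2 → g z = 0 := fun z hz => by simp [hgdef, hGI z hz]
  have hint := dual_integrable d m hd hm h1 h2 hh hH hg hgi hgI
  have pair := dual_pair d m hd hm h1 h2 hh hH hg hgi hgI
  have e : ∀ z, g z * Tg d m ε h z = ((G z * ‖Tg d m ε h z‖ : ℝ) : ℂ) := by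
    intro z; simp only [hgdef]; rw [mul_assoc, ph_mul]; push_cast; rfl
  have hprod : Integrable (fun z => G z * ‖Tg d m ε h z‖) (lam d) := by
    have := hint.integral_prod_left
    have h' := this.norm
    refine h'.congr (Filter.Eventually.of_forall fun z => ?_)
    have e1 : g z * Tg d m ε h z = ∫ y, Kk d m ε z.2 (z.1 - y) * g z * h y := by
      rw [Tg, ← integral_const_mul]
      congr 1; ext y; ring
    simp only
    rw [← e1, e, Complex.norm_real, Real.norm_eq_abs, abs_of_nonneg (mul_nonneg (hG0 z) (norm_nonneg _))]
  have L : ∫⁻ z, ENNReal.ofReal (G z) * ‖Tg d m ε h z‖ₑ ∂(lam d) = ‖∫ z, g z * Tg d m ε h z ∂(lam d)‖ₑ := by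
    simp only [e]
    rw [integral_complex_ofReal, ← ofReal_norm, Complex.norm_real, Real.norm_eq_abs,
      abs_of_nonneg (integral_nonneg fun z => mul_nonneg (hG0 z) (norm_nonneg _)),
      ofReal_integral_eq_lintegral_ofReal hprod (Filter.Eventually.of_forall fun z => mul_nonneg (hG0 z) (norm_nonneg _))]
    congr 1; ext z
    rw [ENNReal.ofReal_mul (hG0 z), ofReal_norm]
  rw [L, pair]
  refine (enorm_integral_le_lintegral_enorm _).trans ?_
  simp only [enorm_mul]
  exact ENNReal.lintegral_mul_le_Lp_mul_Lq volume hpq hh.enorm.aemeasurable (measurable_Sg d m h1 hg).enorm.aemeasurable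

lemma self_improve {I A C : ℝ≥0∞} {q p : ℝ} (hpq : q.HolderConjugate p) (hI : I ≠ ⊤) (h : I ≤ A ^ (1 / q) * (C * I) ^ (1 / p)) :
    I ≤ A * C ^ (q / p) := by
  have hq := hpq.pos
  have hp := hpq.symm.pos
  by_cases h0 : I = 0
  · rw [h0]; exact zero_le
  have e : 1 / q + 1 / p = 1 := by simpa using hpq.inv_add_inv_eq_one
  have e1 : I = I ^ (1 / q) * I ^ (1 / p) := by
    rw [← ENNReal.rpow_add _ _ h0 hI, e, ENNReal.rpow_one]
  have hc0 : I ^ (1 / p) ≠ 0 := (ENNReal.rpow_pos (pos_iff_ne_zero.2 h0) hI).ne'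
  have hct : I ^ (1 / p) ≠ ⊤ := ENNReal.rpow_ne_top_of_nonneg (by positivity) hI
  have h2 : I ^ (1 / p) * I ^ (1 / q) ≤ I ^ (1 / p) * (A ^ (1 / q) * C ^ (1 / p)) := by
    calc _ = I := by rw [mul_comm, ← e1]
      _ ≤ _ := h
      _ = _ := by rw [ENNReal.mul_rpow_of_nonneg _ _ (by positivity)]; ring
  have h3 := (ENNReal.mul_le_mul_iff_right hc0 hct).1 h2
  have h4 := ENNReal.rpow_le_rpow h3 hq.le
  rw [← ENNReal.rpow_mul, one_div_mul_cancel hq.ne', ENNReal.rpow_one, ENNReal.mul_rpow_of_nonneg _ _ hq.le, ← ENNReal.rpow_mul,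
    ← ENNReal.rpow_mul, one_div_mul_cancel hq.ne', ENNReal.rpow_one] at h4
  refine h4.trans (le_of_eq ?_)
  congr 2; ring

lemma sum_weights {q p a b : ℝ} (hpq : q.HolderConjugate p) (N : ℕ) (A B : ℕ → ℝ≥0∞) (α : ℝ)
   (ha : a = -α * q) (hb : b = α * p) :
    ∑ k ∈ Finset.range N, A k ^ (1 / q) * B k ^ (1 / p) ≤
      (∑' k, ENNReal.ofReal (ek k ^ a) * A k) ^ (1 / q) * (∑' k, ENNReal.ofReal (ek k ^ b) * B k) ^ (1 / p) := by
  have hq := hpq.pos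
  have hp := hpq.symm.pos
  have e : ∀ k, A k ^ (1 / q) * B k ^ (1 / p) =
    (ENNReal.ofReal (ek k ^ a) * A k) ^ (1 / q) * (ENNReal.ofReal (ek k ^ b) * B k) ^ (1 / p) := by
    intro k
    have hk := ek_pos k
    rw [ENNReal.mul_rpow_of_nonneg _ _ (by positivity), ENNReal.mul_rpow_of_nonneg _ _ (by positivity),
      ENNReal.ofReal_rpow_of_nonneg (by positivity) (by positivity),
      ENNReal.ofReal_rpow_of_nonneg (by positivity) (by positivity), ← Real.rpow_mul hk.le, ← Real.rpow_mul hk.le]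
    have e1 : a * (1 / q) = -α := by rw [ha]; field_simp
    have e2 : b * (1 / p) = α := by rw [hb]; field_simp
    rw [e1, e2]
    have e3 : ENNReal.ofReal (ek k ^ (-α)) * ENNReal.ofReal (ek k ^ α) = 1 := by
      rw [← ENNReal.ofReal_mul (by positivity), ← Real.rpow_add hk]; simp
    calc _ = (ENNReal.ofReal (ek k ^ (-α)) * ENNReal.ofReal (ek k ^ α)) * (A k ^ (1 / q) * B k ^ (1 / p)) := by rw [e3, one_mul]
      _ = _ := by ring
  simp only [e]
  refine (ENNReal.inner_le_Lp_mul_Lq (Finset.range N) _ _ hpq).trans ?_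
  have r : ∀ x : ℝ≥0∞, (x ^ (1 / q)) ^ q = x := fun x => by rw [← ENNReal.rpow_mul, one_div_mul_cancel hq.ne', ENNReal.rpow_one]
  have r' : ∀ x : ℝ≥0∞, (x ^ (1 / p)) ^ p = x := fun x => by rw [← ENNReal.rpow_mul, one_div_mul_cancel hp.ne', ENNReal.rpow_one]
  simp only [r, r']
  gcongr
  · exact ENNReal.sum_le_tsum _
  · exact ENNReal.sum_le_tsum _

lemma dual_fin (d : ℕ) (hd : 4 ≤ d) {q p : ℝ} (hpq : q.HolderConjugate p) (C : ℝ≥0∞)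
    (HC : ∀ (G : Ed d × ℝ → ℝ) (_ : Measurable G) (_ : Integrable G (lam d)) (_ : ∀ z, z.2 ∉ Icc (1:ℝ) 2 → G z = 0)
    (g : ℕ → Ed d × ℝ → ℂ) (_ : ∀ k, Measurable (g k)) (_ : ∀ k z, ‖g k z‖ ≤ G z),
    ∑' k, ENNReal.ofReal (ek k ^ (-(p * ((d + 1) / 2) - d) : ℝ)) * ∫⁻ y, ‖Sg d (mm d) (ek k) (g k) y‖ₑ ^ p ≤
      C * ∫⁻ z, ENNReal.ofReal (G z) ^ p ∂(lam d))
    (h : ℕ → Ed d → ℂ) (hh : ∀ k, Measurable (h k)) (H : ℕ → ℝ) (hH : ∀ k y, ‖h k y‖ ≤ H k) (N : ℕ) (M : ℝ)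
    (F : Ed d × ℝ → ℝ) (hF : ∀ z, F z = ∑ k ∈ Finset.range N, ‖Tg d (mm d) (ek k) (h k) z‖) :
    ∫⁻ z in {z : Ed d × ℝ | z.1 ∈ closedBall 0 M ∧ z.2 ∈ Icc (1:ℝ) 2 ∧ F z ≤ M}, ENNReal.ofReal (F z) ^ q ∂(lam d) ≤
      (∑' k, ENNReal.ofReal (ek k ^ (-((d:ℝ) * (1 / 2 - 1 / q) - 1 / 2) * q)) * ∫⁻ y, ‖h k y‖ₑ ^ q) * C ^ (q / p) := by
  have hq := hpq.pos
  have hp := hpq.symm.pos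
  have hq1 := hpq.lt
  have hTm : ∀ k, Measurable (Tg d (mm d) (ek k) (h k)) := fun k => measurable_Tg d _ (ek_pos k) (hh k)
  have hF0 : ∀ z, 0 ≤ F z := fun z => by rw [hF]; positivity
  have hFm : Measurable F := by
    have : F = fun z => ∑ k ∈ Finset.range N, ‖Tg d (mm d) (ek k) (h k) z‖ := funext hF
    rw [this]
    exact Finset.measurable_sum _ fun k _ => (hTm k).norm
  set B := {z : Ed d × ℝ | z.1 ∈ closedBall 0 M ∧ z.2 ∈ Icc (1:ℝ) 2 ∧ F z ≤ M} with hB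
  have hBm : MeasurableSet B :=
    (measurable_fst measurableSet_closedBall).inter ((measurable_snd measurableSet_Icc).inter (measurableSet_le hFm measurable_const))
  have hBf : lam d B < ⊤ := by
    have : B ⊆ (closedBall (0 : Ed d) M) ×ˢ univ := fun z hz => ⟨hz.1, mem_univ _⟩
    refine (measure_mono this).trans_lt ?_
    rw [Measure.prod_prod]
    refine ENNReal.mul_lt_top measure_closedBall_lt_top ?_
    simp
  set G : Ed d × ℝ → ℝ := B.indicator (fun z => F z ^ (q - 1)) with hGdef
  have hGm : Measurable G := (hFm.pow_const (q - 1)).indicator hBm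
  have hG0 : ∀ z, 0 ≤ G z := fun z => indicator_nonneg (fun z _ => by have := hF0 z; positivity) z
  have hGi : Integrable G (lam d) := by
    rw [hGdef, integrable_indicator_iff hBm]
    refine Measure.integrableOn_of_bounded (M := M ^ (q - 1)) hBf.ne (hFm.pow_const (q - 1)).aestronglyMeasurable ?_
    rw [ae_restrict_iff' hBm]
    refine Filter.Eventually.of_forall fun z hz => ?_
    rw [Real.norm_of_nonneg (by have := hF0 z; positivity)]
    exact Real.rpow_le_rpow (hF0 z) hz.2.2 (by linarith)
  have hGI : ∀ z, z.2 ∉ Icc (1:ℝ) 2 → G z = 0 := fun z hz => indicator_of_notMem (fun h' => hz h'.2.1) _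
  have eG : ∀ z, ENNReal.ofReal (G z) ^ p = B.indicator (fun z => ENNReal.ofReal (F z) ^ q) z := by
    intro z
    by_cases hz : z ∈ B
    · rw [hGdef, indicator_of_mem hz, indicator_of_mem hz, ← ENNReal.ofReal_rpow_of_nonneg (hF0 z) (by linarith), ← ENNReal.rpow_mul,
        hpq.sub_one_mul_conj]
    · rw [hGdef, indicator_of_notMem hz, indicator_of_notMem hz]; simp [hp]
  have eS : ∀ z, ∑ k ∈ Finset.range N, ENNReal.ofReal (G z) * ‖Tg d (mm d) (ek k) (h k) z‖ₑ = B.indicator (fun z => ENNReal.ofReal (F z) ^ q) z := by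
    intro z
    rw [← Finset.mul_sum]
    have : ∑ k ∈ Finset.range N, ‖Tg d (mm d) (ek k) (h k) z‖ₑ = ENNReal.ofReal (F z) := by
      rw [hF, ENNReal.ofReal_sum_of_nonneg (fun _ _ => norm_nonneg _)]
      simp only [ofReal_norm]
    rw [this]
    by_cases hz : z ∈ B
    · rw [hGdef, indicator_of_mem hz, indicator_of_mem hz, ENNReal.ofReal_rpow_of_nonneg (hF0 z) hq.le, ← ENNReal.ofReal_mul (by have := hF0 z; positivity)]
      congr 1
      rcases (hF0 z).eq_or_lt with h0 | h0
      · rw [← h0, mul_zero, Real.zero_rpow hq.ne']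
      · nth_rewrite 2 [← Real.rpow_one (F z)]
        rw [← Real.rpow_add h0]; congr 1; ring
    · rw [hGdef, indicator_of_notMem hz, indicator_of_notMem hz]; simp
  have eI : ∫⁻ z in B, ENNReal.ofReal (F z) ^ q ∂(lam d) = ∫⁻ z, ENNReal.ofReal (G z) ^ p ∂(lam d) := by
    rw [← lintegral_indicator hBm]; simp only [eG]
  refine self_improve hpq ?_ ?_
  · refine ((setLIntegral_mono (g := fun _ => ENNReal.ofReal M ^ q) measurable_const fun z hz => ?_).trans_lt ?_).ne
    · exact ENNReal.rpow_le_rpow (ENNReal.ofReal_le_ofReal hz.2.2) hq.le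
    · rw [setLIntegral_const]
      exact ENNReal.mul_lt_top (ENNReal.rpow_lt_top_of_nonneg hq.le ENNReal.ofReal_ne_top) hBf
  have key : ∫⁻ z in B, ENNReal.ofReal (F z) ^ q ∂(lam d) = ∑ k ∈ Finset.range N, ∫⁻ z, ENNReal.ofReal (G z) * ‖Tg d (mm d) (ek k) (h k) z‖ₑ ∂(lam d) := by
    rw [← lintegral_indicator hBm, ← lintegral_finsetSum]
    · simp only [eS]
    · intro k _
      exact (ENNReal.measurable_ofReal.comp hGm).mul (hTm k).enorm
  have H1 := HC G hGm hGi hGI (fun k z => G z * ph (Tg d (mm d) (ek k) (h k) z))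
    (fun k => (Complex.measurable_ofReal.comp hGm).mul (measurable_ph.comp (hTm k)))
    (fun k z => by
      simp only [norm_mul, Complex.norm_real, Real.norm_eq_abs, abs_of_nonneg (hG0 z)]
      exact mul_le_of_le_one_right (hG0 z) (norm_ph _))
  rw [← eI] at H1
  rw [key]
  rw [← key]
  calc _ = _ := key
    _ ≤ ∑ k ∈ Finset.range N, (∫⁻ y, ‖h k y‖ₑ ^ q) ^ (1 / q) *
        (∫⁻ y, ‖Sg d (mm d) (ek k) (fun z => G z * ph (Tg d (mm d) (ek k) (h k) z)) y‖ₑ ^ p) ^ (1 / p) :=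
      Finset.sum_le_sum fun k _ => dual_k d (mm d) (by omega) (by unfold mm; omega) (ek_pos k) (ek_le k) (hh k) (hH k) hGm hG0 hGi hGI hpq
    _ ≤ _ := sum_weights hpq N _ _ ((d:ℝ) * (1 / 2 - 1 / q) - 1 / 2) rfl (b := -(p * ((d + 1) / 2) - d)) (by
        have : p * (1 / q) = p - 1 := by
          have := hpq.inv_add_inv_eq_one
          field_simp at this ⊢; linarith
        linear_combination (d:ℝ) * this)
    _ ≤ _ := by gcongr

lemma dual_main (d : ℕ) (hd : 4 ≤ d) {q p : ℝ} (hpq : q.HolderConjugate p) (hp2 : p * (d + 1) < 2 * (d - 1)) :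
    ∃ C : ℝ≥0∞, C ≠ ⊤ ∧ ∀ (h : ℕ → Ed d → ℂ) (_ : ∀ k, Measurable (h k)) (H : ℕ → ℝ) (_ : ∀ k y, ‖h k y‖ ≤ H k),
    ∫⁻ z, (∑' k, ‖Tg d (mm d) (ek k) (h k) z‖ₑ) ^ q ∂(lam d) ≤
      C * ∑' k, ENNReal.ofReal (ek k ^ (-((d:ℝ) * (1 / 2 - 1 / q) - 1 / 2) * q)) * ∫⁻ y, ‖h k y‖ₑ ^ q := by
  obtain ⟨C, hC, HC⟩ := strong d hd p hpq.symm.lt hp2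
  have hq := hpq.pos
  have hp := hpq.symm.pos
  refine ⟨C ^ (q / p), ENNReal.rpow_ne_top_of_nonneg (by positivity) hC, ?_⟩
  intro h hh H hH
  rw [mul_comm]
  set R := (∑' k, ENNReal.ofReal (ek k ^ (-((d:ℝ) * (1 / 2 - 1 / q) - 1 / 2) * q)) * ∫⁻ y, ‖h k y‖ₑ ^ q) * C ^ (q / p) with hR
  have hTm : ∀ k, Measurable (Tg d (mm d) (ek k) (h k)) := fun k => measurable_Tg d _ (ek_pos k) (hh k)
  set F : ℕ → Ed d × ℝ → ℝ := fun N z => ∑ k ∈ Finset.range N, ‖Tg d (mm d) (ek k) (h k) z‖ with hFdef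
  have hF0 : ∀ N z, 0 ≤ F N z := fun N z => by simp only [hFdef]; positivity
  have hFm : ∀ N, Measurable (F N) := fun N => Finset.measurable_sum _ fun k _ => (hTm k).norm
  have hFe : ∀ N z, ENNReal.ofReal (F N z) = ∑ k ∈ Finset.range N, ‖Tg d (mm d) (ek k) (h k) z‖ₑ := by
    intro N z
    simp only [hFdef]
    rw [ENNReal.ofReal_sum_of_nonneg (fun _ _ => norm_nonneg _)]
    simp only [ofReal_norm]
  have s1 : ∀ N, ∫⁻ z, ENNReal.ofReal (F N z) ^ q ∂(lam d) ≤ R := by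
    intro N
    set B : ℕ → Set (Ed d × ℝ) := fun M => {z : Ed d × ℝ | z.1 ∈ closedBall 0 (M:ℝ) ∧ z.2 ∈ Icc (1:ℝ) 2 ∧ F N z ≤ M} with hB
    have hBm : ∀ M, MeasurableSet (B M) := fun M =>
      (measurable_fst measurableSet_closedBall).inter ((measurable_snd measurableSet_Icc).inter (measurableSet_le (hFm N) measurable_const))
    have hmono : Monotone B := by
      intro M M' hM z hz
      have : (M:ℝ) ≤ M' := by exact_mod_cast hM
      exact ⟨closedBall_subset_closedBall this hz.1, hz.2.1, hz.2.2.trans this⟩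
    have hb : ∀ M, ∫⁻ z in B M, ENNReal.ofReal (F N z) ^ q ∂(lam d) ≤ R := fun M =>
      dual_fin d hd hpq C HC h hh H hH N M (F N) (fun z => rfl)
    have hu : lam d (⋃ M, B M)ᶜ = 0 := by
      have : (⋃ M, B M)ᶜ ⊆ univ ×ˢ (Icc (1:ℝ) 2)ᶜ := by
        intro z hz
        refine ⟨mem_univ _, fun hz2 => hz ?_⟩
        obtain ⟨M, hM⟩ := exists_nat_ge (max ‖z.1‖ (F N z))
        exact mem_iUnion.2 ⟨M, mem_closedBall_zero_iff.2 ((le_max_left _ _).trans hM), hz2, (le_max_right _ _).trans hM⟩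
      refine measure_mono_null this ?_
      rw [Measure.prod_prod, Measure.restrict_apply measurableSet_Icc.compl]
      simp
    have e1 : ∫⁻ z, ENNReal.ofReal (F N z) ^ q ∂(lam d) = ∫⁻ z in ⋃ M, B M, ENNReal.ofReal (F N z) ^ q ∂(lam d) := by
      have : (lam d).restrict (⋃ M, B M) = lam d := Measure.restrict_eq_self_of_ae_mem (by
        rw [ae_iff]; exact hu)
      rw [this]
    rw [e1, setLIntegral_iUnion_of_directed _ (hmono.directed_le)]
    exact iSup_le hb
  have e2 : ∀ z, (∑' k, ‖Tg d (mm d) (ek k) (h k) z‖ₑ) ^ q = ⨆ N, ENNReal.ofReal (F N z) ^ q := by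
    intro z
    rw [ENNReal.tsum_eq_iSup_nat]
    simp only [hFe]
    exact (ENNReal.orderIsoRpow q hq).map_iSup _
  simp only [e2]
  rw [lintegral_iSup]
  · exact iSup_le s1
  · intro N
    exact (ENNReal.measurable_ofReal.comp (hFm N)).pow_const q
  · intro N N' hN z
    refine ENNReal.rpow_le_rpow (ENNReal.ofReal_le_ofReal ?_) hq.le
    exact Finset.sum_le_sum_of_subset_of_nonneg (Finset.range_mono hN) fun _ _ _ => norm_nonneg _

lemma conv_fi {d : ℕ} {κ φ : Ed d → ℂ} (hκ : Integrable κ) (hφ : Integrable φ) (x : Ed d) :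
    𝓕⁻ (fun ξ => 𝓕 κ ξ * φ ξ) x = ∫ y, κ (x - y) * 𝓕⁻ φ y := by
  have e0 : ∫ y, κ (x - y) * 𝓕⁻ φ y = ∫ y, κ y * 𝓕⁻ φ (x - y) := by
    rw [← integral_sub_left_eq_self (fun y => κ y * 𝓕⁻ φ (x - y)) volume x]
    simp
  rw [e0, Real.fourierInv_eq']
  simp only [Real.fourierInv_eq', Real.fourier_eq', smul_eq_mul]
  have h1 : ∀ y, κ y * ∫ v, Complex.exp (↑(2 * Real.pi * inner ℝ v (x - y)) * Complex.I) * φ v =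
      ∫ v, Complex.exp (↑(2 * Real.pi * inner ℝ v (x - y)) * Complex.I) * (κ y * φ v) := by
    intro y; rw [← integral_const_mul]; congr 1; ext v; ring
  simp only [h1]
  rw [integral_integral_swap]
  · congr 1; ext v
    rw [← integral_mul_const, ← integral_const_mul]
    congr 1; ext y
    rw [show ((2 * Real.pi * inner ℝ v (x - y) : ℝ) : ℂ) * Complex.I = ((2 * Real.pi * inner ℝ v x : ℝ) : ℂ) * Complex.I +
      ((-2 * Real.pi * inner ℝ y v : ℝ) : ℂ) * Complex.I by
        rw [inner_sub_right, real_inner_comm y v]; push_cast; ring, Complex.exp_add]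
    ring
  · have h := hκ.mul_prod hφ
    refine h.mono ?_ ?_
    · refine AEStronglyMeasurable.mul (f := fun p : Ed d × Ed d => Complex.exp (↑(2 * Real.pi * inner ℝ p.2 (x - p.1)) * Complex.I)) ?_ h.1
      apply Continuous.aestronglyMeasurable
      fun_prop
    · filter_upwards with p
      simp only [Function.uncurry_def, norm_mul, Complex.norm_exp_ofReal_mul_I, one_mul]
      rfl

lemma young {d : ℕ} {κ u : Ed d → ℂ} (hκ : Continuous κ) (hu : Continuous u) {q p : ℝ} (hpq : q.HolderConjugate p) :
    ∫⁻ x, ‖∫ y, κ (x - y) * u y‖ₑ ^ q ≤ (∫⁻ x, ‖κ x‖ₑ) ^ q * ∫⁻ x, ‖u x‖ₑ ^ q := by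
  have hq := hpq.pos
  have hp := hpq.symm.pos
  have e : 1 / p + 1 / q = 1 := by simpa using hpq.symm.inv_add_inv_eq_one
  set K := ∫⁻ x, ‖κ x‖ₑ with hK
  have hKx : ∀ x, ∫⁻ y, ‖κ (x - y)‖ₑ = K := fun x => by
    rw [hK, ← lintegral_sub_left_eq_self (fun y => ‖κ y‖ₑ) x]
  have s1 : ∀ x, ‖∫ y, κ (x - y) * u y‖ₑ ^ q ≤ K ^ (q / p) * ∫⁻ y, ‖κ (x - y)‖ₑ * ‖u y‖ₑ ^ q := by
    intro x
    have mκ : Measurable (fun y => ‖κ (x - y)‖ₑ) := (hκ.comp (continuous_const.sub continuous_id)).measurable.enorm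
    have h1 : ‖∫ y, κ (x - y) * u y‖ₑ ≤ K ^ (1 / p) * (∫⁻ y, ‖κ (x - y)‖ₑ * ‖u y‖ₑ ^ q) ^ (1 / q) := by
      refine (enorm_integral_le_lintegral_enorm _).trans ?_
      have h2 := ENNReal.lintegral_mul_le_Lp_mul_Lq volume hpq.symm (f := fun y => ‖κ (x - y)‖ₑ ^ (1 / p))
        (g := fun y => ‖κ (x - y)‖ₑ ^ (1 / q) * ‖u y‖ₑ) (mκ.pow_const _).aemeasurable
        ((mκ.pow_const _).mul hu.measurable.enorm).aemeasurable
      refine (le_of_eq ?_).trans (h2.trans (le_of_eq ?_))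
      · congr 1; ext y
        simp only [Pi.mul_apply]
        rw [enorm_mul, ← mul_assoc, ← ENNReal.rpow_add_of_nonneg _ _ (by positivity) (by positivity), e, ENNReal.rpow_one]
      · congr 2
        · rw [← hKx x]
          congr 1; ext y
          rw [← ENNReal.rpow_mul, one_div_mul_cancel hp.ne', ENNReal.rpow_one]
        · congr 1; ext y
          rw [ENNReal.mul_rpow_of_nonneg _ _ hq.le, ← ENNReal.rpow_mul, one_div_mul_cancel hq.ne', ENNReal.rpow_one]
    have h3 := ENNReal.rpow_le_rpow h1 hq.le
    refine h3.trans (le_of_eq ?_)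
    rw [ENNReal.mul_rpow_of_nonneg _ _ hq.le, ← ENNReal.rpow_mul, ← ENNReal.rpow_mul, one_div_mul_cancel hq.ne', ENNReal.rpow_one]
    congr 2; ring
  have mm2 : Measurable (Function.uncurry fun (x y : Ed d) => ‖κ (x - y)‖ₑ * ‖u y‖ₑ ^ q) :=
    ((hκ.comp (continuous_fst.sub continuous_snd)).measurable.enorm).mul ((hu.comp continuous_snd).measurable.enorm.pow_const _)
  calc _ ≤ ∫⁻ x, K ^ (q / p) * ∫⁻ y, ‖κ (x - y)‖ₑ * ‖u y‖ₑ ^ q := lintegral_mono s1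
    _ = K ^ (q / p) * ∫⁻ x, ∫⁻ y, ‖κ (x - y)‖ₑ * ‖u y‖ₑ ^ q := by
        rw [lintegral_const_mul]
        exact Measurable.lintegral_prod_right mm2
    _ = K ^ (q / p) * ∫⁻ y, K * ‖u y‖ₑ ^ q := by
        rw [lintegral_lintegral_swap mm2.aemeasurable]
        congr 2; ext y
        rw [lintegral_mul_const]
        · congr 1
          exact lintegral_sub_right_eq_self (fun x => ‖κ x‖ₑ) y
        · exact (hκ.comp (continuous_id.sub continuous_const)).measurable.enorm
    _ = _ := by
        rw [lintegral_const_mul _ (hu.measurable.enorm.pow_const _), ← mul_assoc]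
        congr 1
        nth_rewrite 2 [← ENNReal.rpow_one K]
        rw [← ENNReal.rpow_add_of_nonneg _ _ (by positivity) (by positivity)]
        congr 1
        field_simp
        have := hpq.inv_add_inv_eq_one
        field_simp at this
        linarith

lemma fourierInv_comp_smul {d : ℕ} (a : Ed d → ℂ) {r : ℝ} (hr : 0 < r) (x : Ed d) :
    𝓕⁻ (fun ξ => a (r • ξ)) x = ((r ^ d)⁻¹ : ℝ) • 𝓕⁻ a (r⁻¹ • x) := by
  simp only [Real.fourierInv_eq']
  have := Measure.integral_comp_smul_of_nonneg (μ := (volume : Measure (Ed d)))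
    (fun v => Complex.exp (↑(2 * Real.pi * inner ℝ v (r⁻¹ • x)) * Complex.I) • a v) r (hR := hr.le)
  rw [finrank_euclideanSpace_fin] at this
  rw [← this]
  congr 1; ext v
  rw [real_inner_smul_left, real_inner_smul_right]
  field_simp

lemma symb {d : ℕ} (a : SchwartzMap (Ed d) ℂ) {q p : ℝ} (hpq : q.HolderConjugate p) {r : ℝ} (hr : 0 < r) {φ : Ed d → ℂ} (hφ : Integrable φ) :
    ∫⁻ x, ‖𝓕⁻ (fun ξ => a (r • ξ) * φ ξ) x‖ₑ ^ q ≤ (∫⁻ x, ‖𝓕⁻ (⇑a) x‖ₑ) ^ q * ∫⁻ x, ‖𝓕⁻ φ x‖ₑ ^ q := by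
  set b : Ed d → ℂ := fun ξ => a (r • ξ) with hb
  have hbc : Continuous b := a.continuous.comp (continuous_const_smul r)
  have hbi : Integrable b := (integrable_comp_smul_iff volume (⇑a) hr.ne').2 a.integrable
  set κ := 𝓕⁻ b with hκ
  have eκ : κ = fun x => ((r ^ d)⁻¹ : ℝ) • 𝓕⁻ (⇑a) (r⁻¹ • x) := funext fun x => fourierInv_comp_smul _ hr x
  have hai : Integrable (𝓕⁻ (⇑a)) := by
    rw [← SchwartzMap.fourierInv_coe]; exact SchwartzMap.integrable _
  have hκi : Integrable κ := by
    rw [eκ]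
    exact ((integrable_comp_smul_iff volume (𝓕⁻ (⇑a)) (inv_ne_zero hr.ne')).2 hai).smul ((r ^ d)⁻¹ : ℝ)
  have hκc : Continuous κ := continuous_fourierInv_of_integrable hbi
  have hF : 𝓕 κ = b := by
    apply hbc.fourier_fourierInv_eq hbi
    have : 𝓕 b = fun x => 𝓕⁻ b (-x) := by
      ext x; rw [Real.fourierInv_eq_fourier_neg, neg_neg]
    rw [this]
    exact hκi.comp_neg
  have hL1 : ∫⁻ x, ‖κ x‖ₑ = ∫⁻ x, ‖𝓕⁻ (⇑a) x‖ₑ := by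
    rw [← ofReal_integral_norm_eq_lintegral_enorm hκi, ← ofReal_integral_norm_eq_lintegral_enorm hai, eκ]
    congr 1
    simp only [norm_smul]
    rw [integral_const_mul, Measure.integral_comp_inv_smul_of_nonneg volume (fun x => ‖𝓕⁻ (⇑a) x‖) hr.le, finrank_euclideanSpace_fin,
      Real.norm_of_nonneg (by positivity), smul_eq_mul, ← mul_assoc, inv_mul_cancel₀ (by positivity), one_mul]
  have e1 : ∀ x, 𝓕⁻ (fun ξ => b ξ * φ ξ) x = ∫ y, κ (x - y) * 𝓕⁻ φ y := by
    intro x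
    rw [← hF]
    exact conv_fi hκi hφ x
  rw [lintegral_congr (fun x => by rw [show 𝓕⁻ (fun ξ => a (r • ξ) * φ ξ) x = _ from e1 x]), ← hL1]
  exact young hκc (continuous_fourierInv_of_integrable hφ) hpq

lemma symb_fin {d : ℕ} (a : SchwartzMap (Ed d) ℂ) : ∫⁻ x, ‖𝓕⁻ (⇑a) x‖ₑ ≠ ⊤ := by
  have hai : Integrable (𝓕⁻ (⇑a)) := by
    rw [← SchwartzMap.fourierInv_coe]; exact SchwartzMap.integrable _
  exact hai.2.ne

/-- smooth functions away from the origin agree with Schwartz functions on annuli -/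
lemma annular {d : ℕ} (g : Ed d → ℂ) (hg : ∀ ξ, ξ ≠ 0 → ContDiffAt ℝ ((⊤ : ℕ∞) : WithTop ℕ∞) g ξ) :
    ∃ a : SchwartzMap (Ed d) ℂ, ∀ ξ, 1 / 4 ≤ ‖ξ‖ → ‖ξ‖ ≤ 2 → a ξ = g ξ := by
  let b : ContDiffBump (0 : Ed d) := ⟨2, 3, by norm_num, by norm_num⟩
  let b' : ContDiffBump (0 : Ed d) := ⟨1 / 8, 1 / 4, by norm_num, by norm_num⟩
  let F : Ed d → ℂ := fun ξ => ((b ξ * (1 - b' ξ) : ℝ) : ℂ) * g ξ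
  have hc : HasCompactSupport F := by
    refine HasCompactSupport.of_support_subset_isCompact (isCompact_closedBall (0 : Ed d) 3) ?_
    intro ξ hξ
    by_contra h
    apply hξ
    have : b ξ = 0 := b.zero_of_le_dist (by simpa [b] using (not_le.1 (fun h' => h (by simpa using h'))).le)
    simp [F, this]
  have hs : ContDiff ℝ ((⊤ : ℕ∞) : WithTop ℕ∞) F := by
    rw [contDiff_iff_contDiffAt]
    intro ξ
    by_cases h0 : ξ = 0
    · have : F =ᶠ[nhds ξ] fun _ => 0 := by
        rw [h0]
        filter_upwards [Metric.ball_mem_nhds (0 : Ed d) (show (0:ℝ) < 1 / 8 by norm_num)] with v hv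
        have : b' v = 1 := b'.one_of_mem_closedBall (ball_subset_closedBall hv)
        simp [F, this]
      exact contDiffAt_const.congr_of_eventuallyEq this
    · refine ContDiffAt.mul ?_ (hg ξ h0)
      refine Complex.ofRealCLM.contDiff.contDiffAt.comp ξ ?_
      exact b.contDiffAt.mul (contDiffAt_const.sub b'.contDiffAt)
  refine ⟨hc.toSchwartzMap hs, ?_⟩
  intro ξ h1 h2
  show F ξ = g ξ
  have e1 : b ξ = 1 := b.one_of_mem_closedBall (by simpa [b] using h2)
  have e2 : b' ξ = 0 := b'.zero_of_le_dist (by simpa [b'] using h1)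
  simp [F, e1, e2]

lemma eLp_pow {d : ℕ} {E : Type*} [NormedAddCommGroup E] (u : Ed d → E) {q : ℝ} (hq : 0 < q) : eLpNorm u (ENNReal.ofReal q) volume ^ q = ∫⁻ x, ‖u x‖ₑ ^ q := by
  rw [eLpNorm_eq_lintegral_rpow_enorm_toReal (by simpa using hq) ENNReal.ofReal_ne_top, ENNReal.toReal_ofReal hq.le, ← ENNReal.rpow_mul,
    one_div_mul_cancel hq.ne', ENNReal.rpow_one]

lemma symb' {d : ℕ} (a : SchwartzMap (Ed d) ℂ) {q p : ℝ} (hpq : q.HolderConjugate p) {r : ℝ} (hr : 0 < r) {φ : Ed d → ℂ} (hφ : Integrable φ) :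
    eLpNorm (𝓕⁻ (fun ξ => a (r • ξ) * φ ξ)) (ENNReal.ofReal q) volume ≤ (∫⁻ x, ‖𝓕⁻ (⇑a) x‖ₑ) * eLpNorm (𝓕⁻ φ) (ENNReal.ofReal q) volume := by
  have hq := hpq.pos
  rw [← ENNReal.rpow_le_rpow_iff hq, ENNReal.mul_rpow_of_nonneg _ _ hq.le, eLp_pow _ hq, eLp_pow _ hq]
  exact symb a hpq hr hφ

lemma schw_mul {d : ℕ} (a : SchwartzMap (Ed d) ℂ) (r : ℝ) {φ : Ed d → ℂ} (hφ : Integrable φ) :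
    Integrable (fun ξ => a (r • ξ) * φ ξ) := by
  obtain ⟨C, hC⟩ := a.decay 0 0
  refine hφ.bdd_mul (c := C) (a.continuous.comp (continuous_const_smul r)).aestronglyMeasurable ?_
  exact Filter.Eventually.of_forall fun x => by simpa using hC.2 (r • x)

lemma mink {d : ℕ} {φ : Ed d → ℂ} (φn : ℕ → Ed d → ℂ) (h : ∀ n, Integrable (φn n)) (hs : Summable fun n => ∫ ξ, ‖φn n ξ‖)
    (he : ∀ ξ, ∑' n, φn n ξ = φ ξ) {q : ℝ} (hq : 1 ≤ q) :
    eLpNorm (𝓕⁻ φ) (ENNReal.ofReal q) volume ≤ ∑' n, eLpNorm (𝓕⁻ (φn n)) (ENNReal.ofReal q) volume := by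
  have hsum : ∀ x, HasSum (fun n => 𝓕⁻ (φn n) x) (𝓕⁻ φ x) := by
    intro x
    simp only [Real.fourierInv_eq', smul_eq_mul]
    have := hasSum_integral_of_summable_integral_norm (μ := (volume : Measure (Ed d)))
      (F := fun n v => Complex.exp (↑(2 * Real.pi * inner ℝ v x) * Complex.I) * φn n v) (fun n => by
        refine (h n).bdd_mul (c := 1) (f := fun v => Complex.exp (↑(2 * Real.pi * inner ℝ v x) * Complex.I)) ?_ ?_
        · apply Continuous.aestronglyMeasurable; fun_prop
        · exact Filter.Eventually.of_forall fun v => by rw [Complex.norm_exp_ofReal_mul_I]) (by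
        simpa only [norm_mul, Complex.norm_exp_ofReal_mul_I, one_mul] using hs)
    have e : ∫ v, Complex.exp (↑(2 * Real.pi * inner ℝ v x) * Complex.I) * φ v =
      ∫ v, ∑' n, Complex.exp (↑(2 * Real.pi * inner ℝ v x) * Complex.I) * φn n v := by
      congr 1; ext v
      rw [← he, tsum_mul_left]
    rw [e]; exact this
  have hm : ∀ n, AEStronglyMeasurable (𝓕⁻ (φn n)) volume := fun n => (continuous_fourierInv_of_integrable (h n)).aestronglyMeasurable
  have h1 := Lp.eLpNorm_lim_le_liminf_eLpNorm (p := ENNReal.ofReal q) (μ := (volume : Measure (Ed d)))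
    (f := fun N => ∑ n ∈ Finset.range N, 𝓕⁻ (φn n)) (fun N => Finset.aestronglyMeasurable_sum _ fun n _ => hm n) (𝓕⁻ φ)
    (Filter.Eventually.of_forall fun x => by
      simpa using (hsum x).tendsto_sum_nat)
  refine h1.trans ?_
  refine Filter.liminf_le_of_le (by isBoundedDefault) fun b hb => ?_
  obtain ⟨N, hN⟩ := hb.exists
  refine hN.trans ((eLpNorm_sum_le (fun n _ => hm n) (by simpa using hq)).trans (ENNReal.sum_le_tsum _))

lemma absD {d : ℕ} (η₀ : SchwartzMap (Ed d) ℂ)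
    (hsupp : ∀ ξ : Ed d, 𝓕 (⇑η₀) ξ ≠ 0 → 1 / 2 < ‖ξ‖ ∧ ‖ξ‖ < 2)
    (hsum : ∀ ξ : Ed d, ξ ≠ 0 → ∑' s : ℤ, (𝓕 (⇑η₀) ((2 : ℝ) ^ (-s) • ξ)) ^ 2 = 1) {q p : ℝ} (hpq : q.HolderConjugate p) :
    ∃ M : ℝ, 0 ≤ M ∧ ∀ φ : Ed d → ℂ, Integrable φ → (∀ ξ, 2 < ‖ξ‖ → φ ξ = 0) →
      eLpNorm (𝓕⁻ (fun ξ => (‖ξ‖ : ℂ) * φ ξ)) (ENNReal.ofReal q) volume ≤ ENNReal.ofReal M * eLpNorm (𝓕⁻ φ) (ENNReal.ofReal q) volume := by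
  obtain ⟨a, ha⟩ := annular (d := d) (fun ξ => (‖ξ‖ : ℂ)) (fun ξ hξ => Complex.ofRealCLM.contDiff.contDiffAt.comp ξ (contDiffAt_norm ℝ hξ))
  set e : SchwartzMap (Ed d) ℂ := 𝓕 η₀ with he
  have hee : ∀ ξ, 𝓕 (⇑η₀) ξ = e ξ := fun ξ => by rw [he, SchwartzMap.fourier_coe]
  simp only [hee] at hsupp hsum
  set A := ∫⁻ x, ‖𝓕⁻ (⇑a) x‖ₑ with hA
  set E := ∫⁻ x, ‖𝓕⁻ (⇑e) x‖ₑ with hE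
  have hAt : A ≠ ⊤ := symb_fin a
  have hEt : E ≠ ⊤ := symb_fin e
  refine ⟨(4 * (A * (E * E))).toReal, ENNReal.toReal_nonneg, ?_⟩
  intro φ hφ hφs
  rw [ENNReal.ofReal_toReal (by finiteness)]
  set ρ : ℕ → ℝ := fun j => (2:ℝ) ^ (-(1 - (j:ℤ))) with hρ
  have hρ0 : ∀ j, 0 < ρ j := fun j => by simp only [hρ]; positivity
  have hρi : ∀ j, (ρ j)⁻¹ = 2 * (1 / 2) ^ j := by
    intro j
    simp only [hρ]
    rw [zpow_neg, inv_inv, zpow_sub₀ (by norm_num)]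
    simp [div_eq_mul_inv]
  set φn : ℕ → Ed d → ℂ := fun j ξ => ((ρ j)⁻¹ : ℂ) * (a (ρ j • ξ) * (e (ρ j • ξ) * (e (ρ j • ξ) * φ ξ))) with hφn
  have i3 : ∀ j, Integrable (fun ξ => a (ρ j • ξ) * (e (ρ j • ξ) * (e (ρ j • ξ) * φ ξ))) := fun j =>
    schw_mul a (ρ j) (schw_mul e (ρ j) (schw_mul e (ρ j) hφ))
  have hint : ∀ j, Integrable (φn j) := fun j => (i3 j).const_mul _
  have hφe : ∀ j ξ, φn j ξ = (‖ξ‖ : ℂ) * φ ξ * e (ρ j • ξ) ^ 2 := by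
    intro j ξ
    simp only [hφn]
    by_cases h : e (ρ j • ξ) = 0
    · simp [h]
    · have := hsupp _ h
      rw [ha (ρ j • ξ) (by linarith) this.2.le, norm_smul, Real.norm_of_nonneg (hρ0 j).le]
      have : (ρ j : ℂ) ≠ 0 := by exact_mod_cast (hρ0 j).ne'
      push_cast
      field_simp
  have hb : ∀ j, eLpNorm (𝓕⁻ (φn j)) (ENNReal.ofReal q) volume ≤ ENNReal.ofReal ((ρ j)⁻¹) * (A * (E * (E * eLpNorm (𝓕⁻ φ) (ENNReal.ofReal q) volume))) := by
    intro j
    have e1 : 𝓕⁻ (φn j) = (((ρ j)⁻¹ : ℝ) : ℂ) • 𝓕⁻ (fun ξ => a (ρ j • ξ) * (e (ρ j • ξ) * (e (ρ j • ξ) * φ ξ))) := by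
      ext x
      simp only [Pi.smul_apply, Real.fourierInv_eq', smul_eq_mul, hφn]
      rw [← integral_const_mul]
      congr 1; ext v; push_cast; ring
    rw [e1, eLpNorm_const_smul]
    have e2 : ‖(((ρ j)⁻¹ : ℝ) : ℂ)‖ₑ = ENNReal.ofReal ((ρ j)⁻¹) := by
      rw [← ofReal_norm, Complex.norm_real, Real.norm_of_nonneg (by have := hρ0 j; positivity)]
    rw [e2]
    gcongr
    refine (symb' a hpq (hρ0 j) (schw_mul e (ρ j) (schw_mul e (ρ j) hφ))).trans ?_
    gcongr
    refine (symb' e hpq (hρ0 j) (schw_mul e (ρ j) hφ)).trans ?_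
    gcongr
    exact symb' e hpq (hρ0 j) hφ
  have hsm : Summable fun j => ∫ ξ, ‖φn j ξ‖ := by
    obtain ⟨Ca, hCa⟩ := a.decay 0 0
    obtain ⟨Ce, hCe⟩ := e.decay 0 0
    have ba : ∀ x, ‖a x‖ ≤ Ca := fun x => by simpa using hCa.2 x
    have be : ∀ x, ‖e x‖ ≤ Ce := fun x => by simpa using hCe.2 x
    refine Summable.of_nonneg_of_le (fun j => integral_nonneg fun _ => norm_nonneg _) (f := fun j => 2 * (1/2)^j * (Ca * (Ce * (Ce * ∫ ξ, ‖φ ξ‖)))) ?_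
      ((summable_geometric_two.mul_left 2).mul_right _)
    intro j
    rw [← hρi, ← integral_const_mul, ← integral_const_mul, ← integral_const_mul, ← integral_const_mul]
    refine integral_mono (hint j).norm ?_ fun ξ => ?_
    · exact (((hφ.norm.const_mul _).const_mul _).const_mul _).const_mul _
    · simp only [hφn, norm_mul, norm_inv, Complex.norm_real, Real.norm_of_nonneg (hρ0 j).le]
      have := hρ0 j
      have h1 := ba (ρ j • ξ)
      have h2 := be (ρ j • ξ)
      have h3 : 0 ≤ Ca := hCa.1.le
      have h4 : 0 ≤ Ce := hCe.1.le
      gcongr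
  have hT : ∀ ξ, ∑' j, φn j ξ = (‖ξ‖ : ℂ) * φ ξ := by
    intro ξ
    simp only [hφe]
    rw [tsum_mul_left]
    by_cases h0 : ξ = 0
    · simp [h0]
    by_cases h2 : 2 < ‖ξ‖
    · simp [hφs ξ h2]
    push Not at h2
    have : ∑' j : ℕ, e (ρ j • ξ) ^ 2 = 1 := by
      rw [← hsum ξ h0]
      have inj : Function.Injective (fun j : ℕ => (1 - (j:ℤ))) := fun i j h => by simpa using h
      refine inj.tsum_eq (f := fun s : ℤ => e ((2:ℝ) ^ (-s) • ξ) ^ 2) ?_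
      intro s hs
      have hne : e ((2:ℝ) ^ (-s) • ξ) ≠ 0 := fun h => hs (by show e ((2:ℝ) ^ (-s) • ξ) ^ 2 = 0; rw [h]; simp)
      have := (hsupp _ hne).1
      rw [norm_smul, Real.norm_of_nonneg (by positivity)] at this
      have hs1 : s < 2 := by
        by_contra hcon
        push Not at hcon
        have h5 : (2:ℝ) ^ (-s) ≤ (2:ℝ) ^ (-2 : ℤ) := zpow_le_zpow_right₀ (by norm_num) (by omega)
        rw [show (2:ℝ) ^ (-2 : ℤ) = 1 / 4 by norm_num] at h5
        nlinarith [norm_nonneg ξ]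
      exact ⟨(1 - s).toNat, by simp only; omega⟩
    rw [this, mul_one]
  refine (mink φn hint hsm hT hpq.lt.le).trans ((ENNReal.tsum_le_tsum hb).trans (le_of_eq ?_))
  rw [ENNReal.tsum_mul_right, ← ENNReal.ofReal_tsum_of_nonneg (fun j => by have := hρ0 j; positivity)]
  · simp only [hρi]
    rw [tsum_mul_left, tsum_geometric_two]
    norm_num
    ring
  · simp only [hρi]; exact summable_geometric_two.mul_left 2

lemma low_freq {d : ℕ} (η₀ : SchwartzMap (Ed d) ℂ)
    (hsupp : ∀ ξ : Ed d, 𝓕 (⇑η₀) ξ ≠ 0 → 1 / 2 < ‖ξ‖ ∧ ‖ξ‖ < 2)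
    (hsum : ∀ ξ : Ed d, ξ ≠ 0 → ∑' s : ℤ, (𝓕 (⇑η₀) ((2 : ℝ) ^ (-s) • ξ)) ^ 2 = 1) {q p : ℝ} (hpq : q.HolderConjugate p) :
    ∃ M : ℝ, 0 ≤ M ∧ ∀ φ : Ed d → ℂ, Integrable φ → (∀ ξ, 2 < ‖ξ‖ → φ ξ = 0) → ∀ t ∈ Icc (1:ℝ) 2,
      eLpNorm (𝓕⁻ (fun ξ => Complex.exp (Complex.I * (t : ℂ) * (‖ξ‖ : ℂ)) * φ ξ)) (ENNReal.ofReal q) volume ≤ ENNReal.ofReal M * eLpNorm (𝓕⁻ φ) (ENNReal.ofReal q) volume := by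
  obtain ⟨M, hM, H⟩ := absD η₀ hsupp hsum hpq
  refine ⟨Real.exp (2 * M), (Real.exp_pos _).le, ?_⟩
  intro φ hφ hφs t ht
  have hb2 : ∀ n ξ, ‖(‖ξ‖ : ℂ) ^ n * φ ξ‖ ≤ 2 ^ n * ‖φ ξ‖ := by
    intro n ξ
    rw [norm_mul, norm_pow, Complex.norm_real, norm_norm]
    by_cases h2 : 2 < ‖ξ‖
    · simp [hφs ξ h2]
    · push Not at h2; gcongr
  have hi : ∀ n : ℕ, Integrable (fun ξ => (‖ξ‖ : ℂ) ^ n * φ ξ) := by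
    intro n
    refine (hφ.norm.const_mul (2 ^ n)).mono' ?_ (Filter.Eventually.of_forall (hb2 n))
    refine AEStronglyMeasurable.mul ?_ hφ.1
    apply Continuous.aestronglyMeasurable; fun_prop
  have hn : ∀ n : ℕ, eLpNorm (𝓕⁻ (fun ξ => (‖ξ‖ : ℂ) ^ n * φ ξ)) (ENNReal.ofReal q) volume ≤ ENNReal.ofReal (M ^ n) * eLpNorm (𝓕⁻ φ) (ENNReal.ofReal q) volume := by
    intro n
    induction n with
    | zero => simp
    | succ n ih =>
      have := H _ (hi n) (fun ξ hξ => by rw [hφs ξ hξ, mul_zero])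
      have e : (fun ξ : Ed d => (‖ξ‖ : ℂ) * ((‖ξ‖ : ℂ) ^ n * φ ξ)) = fun ξ => (‖ξ‖ : ℂ) ^ (n + 1) * φ ξ := by
        ext ξ; ring
      rw [e] at this
      refine this.trans ?_
      rw [pow_succ', ENNReal.ofReal_mul hM, mul_assoc]
      gcongr
  set c : ℕ → ℂ := fun n => (Complex.I * t) ^ n / (n.factorial : ℂ) with hc
  have hcn : ∀ n, ‖c n‖ ≤ 2 ^ n / n.factorial := by
    intro n
    simp only [hc, norm_div, norm_pow, norm_mul, Complex.norm_I, one_mul, Complex.norm_real, Complex.norm_natCast]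
    have : ‖t‖ ≤ 2 := by rw [Real.norm_of_nonneg (by linarith [ht.1])]; exact ht.2
    gcongr
  have hs : ∀ x : ℝ, Summable fun n : ℕ => x ^ n / (n.factorial : ℝ) := Real.summable_pow_div_factorial
  have k1 : Summable fun n : ℕ => ∫ ξ, ‖c n * ((‖ξ‖ : ℂ) ^ n * φ ξ)‖ := by
    have k0 := (hs 4).mul_right (∫ ξ, ‖φ ξ‖)
    refine Summable.of_nonneg_of_le (fun n => integral_nonneg fun _ => norm_nonneg _) (fun n => ?_) k0
    rw [← integral_const_mul]
    refine integral_mono ((hi n).const_mul _).norm (hφ.norm.const_mul _) fun ξ => ?_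
    simp only
    rw [norm_mul]
    calc _ ≤ 2 ^ n / (n.factorial : ℝ) * (2 ^ n * ‖φ ξ‖) := mul_le_mul (hcn n) (hb2 n ξ) (norm_nonneg _) (by positivity)
      _ = _ := by rw [show (4:ℝ) = 2 * 2 by norm_num, mul_pow]; ring
  have k2 : ∀ ξ, ∑' n : ℕ, c n * ((‖ξ‖ : ℂ) ^ n * φ ξ) = Complex.exp (Complex.I * (t : ℂ) * (‖ξ‖ : ℂ)) * φ ξ := by
    intro ξ
    have : ∀ n, c n * ((‖ξ‖ : ℂ) ^ n * φ ξ) = (Complex.I * t * ‖ξ‖) ^ n / (n.factorial : ℂ) * φ ξ := by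
      intro n; simp only [hc]; rw [mul_pow _ (‖ξ‖ : ℂ)]; ring
    simp only [this]
    rw [tsum_mul_right, Complex.exp_eq_exp_ℂ, NormedSpace.exp_eq_tsum_div]
  have key := mink (φ := fun ξ => Complex.exp (Complex.I * (t : ℂ) * (‖ξ‖ : ℂ)) * φ ξ) (fun n ξ => c n * ((‖ξ‖ : ℂ) ^ n * φ ξ))
    (fun n => (hi n).const_mul _) k1 k2 hpq.lt.le
  refine key.trans ?_
  have hb : ∀ n, eLpNorm (𝓕⁻ (fun ξ => c n * ((‖ξ‖ : ℂ) ^ n * φ ξ))) (ENNReal.ofReal q) volume ≤ ENNReal.ofReal ((2 * M) ^ n / n.factorial) * eLpNorm (𝓕⁻ φ) (ENNReal.ofReal q) volume := by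
    intro n
    have e1 : 𝓕⁻ (fun ξ => c n * ((‖ξ‖ : ℂ) ^ n * φ ξ)) = c n • 𝓕⁻ (fun ξ => ((‖ξ‖ : ℂ) ^ n * φ ξ)) := by
      ext x
      simp only [Pi.smul_apply, Real.fourierInv_eq', smul_eq_mul]
      rw [← integral_const_mul]
      congr 1; ext v; ring
    rw [e1, eLpNorm_const_smul, mul_pow, show (2:ℝ) ^ n * M ^ n / n.factorial = 2 ^ n / n.factorial * M ^ n by ring,
      ENNReal.ofReal_mul (by positivity), mul_assoc]
    refine mul_le_mul' ?_ (hn n)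
    rw [← ofReal_norm]
    exact ENNReal.ofReal_le_ofReal (hcn n)
  refine (ENNReal.tsum_le_tsum hb).trans (le_of_eq ?_)
  rw [ENNReal.tsum_mul_right, ← ENNReal.ofReal_tsum_of_nonneg (fun n => by positivity) (hs _), Real.exp_eq_exp_ℝ, NormedSpace.exp_eq_tsum_div]

lemma lpMult_zero {d : ℕ} (η₀ : SchwartzMap (Ed d) ℂ)
    (hsupp : ∀ ξ : Ed d, 𝓕 (⇑η₀) ξ ≠ 0 → 1 / 2 < ‖ξ‖ ∧ ‖ξ‖ < 2)
    (hsum : ∀ ξ : Ed d, ξ ≠ 0 → ∑' s : ℤ, (𝓕 (⇑η₀) ((2 : ℝ) ^ (-s) • ξ)) ^ 2 = 1) (ξ : Ed d) :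
    lpMult d η₀ 0 ξ = (closedBall (0 : Ed d) 2).indicator (fun ξ => 1 - (𝓕 (⇑η₀) ((1 / 2 : ℝ) • ξ)) ^ 2) ξ := by
  simp only [lpMult, if_true]
  by_cases h : ξ ∈ closedBall (0 : Ed d) 2
  · rw [indicator_of_mem h]
    congr 1
    rw [tsum_eq_single 0]
    · norm_num
    · intro j hj
      have : 𝓕 (⇑η₀) ((2 : ℝ) ^ (-((j : ℤ) + 1)) • ξ) = 0 := by
        by_contra hne
        have h1 := (hsupp _ hne).1
        rw [norm_smul, Real.norm_of_nonneg (by positivity)] at h1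
        have h5 : (2:ℝ) ^ (-((j : ℤ) + 1)) ≤ (2:ℝ) ^ (-2 : ℤ) := zpow_le_zpow_right₀ (by norm_num) (by omega)
        rw [show (2:ℝ) ^ (-2 : ℤ) = 1 / 4 by norm_num] at h5
        rw [mem_closedBall_zero_iff] at h
        nlinarith [norm_nonneg ξ]
      rw [this]; simp
  · rw [indicator_of_notMem h]
    rw [mem_closedBall_zero_iff, not_le] at h
    have h0 : ξ ≠ 0 := by rintro rfl; simp at h; linarith
    have : ∑' j : ℕ, (𝓕 (⇑η₀) ((2 : ℝ) ^ (-((j : ℤ) + 1)) • ξ)) ^ 2 = 1 := by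
      rw [← hsum ξ h0]
      have inj : Function.Injective (fun j : ℕ => ((j:ℤ) + 1)) := fun i j h => by simpa using h
      refine inj.tsum_eq (f := fun s : ℤ => (𝓕 (⇑η₀) ((2:ℝ) ^ (-s) • ξ)) ^ 2) ?_
      intro s hs
      have hne : 𝓕 (⇑η₀) ((2:ℝ) ^ (-s) • ξ) ≠ 0 := fun h => hs (by show (𝓕 (⇑η₀) ((2:ℝ) ^ (-s) • ξ)) ^ 2 = 0; rw [h]; simp)
      have h1 := (hsupp _ hne).2
      rw [norm_smul, Real.norm_of_nonneg (by positivity)] at h1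
      have hs1 : 0 < s := by
        by_contra hcon
        push Not at hcon
        have h5 : (2:ℝ) ^ (0 : ℤ) ≤ (2:ℝ) ^ (-s) := zpow_le_zpow_right₀ (by norm_num) (by omega)
        rw [zpow_zero] at h5
        nlinarith [norm_nonneg ξ]
      exact ⟨(s - 1).toNat, by simp only; omega⟩
    rw [this]; simp

lemma ek_zpow (k : ℕ) : ek k = (2:ℝ) ^ (-(k:ℤ)) := by
  rw [ek, ← Real.rpow_intCast]; push_cast; rfl

lemma lpMult_int {d : ℕ} (η₀ : SchwartzMap (Ed d) ℂ)
    (hsupp : ∀ ξ : Ed d, 𝓕 (⇑η₀) ξ ≠ 0 → 1 / 2 < ‖ξ‖ ∧ ‖ξ‖ < 2)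
    (hsum : ∀ ξ : Ed d, ξ ≠ 0 → ∑' s : ℤ, (𝓕 (⇑η₀) ((2 : ℝ) ^ (-s) • ξ)) ^ 2 = 1) (k : ℕ) {φ : Ed d → ℂ} (hφ : Integrable φ) :
    Integrable (fun ξ => lpMult d η₀ k ξ * φ ξ) := by
  set e : SchwartzMap (Ed d) ℂ := 𝓕 η₀ with he
  have hee : ∀ ξ, 𝓕 (⇑η₀) ξ = e ξ := fun ξ => by rw [he, SchwartzMap.fourier_coe]
  have h2 : ∀ r : ℝ, Integrable (fun ξ => (𝓕 (⇑η₀) (r • ξ)) ^ 2 * φ ξ) := by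
    intro r
    refine (schw_mul e r (schw_mul e r hφ)).congr (Filter.Eventually.of_forall fun ξ => ?_)
    simp only [hee]; ring
  by_cases hk : k = 0
  · subst hk
    have h3 := (hφ.sub (h2 (1 / 2))).indicator (measurableSet_closedBall (x := (0 : Ed d)) (ε := 2))
    refine h3.congr (Filter.Eventually.of_forall fun ξ => ?_)
    simp only
    rw [lpMult_zero η₀ hsupp hsum]
    by_cases h : ξ ∈ closedBall (0 : Ed d) 2
    · rw [indicator_of_mem h, indicator_of_mem h, Pi.sub_apply]; ring
    · rw [indicator_of_notMem h, indicator_of_notMem h, zero_mul]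
  · simp only [lpMult, hk, if_false]
    exact h2 _

/-- frequency-localised wave -/
def Wv (d : ℕ) (η₀ : SchwartzMap (Ed d) ℂ) (k : ℕ) (t : ℝ) (f : Ed d → ℂ) : Ed d → ℂ :=
  𝓕⁻ (fun ξ => Complex.exp (Complex.I * (t : ℂ) * (‖ξ‖ : ℂ)) * (lpMult d η₀ k ξ * 𝓕 f ξ))

lemma Pk_wave {d : ℕ} (η₀ : SchwartzMap (Ed d) ℂ) (k : ℕ) (t : ℝ) (f : SchwartzMap (Ed d) ℂ) (x : Ed d) :
    ‖Pk d η₀ k (waveOp d t ⇑f) x‖ₑ ≤ ‖Wv d η₀ k t ⇑f x‖ₑ := by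
  by_cases hi : Integrable (waveOp d t ⇑f)
  · have : 𝓕 (waveOp d t ⇑f) = fun ξ => Complex.exp (Complex.I * (t : ℂ) * (‖ξ‖ : ℂ)) * 𝓕 (⇑f) ξ := by
      have hfi : Integrable (𝓕 (⇑f)) := by rw [← SchwartzMap.fourier_coe]; exact SchwartzMap.integrable _
      have hfc : Continuous (𝓕 (⇑f)) := by rw [← SchwartzMap.fourier_coe]; exact SchwartzMap.continuous _
      have hec : Continuous (fun ξ : Ed d => Complex.exp (Complex.I * (t : ℂ) * (‖ξ‖ : ℂ))) := by fun_prop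
      have hc : Continuous (fun ξ => Complex.exp (Complex.I * (t : ℂ) * (‖ξ‖ : ℂ)) * 𝓕 (⇑f) ξ) := hec.mul hfc
      have hi2 : Integrable (fun ξ => Complex.exp (Complex.I * (t : ℂ) * (‖ξ‖ : ℂ)) * 𝓕 (⇑f) ξ) := by
        refine hfi.bdd_mul (c := 1) hec.aestronglyMeasurable (Filter.Eventually.of_forall fun ξ => ?_)
        rw [show Complex.I * (t : ℂ) * (‖ξ‖ : ℂ) = ((t * ‖ξ‖ : ℝ) : ℂ) * Complex.I by push_cast; ring, Complex.norm_exp_ofReal_mul_I]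
      apply hc.fourier_fourierInv_eq hi2
      have : 𝓕 (fun ξ => Complex.exp (Complex.I * (t : ℂ) * (‖ξ‖ : ℂ)) * 𝓕 (⇑f) ξ) = fun x => waveOp d t ⇑f (-x) := by
        ext x; rw [waveOp, Real.fourierInv_eq_fourier_neg, neg_neg]
      rw [this]
      exact hi.comp_neg
    rw [Pk, Wv, this]
    refine le_of_eq ?_
    refine congrArg (fun g : Ed d → ℂ => ‖𝓕⁻ g x‖ₑ) (funext fun ξ => ?_)
    ring
  · have : 𝓕 (waveOp d t ⇑f) = 0 := by
      ext x
      rw [Real.fourier_eq, Pi.zero_apply, integral_undef]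
      intro h
      apply hi
      refine (Real.fourierIntegral_convergent_iff x).1 h
    rw [Pk, this]
    simp [Real.fourierInv_eq']

lemma high_freq {d : ℕ} (hd : 4 ≤ d) (η₀ : SchwartzMap (Ed d) ℂ)
    (hsupp : ∀ ξ : Ed d, 𝓕 (⇑η₀) ξ ≠ 0 → 1 / 2 < ‖ξ‖ ∧ ‖ξ‖ < 2)
    (hsum : ∀ ξ : Ed d, ξ ≠ 0 → ∑' s : ℤ, (𝓕 (⇑η₀) ((2 : ℝ) ^ (-s) • ξ)) ^ 2 = 1) {q p : ℝ} (hpq : q.HolderConjugate p) :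
    ∃ A : ℝ≥0∞, A ≠ ⊤ ∧ ∀ (f : SchwartzMap (Ed d) ℂ) (k : ℕ), k ≠ 0 → ∃ (h : Ed d → ℂ) (H : ℝ), Continuous h ∧ (∀ y, ‖h y‖ ≤ H) ∧
      (∀ t ∈ Icc (1:ℝ) 2, ∀ x, Tg d (mm d) (ek k) h (x, t) = Wv d η₀ k t ⇑f x) ∧
      ∫⁻ y, ‖h y‖ₑ ^ q ≤ A * eLpNorm (Pk d η₀ k ⇑f) (ENNReal.ofReal q) volume ^ q := by
  obtain ⟨a, ha⟩ := annular (d := d) (fun ξ => (((‖ξ‖ ^ (mm d))⁻¹ * Real.exp ‖ξ‖ : ℝ) : ℂ)) (fun ξ hξ =>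
    Complex.ofRealCLM.contDiff.contDiffAt.comp ξ ((((contDiffAt_norm ℝ hξ).pow _).inv (by positivity)).mul (contDiffAt_norm ℝ hξ).exp))
  have hq := hpq.pos
  refine ⟨(∫⁻ x, ‖𝓕⁻ (⇑a) x‖ₑ) ^ q, ENNReal.rpow_ne_top_of_nonneg hq.le (symb_fin a), ?_⟩
  intro f k hk
  have hfi : Integrable (𝓕 (⇑f)) := by rw [← SchwartzMap.fourier_coe]; exact SchwartzMap.integrable _
  have hmi := lpMult_int η₀ hsupp hsum k hfi
  set φ : Ed d → ℂ := fun ξ => lpMult d η₀ k ξ * 𝓕 (⇑f) ξ with hφ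
  have hai := schw_mul a (ek k) hmi
  have hk0 := ek_pos k
  refine ⟨𝓕⁻ (fun ξ => a (ek k • ξ) * φ ξ), ∫ ξ, ‖a (ek k • ξ) * φ ξ‖, continuous_fourierInv_of_integrable hai, ?_, ?_, ?_⟩
  · intro y
    rw [Real.fourierInv_eq']
    refine (norm_integral_le_integral_norm _).trans (le_of_eq ?_)
    congr 1; ext v
    rw [norm_smul, Complex.norm_exp_ofReal_mul_I, one_mul]
  · intro t ht x
    have hm1 : 1 ≤ mm d := by unfold mm; omega
    rw [Tg]
    simp only
    rw [← conv_fi (integrable_Kk d (mm d) (by omega) hm1 hk0 (ek_le k) ht.1 ht.2) hai x,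
      fourier_Kk d (mm d) (by omega) hm1 hk0 (ek_le k) ht.1 ht.2, Wv]
    refine congrArg (fun g : Ed d → ℂ => 𝓕⁻ g x) (funext fun ξ => ?_)
    simp only [hφ]
    by_cases h : lpMult d η₀ k ξ = 0
    · rw [h]; simp
    · have hne : 𝓕 (⇑η₀) (ek k • ξ) ≠ 0 := by
        intro h'
        apply h
        simp only [lpMult, hk, if_false]
        rw [← ek_zpow, h']; simp
      have hs := hsupp _ hne
      rw [ha (ek k • ξ) (by linarith [hs.1]) hs.2.le]
      rw [norm_smul, Real.norm_of_nonneg hk0.le] at hs ⊢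
      have hξ : ‖ξ‖ ≠ 0 := by
        intro h0; rw [h0] at hs; linarith [hs.1]
      have e1 : Mk d (mm d) (ek k) t ξ * (((ek k * ‖ξ‖) ^ (mm d))⁻¹ * Real.exp (ek k * ‖ξ‖) : ℝ) = Complex.exp (Complex.I * (t : ℂ) * (‖ξ‖ : ℂ)) := by
        have c1 : (ek k : ℂ) ≠ 0 := by exact_mod_cast hk0.ne'
        have c2 : (‖ξ‖ : ℂ) ≠ 0 := by exact_mod_cast hξ
        simp only [Mk, Mz]
        push_cast
        rw [show Complex.I * (t : ℂ) * (‖ξ‖ : ℂ) = -((ek k : ℂ) - t * Complex.I) * ‖ξ‖ + ek k * ‖ξ‖ by ring, Complex.exp_add, mul_pow]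
        field_simp
      rw [← e1]; ring
  · rw [eLp_pow _ hq]
    exact symb a hpq hk0 hmi

/-- the Triebel–Lizorkin strengthening of the local smoothing estimate:
for `d ≥ 4`, `(2d-2)/(d-3) < q < ∞` and `α = d(1/2 - 1/q) - 1/2`,
`(∫_1^2 ‖∑_k |P_k e^{it√(-Δ)} f|‖_q^q dt)^{1/q} ≤ C (∑_k 2^{kαq} ‖P_k f‖_q^q)^{1/q}`. -/
theorem triebel_lizorkin_smoothing
    (d : ℕ) (hd : 4 ≤ d) (q : ℝ) (hq : (2 * (d : ℝ) - 2) / ((d : ℝ) - 3) < q)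
    (η₀ : SchwartzMap (Ed d) ℂ)
    (hrad : ∀ x y : Ed d, ‖x‖ = ‖y‖ → η₀ x = η₀ y)
    (hsupp : ∀ ξ : Ed d, 𝓕 (⇑η₀) ξ ≠ 0 → 1 / 2 < ‖ξ‖ ∧ ‖ξ‖ < 2)
    (hsum : ∀ ξ : Ed d, ξ ≠ 0 → ∑' s : ℤ, (𝓕 (⇑η₀) ((2 : ℝ) ^ (-s) • ξ)) ^ 2 = 1) :
    ∃ C : ℝ, 0 < C ∧ ∀ f : SchwartzMap (Ed d) ℂ,
      (∫⁻ t in Set.Icc (1 : ℝ) 2,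
          eLpNorm (fun x => ∑' k : ℕ, ‖Pk d η₀ k (waveOp d t ⇑f) x‖)
              (ENNReal.ofReal q) volume ^ q) ^ (1 / q)
      ≤ ENNReal.ofReal C *
          (∑' k : ℕ,
              ENNReal.ofReal
                  ((2 : ℝ) ^ ((k : ℝ) * ((d : ℝ) * (1 / 2 - 1 / q) - 1 / 2) * q)) *
                eLpNorm (Pk d η₀ k ⇑f) (ENNReal.ofReal q) volume ^ q) ^ (1 / q) := by
  have hd4 : (4:ℝ) ≤ d := by exact_mod_cast hd
  have hq' : 2 * (d:ℝ) - 2 < q * (d - 3) := by rwa [div_lt_iff₀ (by linarith)] at hq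
  have hq1 : 1 < q := by
    refine lt_trans ?_ hq
    rw [lt_div_iff₀ (by linarith)]; linarith
  have hq0 : 0 < q := by linarith
  have hpq : q.HolderConjugate (q / (q - 1)) := Real.HolderConjugate.conjExponent hq1
  have hp2 : q / (q - 1) * (d + 1) < 2 * (d - 1) := by
    rw [div_mul_eq_mul_div, div_lt_iff₀ (by linarith)]
    nlinarith
  obtain ⟨M, hM, HM⟩ := low_freq η₀ hsupp hsum hpq
  obtain ⟨A, hA, HA⟩ := high_freq hd η₀ hsupp hsum hpq
  obtain ⟨C, hC, HC⟩ := dual_main d hd hpq hp2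
  set D : ℝ≥0∞ := 2 ^ (q - 1) * (ENNReal.ofReal M ^ q + C * A) with hD
  have hDt : D ≠ ⊤ := by
    refine ENNReal.mul_ne_top (ENNReal.rpow_ne_top_of_nonneg (by linarith) (by simp)) (ENNReal.add_ne_top.2 ⟨?_, ENNReal.mul_ne_top hC hA⟩)
    exact ENNReal.rpow_ne_top_of_nonneg hq0.le ENNReal.ofReal_ne_top
  have hDq : D ^ (1 / q) ≠ ⊤ := ENNReal.rpow_ne_top_of_nonneg (by positivity) hDt
  refine ⟨(D ^ (1 / q)).toReal + 1, by positivity, ?_⟩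
  intro f
  set R : ℝ≥0∞ := ∑' k : ℕ, ENNReal.ofReal ((2 : ℝ) ^ ((k : ℝ) * ((d : ℝ) * (1 / 2 - 1 / q) - 1 / 2) * q)) *
                eLpNorm (Pk d η₀ k ⇑f) (ENNReal.ofReal q) volume ^ q with hR
  suffices hmain : (∫⁻ t in Set.Icc (1 : ℝ) 2, eLpNorm (fun x => ∑' k : ℕ, ‖Pk d η₀ k (waveOp d t ⇑f) x‖) (ENNReal.ofReal q) volume ^ q) ≤ D * R by
    refine (ENNReal.rpow_le_rpow hmain (by positivity)).trans ?_
    rw [ENNReal.mul_rpow_of_nonneg _ _ (by positivity)]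
    gcongr
    rw [ENNReal.ofReal_add (by positivity) (by norm_num), ENNReal.ofReal_toReal hDq]
    exact le_self_add
  have hex : ∀ k : ℕ, ∃ (h : Ed d → ℂ) (H : ℝ), Continuous h ∧ (∀ y, ‖h y‖ ≤ H) ∧
      (k ≠ 0 → ∀ t ∈ Icc (1:ℝ) 2, ∀ x, Tg d (mm d) (ek k) h (x, t) = Wv d η₀ k t ⇑f x) ∧
      ∫⁻ y, ‖h y‖ₑ ^ q ≤ A * eLpNorm (Pk d η₀ k ⇑f) (ENNReal.ofReal q) volume ^ q := by
    intro k
    by_cases hk : k = 0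
    · refine ⟨fun _ => 0, 0, continuous_const, by simp, fun h => absurd hk h, ?_⟩
      simp [hq0]
    · obtain ⟨h, H, h1, h2, h3, h4⟩ := HA f k hk
      exact ⟨h, H, h1, h2, fun _ => h3, h4⟩
  choose h H h1 h2 h3 h4 using hex
  have hfi : Integrable (𝓕 (⇑f)) := by rw [← SchwartzMap.fourier_coe]; exact SchwartzMap.integrable _
  have hTm : ∀ k, Measurable (Tg d (mm d) (ek k) (h k)) := fun k => measurable_Tg d _ (ek_pos k) (h1 k).measurable
  set S : Ed d × ℝ → ℝ≥0∞ := fun z => ∑' k, ‖Tg d (mm d) (ek k) (h k) z‖ₑ with hS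
  have hSm : Measurable S := Measurable.tsum fun k => (hTm k).enorm
  have hSq : Measurable (fun z => S z ^ q) := hSm.pow_const q
  have b1 : ∫⁻ z, S z ^ q ∂(lam d) ≤ C * A * R := by
    refine (HC h (fun k => (h1 k).measurable) H h2).trans ?_
    rw [mul_assoc, hR, ← ENNReal.tsum_mul_left (a := A)]
    refine mul_le_mul' le_rfl (ENNReal.tsum_le_tsum fun k => ?_)
    have : ek k ^ (-((d:ℝ) * (1 / 2 - 1 / q) - 1 / 2) * q) = (2 : ℝ) ^ ((k : ℝ) * ((d : ℝ) * (1 / 2 - 1 / q) - 1 / 2) * q) := by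
      rw [ek, ← Real.rpow_mul (by norm_num)]; congr 1; ring
    rw [this, mul_left_comm]
    gcongr
    exact h4 k
  have b0 : ∀ t ∈ Icc (1:ℝ) 2, ∫⁻ x, ‖Wv d η₀ 0 t ⇑f x‖ₑ ^ q ≤ ENNReal.ofReal M ^ q * R := by
    intro t ht
    have hk := HM (fun ξ => lpMult d η₀ 0 ξ * 𝓕 (⇑f) ξ) (lpMult_int η₀ hsupp hsum 0 hfi) (fun ξ hξ => by
      rw [lpMult_zero η₀ hsupp hsum, indicator_of_notMem (by simpa using hξ), zero_mul]) t ht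
    have hk2 := ENNReal.rpow_le_rpow hk hq0.le
    rw [eLp_pow _ hq0, ENNReal.mul_rpow_of_nonneg _ _ hq0.le] at hk2
    refine hk2.trans ?_
    gcongr
    have := ENNReal.le_tsum (f := fun k : ℕ => ENNReal.ofReal ((2 : ℝ) ^ ((k : ℝ) * ((d : ℝ) * (1 / 2 - 1 / q) - 1 / 2) * q)) *
                eLpNorm (Pk d η₀ k ⇑f) (ENNReal.ofReal q) volume ^ q) 0
    refine le_trans (le_of_eq ?_) this
    simp [Pk]
  have b2 : ∀ t ∈ Icc (1:ℝ) 2, eLpNorm (fun x => ∑' k : ℕ, ‖Pk d η₀ k (waveOp d t ⇑f) x‖) (ENNReal.ofReal q) volume ^ q ≤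
      2 ^ (q - 1) * (ENNReal.ofReal M ^ q * R + ∫⁻ x, S (x, t) ^ q) := by
    intro t ht
    rw [eLp_pow _ hq0]
    have pt : ∀ x, ‖∑' k : ℕ, ‖Pk d η₀ k (waveOp d t ⇑f) x‖‖ₑ ≤ ‖Wv d η₀ 0 t ⇑f x‖ₑ + S (x, t) := by
      intro x
      refine enorm_tsum_le_tsum_enorm.trans ?_
      have hk : ∀ k : ℕ, ‖‖Pk d η₀ k (waveOp d t ⇑f) x‖‖ₑ ≤ (if k = 0 then ‖Wv d η₀ 0 t ⇑f x‖ₑ else 0) + ‖Tg d (mm d) (ek k) (h k) (x, t)‖ₑ := by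
        intro k
        rw [enorm_norm]
        refine (Pk_wave η₀ k t f x).trans ?_
        by_cases hk : k = 0
        · subst hk; simp
        · rw [h3 k hk t ht x]; simp [hk]
      refine (ENNReal.tsum_le_tsum hk).trans ?_
      rw [ENNReal.tsum_add, tsum_ite_eq]
    calc _ ≤ ∫⁻ x, 2 ^ (q - 1) * (‖Wv d η₀ 0 t ⇑f x‖ₑ ^ q + S (x, t) ^ q) := by
          refine lintegral_mono fun x => ?_
          exact (ENNReal.rpow_le_rpow (pt x) hq0.le).trans (ENNReal.rpow_add_le_mul_rpow_add_rpow _ _ hq1.le)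
      _ = 2 ^ (q - 1) * ((∫⁻ x, ‖Wv d η₀ 0 t ⇑f x‖ₑ ^ q) + ∫⁻ x, S (x, t) ^ q) := by
          rw [lintegral_const_mul' _ _ (ENNReal.rpow_ne_top_of_nonneg (by linarith) (by simp)), lintegral_add_right]
          exact hSq.comp measurable_prodMk_right
      _ ≤ _ := by gcongr; exact b0 t ht
  calc _ ≤ ∫⁻ t in Set.Icc (1 : ℝ) 2, 2 ^ (q - 1) * (ENNReal.ofReal M ^ q * R + ∫⁻ x, S (x, t) ^ q) :=
        setLIntegral_mono' measurableSet_Icc b2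
    _ = 2 ^ (q - 1) * (ENNReal.ofReal M ^ q * R + ∫⁻ z, S z ^ q ∂(lam d)) := by
        rw [lintegral_const_mul' _ _ (ENNReal.rpow_ne_top_of_nonneg (by linarith) (by simp)), lintegral_add_left measurable_const,
          lintegral_prod_symm _ hSq.aemeasurable, lintegral_const]
        congr 2
        rw [Measure.restrict_apply MeasurableSet.univ, univ_inter, Real.volume_Icc]
        norm_num
    _ ≤ 2 ^ (q - 1) * (ENNReal.ofReal M ^ q * R + C * A * R) := by gcongr
    _ = _ := by rw [hD]; ring
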